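/- Let k ≥ 4 and let G be a k-critical graph that is 3-connected and not isomorphic to the complete graph K_k. Then ρ_{k,G}(V(G)) ≤ y_k, where y_k = max{2k−6, k²−5k+2}; in particular, every k-extremal graph other than K_k has a separating set of size 2. -/

import Mathlib

open SimpleGraph

section Defs

variable {V : Type*}

instance instDecidableInduceAdj (G : SimpleGraph V) [DecidableRel G.Adj] (s : Set V) :
    DecidableRel (G.induce s).Adj := fun a b => ‹DecidableRel G.Adj› a.1 b.1

instance instDecidableDeleteEdgeAdj [DecidableEq V] (G : SimpleGraph V) [DecidableRel G.Adj]
    (e : Sym2 V) : DecidableRel (G.deleteEdges {e}).Adj := fun a b =>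
  decidable_of_iff (G.Adj a b ∧ ¬s(a, b) = e) (by simp)

/-- The `k`-potential of a vertex subset `R` of a graph `G`:
`ρ_{k,G}(R) = (k+1)(k-2)|R| - 2(k-1)|E(G[R])|`, where `G[R]` is the induced subgraph. -/
def potential (k : ℕ) (G : SimpleGraph V) [Fintype V] [DecidableEq V] [DecidableRel G.Adj]
    (R : Finset V) : ℤ :=
  ((k : ℤ) + 1) * ((k : ℤ) - 2) * R.card
    - 2 * ((k : ℤ) - 1) * ((G.induce (R : Set V)).edgeFinset.card)

/-- A graph is `k`-critical if its chromatic number is `k` and every proper subgraph is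
`(k-1)`-colorable. -/
def IsKCritical (k : ℕ) (G : SimpleGraph V) : Prop :=
  G.chromaticNumber = k ∧ ∀ H : SimpleGraph V, H < G → H.Colorable (k - 1)

/-- The graph underlying the DHGO-composition: delete the edge `xy` from `G₁`, split the vertex
`z` of `G₂` into two vertices, identify `x` with the half of `z` joined to the neighbors of `z`
lying in `P` and identify `y` with the half joined to the remaining neighbors of `z`. -/
def dhgoGraph {V₁ V₂ : Type*} (G₁ : SimpleGraph V₁) (G₂ : SimpleGraph V₂)
    (x y : V₁) (z : V₂) (P : Set V₂) :
    SimpleGraph (V₁ ⊕ {w : V₂ // w ≠ z}) :=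
  SimpleGraph.fromRel (fun a b =>
    match a, b with
    | Sum.inl a, Sum.inl b => G₁.Adj a b ∧ s(a, b) ≠ s(x, y)
    | Sum.inl a, Sum.inr b => (a = x ∧ (b : V₂) ∈ P) ∨ (a = y ∧ (b : V₂) ∈ G₂.neighborSet z \ P)
    | Sum.inr a, Sum.inr b => G₂.Adj a b
    | _, _ => False)

/-- `G` is a DHGO-composition of `G₁` and `G₂`: some edge `xy` of `G₁` is deleted, some vertex
`z` of `G₂` is split into two vertices of positive degree (its neighborhood is partitioned into
two nonempty parts `P` and `N(z) \ P`), and `x`, `y` are identified with the two halves of `z`. -/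
def IsDHGO {V₁ V₂ U : Type*} (G : SimpleGraph U) (G₁ : SimpleGraph V₁) (G₂ : SimpleGraph V₂) :
    Prop :=
  ∃ (x y : V₁) (z : V₂) (P : Set V₂),
    G₁.Adj x y ∧ P ⊆ G₂.neighborSet z ∧ P.Nonempty ∧ (G₂.neighborSet z \ P).Nonempty ∧
    Nonempty (G ≃g dhgoGraph G₁ G₂ x y z P)

/-- `k`-Ore graphs on the canonical finite vertex types `Fin n`: graphs obtained from copies of
`K_k` by a sequence of DHGO-compositions. -/
inductive IsOreFin (k : ℕ) : ∀ {n : ℕ}, SimpleGraph (Fin n) → Prop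
  | complete {n : ℕ} {G : SimpleGraph (Fin n)}
      (h : Nonempty (G ≃g (⊤ : SimpleGraph (Fin k)))) : IsOreFin k G
  | comp {n₁ n₂ n : ℕ} {G₁ : SimpleGraph (Fin n₁)} {G₂ : SimpleGraph (Fin n₂)}
      {G : SimpleGraph (Fin n)} (h₁ : IsOreFin k G₁) (h₂ : IsOreFin k G₂)
      (h : IsDHGO G G₁ G₂) : IsOreFin k G

/-- A graph is a `k`-Ore graph if it is obtained from copies of `K_k` by a sequence of
DHGO-compositions. -/
def IsKOre (k : ℕ) {V : Type*} (G : SimpleGraph V) : Prop :=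
  ∃ (n : ℕ) (H : SimpleGraph (Fin n)), IsOreFin k H ∧ Nonempty (G ≃g H)

/-- `y_k = max {2k - 6, k² - 5k + 2}`. -/
def yk (k : ℕ) : ℤ := max (2 * (k : ℤ) - 6) ((k : ℤ) ^ 2 - 5 * (k : ℤ) + 2)

/-- A `k`-critical graph is `k`-extremal if `2(k-1)|E(G)| = (k+1)(k-2)|V(G)| - k(k-3)`. -/
def IsKExtremal (k : ℕ) {V : Type*} [Fintype V] [DecidableEq V] (G : SimpleGraph V)
    [DecidableRel G.Adj] : Prop :=
  IsKCritical k G ∧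
    2 * ((k : ℤ) - 1) * G.edgeFinset.card =
      ((k : ℤ) + 1) * ((k : ℤ) - 2) * Fintype.card V - (k : ℤ) * ((k : ℤ) - 3)

/-- A graph is 3-connected if it has more than 3 vertices and deleting any set of at most 2
vertices leaves it connected. -/
def IsThreeConnected {V : Type*} [Fintype V] (G : SimpleGraph V) : Prop :=
  3 < Fintype.card V ∧ ∀ s : Set V, s.ncard ≤ 2 → (G.induce sᶜ).Connected

/-- `Q` is a `k`-quasi-`xy`-vertex: `G[Q]` is `(k-1)`-colorable, every proper `(k-1)`-coloring
of `G[Q]` gives `x` and `y` the same color, and for every edge `e` of `G[Q]` the graph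
`G[Q] - e` has a proper `(k-1)`-coloring giving `x` and `y` different colors. -/
def IsQuasiVertex (k : ℕ) {V : Type*} [DecidableEq V] (G : SimpleGraph V) (x y : V)
    (Q : Set V) : Prop :=
  ∃ (hx : x ∈ Q) (hy : y ∈ Q),
    (G.induce Q).Colorable (k - 1) ∧
    (∀ C : (G.induce Q).Coloring (Fin (k - 1)), C ⟨x, hx⟩ = C ⟨y, hy⟩) ∧
    (∀ a b : Q, (G.induce Q).Adj a b →
      ∃ C : ((G.induce Q).deleteEdges {s(a, b)}).Coloring (Fin (k - 1)),
        C ⟨x, hx⟩ ≠ C ⟨y, hy⟩)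

/-- A set `S` of vertices is standard if `ρ_{k,G}(S) = (k+1)(k-2)`, `G` has a separating set
`{x,y} ⊆ S` such that `S - {x,y}` induces a component of `G - {x,y}`, and `S` is a
`k`-quasi-`xy`-vertex. -/
def IsStandardSet (k : ℕ) {V : Type*} [Fintype V] [DecidableEq V] (G : SimpleGraph V)
    [DecidableRel G.Adj] (S : Finset V) : Prop :=
  potential k G S = ((k : ℤ) + 1) * ((k : ℤ) - 2) ∧
  ∃ x y : V, x ≠ y ∧ x ∈ S ∧ y ∈ S ∧
    ¬(G.induce ({x, y}ᶜ : Set V)).Connected ∧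
    (G.induce ((S : Set V) \ {x, y})).Connected ∧
    (∀ a ∈ (S : Set V) \ {x, y}, ∀ b : V, G.Adj a b → b ∈ (S : Set V) ∪ {x, y}) ∧
    IsQuasiVertex k G x y (S : Set V)

end Defs

namespace KY
open Finset Classical
variable {V : Type*} {q : ℕ} {H H' J F : SimpleGraph V} {S T A B C R X Z N P Y : Finset V} {u v w x y a b z s t : V}

noncomputable def E (H : SimpleGraph V) (A B : Finset V) : ℤ :=
  ∑ u ∈ A, ∑ v ∈ B, if H.Adj u v then 1 else 0

noncomputable def pot (q : ℕ) (H : SimpleGraph V) (S : Finset V) : ℤ :=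
  ((q:ℤ)^2 + q - 2) * S.card - q * E H S S

noncomputable def nb (H : SimpleGraph V) (S : Finset V) (v : V) : Finset V := S.filter (H.Adj v)

theorem mem_nb : u ∈ nb H S v ↔ u ∈ S ∧ H.Adj v u := by simp [nb]
theorem nb_sub : nb H S v ⊆ S := filter_subset _ _

theorem E_sym (H : SimpleGraph V) (A B) : E H A B = E H B A := by
  unfold E; rw [sum_comm]; simp [SimpleGraph.adj_comm]

theorem E_ul (H : SimpleGraph V) (h : Disjoint A B) (C) : E H (A ∪ B) C = E H A C + E H B C := by
  unfold E; rw [sum_union h]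

theorem E_ur (H : SimpleGraph V) (h : Disjoint A B) (C) : E H C (A ∪ B) = E H C A + E H C B := by
  rw [E_sym, E_ul H h, E_sym H A, E_sym H B]

theorem E_nn (H : SimpleGraph V) (A B) : 0 ≤ E H A B := by
  unfold E; exact sum_nonneg fun _ _ => sum_nonneg fun _ _ => by split_ifs <;> norm_num

theorem E_mono (hA : A ⊆ S) (hB : B ⊆ T) (h : ∀ u ∈ A, ∀ v ∈ B, H.Adj u v → J.Adj u v) :
    E H A B ≤ E J S T := by
  unfold E
  refine le_trans (sum_le_sum (g := fun u => ∑ v ∈ T, if J.Adj u v then (1:ℤ) else 0) fun u hu => ?_)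
    (sum_le_sum_of_subset_of_nonneg hA fun _ _ _ => sum_nonneg fun _ _ => by split_ifs <;> norm_num)
  refine le_trans (sum_le_sum (g := fun v => if J.Adj u v then (1:ℤ) else 0) fun v hv => ?_)
    (sum_le_sum_of_subset_of_nonneg hB fun _ _ _ => by split_ifs <;> norm_num)
  have := h u hu v hv
  split_ifs <;> simp_all

theorem E_ms (H : SimpleGraph V) (hA : A ⊆ S) (hB : B ⊆ T) : E H A B ≤ E H S T :=
  E_mono hA hB fun _ _ _ _ h => h

theorem E_congr (h : ∀ u ∈ A, ∀ v ∈ B, (H.Adj u v ↔ J.Adj u v)) : E H A B = E J A B :=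
  le_antisymm (E_mono subset_rfl subset_rfl fun u hu v hv => (h u hu v hv).1)
    (E_mono subset_rfl subset_rfl fun u hu v hv => (h u hu v hv).2)

theorem E_zero (h : ∀ u ∈ A, ∀ v ∈ B, ¬ H.Adj u v) : E H A B = 0 :=
  sum_eq_zero fun u hu => sum_eq_zero fun v hv => by simp [h u hu v hv]

theorem E_one (H : SimpleGraph V) (v : V) (S) : E H {v} S = (nb H S v).card := by
  simp [E, nb]

theorem E_sum (H : SimpleGraph V) (A S : Finset V) : E H A S = ∑ v ∈ A, ((nb H S v).card : ℤ) := by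
  simp [E, nb]

@[simp] theorem E_self (H : SimpleGraph V) (v : V) : E H {v} {v} = 0 := by simp [E]
@[simp] theorem E_empty (H : SimpleGraph V) (S) : E H ∅ S = 0 := by simp [E]
@[simp] theorem E_empty' (H : SimpleGraph V) (S) : E H S ∅ = 0 := by simp [E]

theorem E_lt (h : ∀ u ∈ A, ∀ v ∈ B, H.Adj u v → J.Adj u v) (hu : u ∈ A) (hv : v ∈ B)
    (h1 : J.Adj u v) (h2 : ¬ H.Adj u v) : E H A B + 1 ≤ E J A B := by
  have key : ∀ K : SimpleGraph V, E K A B = E K (A.erase u) B + E K {u} (B.erase v) +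
      (if K.Adj u v then 1 else 0) := by
    intro K
    have e1 : E K A B = E K (A.erase u) B + E K {u} B := by
      rw [← E_ul K (by simp), union_comm, ← insert_eq, insert_erase hu]
    have e2 : E K {u} B = E K {u} (B.erase v) + E K {u} {v} := by
      rw [← E_ur K (by simp), union_comm, ← insert_eq, insert_erase hv]
    have e3 : E K {u} {v} = if K.Adj u v then 1 else 0 := by simp only [E, sum_singleton]
    rw [e1, e2, e3]; ring
  rw [key H, key J]
  simp only [h1, h2, if_true, if_false]
  have := E_mono (H := H) (J := J) (erase_subset u A |> fun _ => subset_refl (A.erase u))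
    (subset_refl B) fun x hx y hy => h x (mem_of_mem_erase hx) y hy
  have := E_mono (H := H) (J := J) (subset_refl {u})
    (subset_refl (B.erase v)) fun x hx y hy => h x (by simp at hx; rwa [hx]) y (mem_of_mem_erase hy)
  linarith

theorem E_lt2 (h : ∀ u ∈ A, ∀ v ∈ A, H.Adj u v → J.Adj u v) (hu : u ∈ A) (hv : v ∈ A)
    (h1 : J.Adj u v) (h2 : ¬ H.Adj u v) : E H A A + 2 ≤ E J A A := by
  have hne := h1.ne
  have key : ∀ K : SimpleGraph V, E K A A = ∑ x ∈ A, ∑ y ∈ A,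
      ((if (K.Adj x y ∧ ¬ (x = u ∧ y = v) ∧ ¬ (x = v ∧ y = u)) then 1 else 0) +
       (if K.Adj u v then ((if x = u ∧ y = v then (1:ℤ) else 0) + (if x = v ∧ y = u then 1 else 0))
        else 0)) := by
    intro K
    unfold E
    refine sum_congr rfl fun x _ => sum_congr rfl fun y _ => ?_
    have := K.adj_comm u v
    by_cases c1 : x = u ∧ y = v
    · grind
    · grind
  rw [key H, key J]
  simp only [h1, h2, if_true, if_false, sum_add_distrib]
  have t1 : ∑ x ∈ A, ∑ y ∈ A, (if x = u ∧ y = v then (1:ℤ) else 0) = 1 := by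
    simp [ite_and, hu, hv]
  have t2 : ∑ x ∈ A, ∑ y ∈ A, (if x = v ∧ y = u then (1:ℤ) else 0) = 1 := by
    simp [ite_and, hu, hv]
  rw [t1, t2]
  have : ∑ x ∈ A, ∑ y ∈ A, (if (H.Adj x y ∧ ¬ (x = u ∧ y = v) ∧ ¬ (x = v ∧ y = u)) then (1:ℤ) else 0)
      ≤ ∑ x ∈ A, ∑ y ∈ A, (if (J.Adj x y ∧ ¬ (x = u ∧ y = v) ∧ ¬ (x = v ∧ y = u)) then 1 else 0) := by
    refine sum_le_sum fun x hx => sum_le_sum fun y hy => ?_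
    have := h x hx y hy
    split_ifs <;> simp_all
  simp only [sum_const_zero]
  linarith

theorem pot_union (q : ℕ) (H : SimpleGraph V) (h : Disjoint A B) :
    pot q H (A ∪ B) = pot q H A + pot q H B - 2 * q * E H A B := by
  unfold pot
  rw [E_ul H h, E_ur H h, E_ur H h, E_sym H B A, card_union_of_disjoint h]; push_cast; ring

theorem pot_insert (q : ℕ) (H : SimpleGraph V) (h : v ∉ S) :
    pot q H (insert v S) = pot q H S + ((q:ℤ)^2 + q - 2) - 2 * q * (nb H S v).card := by
  rw [insert_eq, pot_union q H (by simpa), E_one]; simp [pot]; ring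

theorem pot_erase (q : ℕ) (H : SimpleGraph V) (h : v ∈ S) :
    pot q H (S.erase v) = pot q H S - ((q:ℤ)^2 + q - 2) + 2 * q * (nb H S v).card := by
  have := pot_insert q H (notMem_erase v S)
  rw [insert_erase h] at this
  have e : nb H (S.erase v) v = nb H S v := by
    ext u; simp only [mem_nb, mem_erase]
    exact ⟨fun h => ⟨h.1.2, h.2⟩, fun h => ⟨⟨h.2.ne.symm, h.1⟩, h.2⟩⟩
  rw [e] at this; linarith

theorem pot_submod (q : ℕ) (H : SimpleGraph V) (A B) :
    pot q H (A ∪ B) + pot q H (A ∩ B) ≤ pot q H A + pot q H B := by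
  have h1 : A ∪ B = A ∪ (B \ A) := by simp
  have h2 : B = (A ∩ B) ∪ (B \ A) := by ext; simp; tauto
  have d2 : Disjoint (A ∩ B) (B \ A) :=
    disjoint_of_subset_left inter_subset_left disjoint_sdiff
  have e2 := pot_union q H d2
  rw [← h2] at e2
  rw [h1, pot_union q H disjoint_sdiff, e2]
  have := E_ms H (inter_subset_left (s₁ := A) (s₂ := B)) (subset_refl (B \ A))
  have hq : (0:ℤ) ≤ q := by positivity
  nlinarith

theorem pot_mg (q : ℕ) (h : ∀ u ∈ S, ∀ v ∈ S, H.Adj u v → J.Adj u v) : pot q J S ≤ pot q H S := by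
  have := E_mono (H := H) (J := J) (subset_refl S) (subset_refl S) h
  have hq : (0:ℤ) ≤ q := by positivity
  unfold pot; nlinarith

theorem pot_congr (q : ℕ) (h : ∀ u ∈ S, ∀ v ∈ S, (H.Adj u v ↔ J.Adj u v)) :
    pot q H S = pot q J S := by unfold pot; rw [E_congr h]

theorem E_cl (H : SimpleGraph V) (S : Finset V) : E H S S ≤ S.card * (S.card - 1) := by
  rw [E_sum]
  calc _ ≤ ∑ v ∈ S, ((S.card : ℤ) - 1) := sum_le_sum fun v hv => by
        have : nb H S v ⊆ S.erase v := fun u hu => by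
          rw [mem_nb] at hu; exact mem_erase.2 ⟨hu.2.ne.symm, hu.1⟩
        have := card_le_card this
        rw [card_erase_of_mem hv] at this
        have := card_pos.2 ⟨v, hv⟩
        omega
    _ = _ := by simp; ring

def Clq (H : SimpleGraph V) (S : Finset V) : Prop := ∀ u ∈ S, ∀ v ∈ S, u ≠ v → H.Adj u v

theorem Clq.mono (h : Clq H S) (hT : T ⊆ S) : Clq H T := fun u hu v hv => h u (hT hu) v (hT hv)

theorem Clq.nb (h : Clq H S) (hv : v ∈ S) : nb H S v = S.erase v := by
  ext u; simp only [mem_nb, mem_erase]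
  exact ⟨fun k => ⟨k.2.ne.symm, k.1⟩, fun k => ⟨k.2, h v hv u k.2 k.1.symm⟩⟩

theorem Clq.E (h : Clq H S) : E H S S = S.card * (S.card - 1) := by
  rw [E_sum]
  calc _ = ∑ v ∈ S, ((S.card : ℤ) - 1) := sum_congr rfl fun v hv => by
        rw [h.nb hv, card_erase_of_mem hv]
        have := card_pos.2 ⟨v, hv⟩
        omega
    _ = _ := by simp; ring

theorem pot_clq_le (q : ℕ) (H : SimpleGraph V) (S) :
    (S.card:ℤ) * ((q:ℤ)^2 + 2*q - 2 - q * S.card) ≤ pot q H S := by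
  have := E_cl H S
  have hq : (0:ℤ) ≤ q := by positivity
  unfold pot; nlinarith

theorem Clq.pot (q : ℕ) (h : Clq H S) :
    pot q H S = (S.card:ℤ) * ((q:ℤ)^2 + 2*q - 2 - q * S.card) := by
  unfold KY.pot; rw [h.E]; ring

def Ok (H : SimpleGraph V) (S : Finset V) (f : V → Fin q) : Prop :=
  ∀ u ∈ S, ∀ v ∈ S, H.Adj u v → f u ≠ f v

def Col (q : ℕ) (H : SimpleGraph V) (S : Finset V) : Prop := ∃ f : V → Fin q, Ok H S f

structure Crit (q : ℕ) (H : SimpleGraph V) (S : Finset V) : Prop where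
  nc : ¬ Col q H S
  vx : ∀ v ∈ S, Col q H (S.erase v)
  ed : ∀ u ∈ S, ∀ v ∈ S, H.Adj u v → ∃ f : V → Fin q, ∀ x ∈ S, ∀ y ∈ S, H.Adj x y → f x = f y →
    (x = u ∧ y = v) ∨ (x = v ∧ y = u)

theorem Ok.mono {f : V → Fin q} (h : Ok H S f) (hT : T ⊆ S)
    (hJ : ∀ u ∈ T, ∀ v ∈ T, J.Adj u v → H.Adj u v) : Ok J T f :=
  fun u hu v hv k => h u (hT hu) v (hT hv) (hJ u hu v hv k)

theorem Col.mono (h : Col q H S) (hT : T ⊆ S)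
    (hJ : ∀ u ∈ T, ∀ v ∈ T, J.Adj u v → H.Adj u v) : Col q J T := h.imp fun _ h => h.mono hT hJ

theorem Crit.sub (h : Crit q H S) (hT : T ⊆ S) (hne : T ≠ S) : Col q H T := by
  obtain ⟨v, hv, hvT⟩ := exists_of_ssubset (Finset.ssubset_iff_subset_ne.2 ⟨hT, hne⟩)
  exact (h.vx v hv).mono (fun u hu => mem_erase.2 ⟨fun e => hvT (e ▸ hu), hT hu⟩)
    fun _ _ _ _ h => h

theorem Crit.all (h : Crit q H S) (hT : T ⊆ S) (hJ : ∀ u ∈ T, ∀ v ∈ T, J.Adj u v → H.Adj u v)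
    (hc : ¬ Col q J T) : T = S ∧ ∀ u ∈ S, ∀ v ∈ S, (J.Adj u v ↔ H.Adj u v) := by
  have e : T = S := by
    by_contra hne
    exact hc ((h.sub hT hne).mono subset_rfl hJ)
  subst e
  refine ⟨rfl, fun u hu v hv => ⟨hJ u hu v hv, fun k => ?_⟩⟩
  by_contra hn
  obtain ⟨f, hf⟩ := h.ed u hu v hv k
  refine hc ⟨f, fun x hx y hy hxy hfe => ?_⟩
  rcases hf x hx y hy (hJ x hx y hy hxy) hfe with ⟨rfl, rfl⟩ | ⟨rfl, rfl⟩
  · exact hn hxy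
  · exact hn hxy.symm

theorem Crit.congr (h : Crit q H S) (hJ : ∀ u ∈ S, ∀ v ∈ S, (H.Adj u v ↔ J.Adj u v)) :
    Crit q J S where
  nc := fun k => h.nc (k.mono subset_rfl fun u hu v hv => (hJ u hu v hv).1)
  vx := fun v hv => (h.vx v hv).mono subset_rfl fun u hu w hw =>
    (hJ u (mem_of_mem_erase hu) w (mem_of_mem_erase hw)).2
  ed := fun u hu v hv k => by
    obtain ⟨f, hf⟩ := h.ed u hu v hv ((hJ u hu v hv).2 k)
    exact ⟨f, fun x hx y hy hxy => hf x hx y hy ((hJ x hx y hy).2 hxy)⟩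

theorem extract (hc : ¬ Col q H S) : ∃ T ⊆ S, ∃ J ≤ H, Crit q J T := by
  suffices ∀ n : ℕ, ∀ (H : SimpleGraph V) (S : Finset V), ((S.card:ℤ) + E H S S).toNat ≤ n →
      ¬ Col q H S → ∃ T ⊆ S, ∃ J ≤ H, Crit q J T from this _ H S le_rfl hc
  intro n
  induction n with
  | zero =>
    intro H S hn hc
    have : S.card = 0 := by have := E_nn H S S; omega
    rw [card_eq_zero] at this
    subst this
    refine ⟨∅, subset_rfl, H, le_rfl, hc, by simp, by simp⟩
  | succ n ih =>
    intro H S hn hc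
    by_cases h1 : ∃ v ∈ S, ¬ Col q H (S.erase v)
    · obtain ⟨v, hv, h⟩ := h1
      obtain ⟨T, hT, J, hJ, hc⟩ := ih H (S.erase v) (by
        have := E_ms H (erase_subset v S) (erase_subset v S)
        rw [card_erase_of_mem hv]
        have := card_pos.2 ⟨v, hv⟩
        have := E_nn H (S.erase v) (S.erase v)
        omega) h
      exact ⟨T, hT.trans (erase_subset _ _), J, hJ, hc⟩
    · push Not at h1
      by_cases h2 : ∃ u ∈ S, ∃ v ∈ S, H.Adj u v ∧ ¬ Col q (H.deleteEdges {s(u,v)}) S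
      · obtain ⟨u, hu, v, hv, huv, h⟩ := h2
        obtain ⟨T, hT, J, hJ, hc⟩ := ih _ S (by
          have := E_lt (H := H.deleteEdges {s(u,v)}) (J := H) (A := S) (B := S) (u := u) (v := v)
            (fun x _ y _ h => (SimpleGraph.deleteEdges_le _) h) hu hv huv (by simp)
          have := E_nn (H.deleteEdges {s(u,v)}) S S
          omega) h
        exact ⟨T, hT, J, hJ.trans (SimpleGraph.deleteEdges_le _), hc⟩
      · push Not at h2
        refine ⟨S, subset_rfl, H, le_rfl, hc, h1, fun u hu v hv huv => ?_⟩
        obtain ⟨f, hf⟩ := h2 u hu v hv huv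
        refine ⟨f, fun x hx y hy hxy he => ?_⟩
        by_contra hn
        refine hf x hx y hy ?_ he
        simp [hxy]; tauto

theorem exists_col {ι : Type*} (N : Finset ι) (f : ι → Fin q) (h : N.card < q) : ∃ c, ∀ u ∈ N, f u ≠ c := by
  have : (N.image f).card < (univ : Finset (Fin q)).card := by
    rw [card_univ, Fintype.card_fin]; exact lt_of_le_of_lt card_image_le h
  obtain ⟨c, -, hc⟩ := exists_mem_notMem_of_card_lt_card this
  exact ⟨c, fun u hu e => hc (e ▸ mem_image_of_mem f hu)⟩

theorem Ok.upd {f : V → Fin q} {c : Fin q} (h : Ok H (S.erase v) f) (hc : ∀ u ∈ nb H S v, f u ≠ c) :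
    Ok H S (Function.update f v c) := by
  intro x hx y hy hxy
  by_cases e1 : x = v
  · subst e1
    rw [Function.update_self, Function.update_of_ne hxy.ne.symm]
    exact (hc y (mem_nb.2 ⟨hy, hxy⟩)).symm
  · by_cases e2 : y = v
    · subst e2
      rw [Function.update_self, Function.update_of_ne e1]
      exact (hc x (mem_nb.2 ⟨hx, hxy.symm⟩))
    · grind [mem_nb, nb_sub, Clq, Ok]

theorem Col.ext (h : Col q H (S.erase v)) (hc : (nb H S v).card < q) : Col q H S := by
  obtain ⟨f, hf⟩ := h
  obtain ⟨c, hc⟩ := exists_col _ f hc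
  exact ⟨_, hf.upd hc⟩

theorem Crit.deg (h : Crit q H S) (hv : v ∈ S) : q ≤ (nb H S v).card := by
  by_contra hc
  exact h.nc ((h.vx v hv).ext (by omega))

theorem Crit.ne (h : Crit q H S) (hq : 0 < q) : S.Nonempty := by
  by_contra hn
  rw [not_nonempty_iff_eq_empty] at hn
  exact h.nc ⟨fun _ => ⟨0, hq⟩, by simp [hn, Ok]⟩

theorem nb_erase (H : SimpleGraph V) (S) (v : V) : nb H S v ⊆ S.erase v := fun u hu => by
  rw [mem_nb] at hu; exact mem_erase.2 ⟨hu.2.ne.symm, hu.1⟩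

theorem Crit.card (h : Crit q H S) (hq : 0 < q) : q + 1 ≤ S.card := by
  obtain ⟨v, hv⟩ := h.ne hq
  have := h.deg hv
  have := card_le_card (nb_erase H S v)
  rw [card_erase_of_mem hv] at this
  omega

theorem Crit.clq (h : Crit q H S) (hS : S.card = q + 1) : Clq H S := by
  intro u hu v hv huv
  have := h.deg hu
  have e : nb H S u = S.erase u := eq_of_subset_of_card_le (nb_erase H S u) (by
    rw [card_erase_of_mem hu]; omega)
  have : v ∈ nb H S u := by grind
  exact (mem_nb.1 this).2

theorem Clq.ncol (h : Clq H S) (hS : q < S.card) : ¬ Col q H S := by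
  rintro ⟨f, hf⟩
  have : (univ : Finset (Fin q)).card < S.card := by simpa
  obtain ⟨x, hx, y, hy, hxy, e⟩ := exists_ne_map_eq_of_card_lt_of_maps_to this
    (fun x _ => mem_univ (f x))
  exact hf x hx y hy (h x hx y hy hxy) e

theorem Clq.inj {f : V → Fin q} (h : Clq H S) (hf : Ok H S f) (hu : u ∈ S) (hv : v ∈ S)
    (e : f u = f v) : u = v := by
  by_contra hn; exact hf u hu v hv (h u hu v hv hn) e

def star (f : V) (N : Finset V) : SimpleGraph V where
  Adj u v := u ≠ v ∧ ((u = f ∧ v ∈ N) ∨ (v = f ∧ u ∈ N))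
  symm := ⟨fun _ _ h => ⟨h.1.symm, h.2.symm⟩⟩
  loopless := ⟨fun _ h => h.1 rfl⟩

def mrg (H : SimpleGraph V) (a b : V) : SimpleGraph V where
  Adj u v := u ≠ v ∧ u ≠ b ∧ v ≠ b ∧ (H.Adj u v ∨ (u = a ∧ H.Adj b v) ∨ (v = a ∧ H.Adj b u))
  symm := ⟨fun _ _ h => ⟨h.1.symm, h.2.2.1, h.2.1, by rw [H.adj_comm]; exact Or.imp_right Or.symm h.2.2.2⟩⟩
  loopless := ⟨fun _ h => h.1 rfl⟩

def rwr (H : SimpleGraph V) (v : V) (N : Finset V) : SimpleGraph V where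
  Adj x y := x ≠ y ∧ ((x ≠ v ∧ y ≠ v ∧ H.Adj x y) ∨ (x = v ∧ y ∈ N) ∨ (y = v ∧ x ∈ N))
  symm := ⟨fun _ _ h => ⟨h.1.symm, by rw [H.adj_comm]; have := h.2; tauto⟩⟩
  loopless := ⟨fun _ h => h.1 rfl⟩

theorem rwr_adj {N : Finset V} (h1 : x ≠ v) (h2 : y ≠ v) : (rwr H v N).Adj x y ↔ H.Adj x y := by
  simp only [rwr]; constructor
  · grind
  · intro h; exact ⟨h.ne, by tauto⟩

theorem rwr_adj_v {N : Finset V} : (rwr H v N).Adj v y ↔ y ≠ v ∧ y ∈ N := by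
  simp only [rwr]; constructor
  · grind
  · grind

theorem star_adj_f {N : Finset V} : (star u N).Adj u y ↔ y ≠ u ∧ y ∈ N := by
  simp only [star]; constructor
  · grind
  · grind

theorem star_adj_ne {N : Finset V} (h1 : x ≠ u) (h2 : y ≠ u) : ¬ (star u N).Adj x y := by
  simp only [star]; tauto

theorem E_sup_le (H J : SimpleGraph V) (A B) : E (H ⊔ J) A B ≤ E H A B + E J A B := by
  unfold E; simp only [← sum_add_distrib]
  refine sum_le_sum fun u _ => sum_le_sum fun v _ => ?_
  simp only [SimpleGraph.sup_adj]
  split_ifs <;> simp_all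

theorem E_star (u : V) (N X : Finset V) : E (star u N) X X ≤ 2 * (N ∩ X).card := by
  by_cases hu : u ∈ X
  · rw [← insert_erase hu, insert_eq, E_ul _ (by simp), E_ur _ (by simp), E_ur _ (by simp), E_self,
      E_sym _ (X.erase u), E_zero (H := star u N) (A := X.erase u) (B := X.erase u)
        (fun x hx y hy => star_adj_ne (ne_of_mem_erase hx) (ne_of_mem_erase hy)), E_one]
    have : (nb (star u N) (X.erase u) u).card ≤ (N ∩ X).card := card_le_card fun y hy => by
      rw [mem_nb, star_adj_f] at hy
      exact mem_inter.2 ⟨hy.2.2, mem_of_mem_erase hy.1⟩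
    rw [← insert_eq, insert_erase hu]
    omega
  · rw [E_zero]; · positivity
    intro x hx y hy
    exact star_adj_ne (fun e => hu (e ▸ hx)) (fun e => hu (e ▸ hy))

theorem pot_star (q : ℕ) (H : SimpleGraph V) (u : V) (N X : Finset V) :
    pot q H X - 2 * q * (N ∩ X).card ≤ pot q (H ⊔ star u N) X := by
  have h1 := E_sup_le H (star u N) X X
  have h2 := E_star u N X
  have hq : (0:ℤ) ≤ q := by positivity
  unfold pot; nlinarith

theorem pot_edge {X : Finset V} (q : ℕ) (ha : a ∈ X) (hb : b ∈ X) (hne : a ≠ b) (h : ¬ H.Adj a b) :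
    pot q (H ⊔ star a {b}) X = pot q H X - 2 * q := by
  have h1 := E_lt2 (H := H) (J := H ⊔ star a {b}) (A := X) (fun _ _ _ _ h => Or.inl h) ha hb
    (Or.inr (by simp [star, hne])) h
  have h2 := E_sup_le H (star a {b}) X X
  have h3 := E_star a {b} X
  have h4 : ({b} ∩ X : Finset V).card ≤ 1 := card_le_card inter_subset_left
  have : E (H ⊔ star a {b}) X X = E H X X + 2 := by omega
  unfold pot; rw [this]; ring

theorem edge_adj_ne (h : ¬ (x = a ∧ y = b)) (h' : ¬ (x = b ∧ y = a)) :
    (H ⊔ star a {b}).Adj x y ↔ H.Adj x y := by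
  simp only [SimpleGraph.sup_adj, star, mem_singleton]; tauto

theorem pot_edge_ne {X : Finset V} (q : ℕ) (h : ¬ (a ∈ X ∧ b ∈ X)) :
    pot q (H ⊔ star a {b}) X = pot q H X :=
  pot_congr q fun x hx y hy => edge_adj_ne (by rintro ⟨rfl, rfl⟩; tauto) (by rintro ⟨rfl, rfl⟩; tauto)

theorem mrg_adj_ne (h1 : x ≠ a) (h2 : y ≠ a) (h3 : x ≠ b) (h4 : y ≠ b) :
    (mrg H a b).Adj x y ↔ H.Adj x y := by
  simp only [mrg]; constructor
  · grind
  · intro h; exact ⟨h.ne, by tauto⟩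

theorem pot_mrg_ne {X : Finset V} (q : ℕ) (h : a ∉ X) (h' : b ∉ X) : pot q (mrg H a b) X = pot q H X :=
  pot_congr q fun x hx y hy => mrg_adj_ne (fun e => h (e ▸ hx)) (fun e => h (e ▸ hy))
    (fun e => h' (e ▸ hx)) (fun e => h' (e ▸ hy))

theorem mrg_adj_a (hab : a ≠ b) (h : ¬ H.Adj a b) : (mrg H a b).Adj a y ↔ y ≠ b ∧ (H.Adj a y ∨ H.Adj b y) := by
  simp only [mrg]; constructor
  · grind
  · rintro ⟨h1, h2⟩
    refine ⟨?_, hab, h1, by tauto⟩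
    rintro rfl; rcases h2 with h2 | h2
    · exact h2.ne rfl
    · exact h h2.symm

theorem nb_ins (H : SimpleGraph V) (S) (v : V) : nb H (insert v S) v = nb H S v := by
  ext u; simp only [mem_nb, mem_insert]
  exact ⟨fun k => ⟨k.1.resolve_left k.2.ne.symm, k.2⟩, fun k => ⟨Or.inr k.1, k.2⟩⟩

theorem pot_mrg (q : ℕ) (ha : a ∈ S) (hb : b ∈ S) (hne : a ≠ b) (h : ¬ H.Adj a b)
    (hcn : ∀ c ∈ S, H.Adj a c → ¬ H.Adj b c) :
    pot q (mrg H a b) (S.erase b) = pot q H S - ((q:ℤ)^2 + q - 2) := by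
  obtain ⟨C, hC1, hC2, rfl⟩ : ∃ C, a ∉ C ∧ b ∉ C ∧ S = insert b (insert a C) :=
    ⟨(S.erase b).erase a, by simp, by simp, by
      rw [insert_erase (mem_erase.2 ⟨hne, ha⟩), insert_erase hb]⟩
  have hb' : b ∉ insert a C := by grind
  rw [erase_insert hb', pot_insert q _ hC1, pot_insert q _ hb', pot_insert q _ hC1, pot_mrg_ne q hC1 hC2]
  have e1 : nb H (insert a C) b = nb H C b := by
    ext u; simp only [mem_nb, mem_insert]; constructor
    · rintro ⟨rfl | k, l⟩
      · exact absurd l.symm h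
      · exact ⟨k, l⟩
    · grind
  have e2 : nb (mrg H a b) C a = nb H C a ∪ nb H C b := by
    ext u; simp only [mem_nb, mem_union, mrg_adj_a hne h]; constructor
    · grind
    · grind
  have d : Disjoint (nb H C a) (nb H C b) := by
    rw [Finset.disjoint_left]; intro u h1 h2
    rw [mem_nb] at h1 h2
    exact hcn u (by simp [h1.1]) h1.2 h2.2
  rw [e1, e2, card_union_of_disjoint d]; push_cast; ring

structure Cmp (H : SimpleGraph V) (S : Finset V) (a b : V) (A B : Finset V) : Prop where
  un : A ∪ B = S
  int : A ∩ B = {a, b}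
  ne : a ≠ b
  na : ¬ H.Adj a b
  sep : ∀ u ∈ A, ∀ v ∈ B, u ∉ B → v ∉ A → ¬ H.Adj u v
  cn : ∀ c ∈ B, H.Adj a c → ¬ H.Adj b c

theorem Cmp.aA (h : Cmp H S a b A B) : a ∈ A := (mem_inter.1 (h.int ▸ (by simp : a ∈ ({a,b}:Finset V)))).1
theorem Cmp.aB (h : Cmp H S a b A B) : a ∈ B := (mem_inter.1 (h.int ▸ (by simp : a ∈ ({a,b}:Finset V)))).2
theorem Cmp.bA (h : Cmp H S a b A B) : b ∈ A := (mem_inter.1 (h.int ▸ (by simp : b ∈ ({a,b}:Finset V)))).1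
theorem Cmp.bB (h : Cmp H S a b A B) : b ∈ B := (mem_inter.1 (h.int ▸ (by simp : b ∈ ({a,b}:Finset V)))).2
theorem Cmp.ab (h : Cmp H S a b A B) (h1 : x ∈ A) (h2 : x ∈ B) : x = a ∨ x = b := by
  have : x ∈ A ∩ B := mem_inter.2 ⟨h1, h2⟩
  rw [h.int] at this; simpa using this

theorem pot_pair (q : ℕ) (hne : a ≠ b) (h : ¬ H.Adj a b) : pot q H {a, b} = 2 * ((q:ℤ)^2 + q - 2) := by
  have : nb H {b} a = ∅ := by ext u; simp only [mem_nb, mem_singleton]; constructor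
                              · grind
                              · simp
  rw [pot_insert q H (by simpa using hne), this]; simp [pot]; ring

theorem pot_glue (q : ℕ) (h : ∀ u ∈ A, ∀ v ∈ B, u ∉ B → v ∉ A → ¬ H.Adj u v) :
    pot q H (A ∪ B) = pot q H A + pot q H B - pot q H (A ∩ B) := by
  have h1 : A ∪ B = A ∪ (B \ A) := by simp
  have h2 : B = (A ∩ B) ∪ (B \ A) := by ext; simp; tauto
  have d2 : Disjoint (A ∩ B) (B \ A) :=
    disjoint_of_subset_left inter_subset_left disjoint_sdiff
  have e2 := pot_union q H d2
  rw [← h2] at e2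
  rw [h1, pot_union q H disjoint_sdiff, e2]
  have h3 : A = (A ∩ B) ∪ (A \ B) := by ext; simp; tauto
  have d3 : Disjoint (A ∩ B) (A \ B) :=
    disjoint_of_subset_left inter_subset_right disjoint_sdiff
  have e3 := E_ul H d3 (B \ A)
  rw [← h3, E_zero (A := A \ B) fun u hu v hv => h u (mem_sdiff.1 hu).1 v (mem_sdiff.1 hv).1
    (mem_sdiff.1 hu).2 (mem_sdiff.1 hv).2] at e3
  rw [e3]; ring

inductive Ore (q : ℕ) : SimpleGraph V → Finset V → Prop
  | base {H : SimpleGraph V} {S : Finset V} : Crit q H S → S.card = q + 1 → Ore q H S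
  | comp {H : SimpleGraph V} {S : Finset V} {a b : V} {A B : Finset V} : Crit q H S → Cmp H S a b A B → Ore q (H ⊔ star a {b}) A →
      Ore q (mrg H a b) (B.erase b) → Ore q H S

theorem Ore.crit (h : Ore q H S) : Crit q H S := by cases h <;> assumption

theorem Cmp.pots (h : Cmp H S a b A B) :
    pot q H A = pot q (H ⊔ star a {b}) A + 2 * q ∧
    pot q H B = pot q (mrg H a b) (B.erase b) + ((q:ℤ)^2 + q - 2) ∧
    pot q H S = pot q (H ⊔ star a {b}) A + pot q (mrg H a b) (B.erase b) - ((q:ℤ)^2 - q - 2) := by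
  have h1 := pot_edge q h.aA h.bA h.ne h.na
  have h2 := pot_mrg q h.aB h.bB h.ne h.na h.cn
  have h3 := pot_glue q h.sep
  rw [h.un, h.int, pot_pair q h.ne h.na] at h3
  refine ⟨by linarith, by linarith, by linarith⟩

theorem Ore.pot (h : Ore q H S) : pot q H S = (q:ℤ)^2 - q - 2 := by
  induction h with
  | base h1 h2 =>
    rw [(h1.clq h2).pot, h2]; push_cast; ring
  | comp h1 h2 h3 h4 i3 i4 => rw [h2.pots.2.2, i3, i4]; ring

theorem Cmp.potA (h : Cmp H S a b A B) (h3 : Ore q (H ⊔ star a {b}) A) :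
    KY.pot q H A = (q:ℤ)^2 + q - 2 := by
  rw [h.pots.1, h3.pot]; ring

theorem Cmp.potB (h : Cmp H S a b A B) (h3 : Ore q (mrg H a b) (B.erase b)) :
    KY.pot q H B = 2 * (q:ℤ)^2 - 4 := by
  rw [h.pots.2.1, h3.pot]; ring

theorem Cmp.subA (h : Cmp H S a b A B) : A ⊆ S := h.un ▸ subset_union_left
theorem Cmp.subB (h : Cmp H S a b A B) : B ⊆ S := h.un ▸ subset_union_right

theorem Cmp.nbB (h : Cmp H S a b A B) (hv : v ∈ B) (hv' : v ∉ A) :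
    (nb H S v).card = (nb (mrg H a b) (B.erase b) v).card := by
  have va : v ≠ a := fun e => hv' (e ▸ h.aA)
  have vb : v ≠ b := fun e => hv' (e ▸ h.bA)
  have e1 : nb H S v = nb H B v := by
    ext u; simp only [mem_nb]; constructor
    · rintro ⟨k, l⟩
      refine ⟨?_, l⟩
      by_contra hu
      have : u ∈ A := by rw [← h.un] at k; exact (mem_union.1 k).resolve_right hu
      exact h.sep u this v hv hu hv' l.symm
    · rintro ⟨k, l⟩; exact ⟨h.subB k, l⟩
  rw [e1]
  refine card_bij (fun x _ => if x = b then a else x) ?_ ?_ ?_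
  · intro x hx
    rw [mem_nb] at hx
    by_cases e : x = b
    · subst e
      simp only [if_true, mem_nb, mem_erase]
      refine ⟨⟨h.ne, h.aB⟩, ?_⟩
      rw [SimpleGraph.adj_comm, mrg_adj_a h.ne h.na]
      exact ⟨vb, Or.inr hx.2.symm⟩
    · simp only [e, if_false, mem_nb, mem_erase]
      refine ⟨⟨e, hx.1⟩, hx.2.ne, vb, e, Or.inl hx.2⟩
  · intro x hx y hy
    rw [mem_nb] at hx hy
    have k1 : ¬ (H.Adj v a ∧ H.Adj v b) := fun k => h.cn v hv k.1.symm k.2.symm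
    split_ifs with e1 e2 e2
    · grind
    · grind
    · grind
    · exact id
  · intro y hy
    rw [mem_nb, mem_erase] at hy
    by_cases e : y = a
    · subst e
      have := hy.2
      rw [SimpleGraph.adj_comm, mrg_adj_a h.ne h.na] at this
      rcases this.2 with k | k
      · exact ⟨y, mem_nb.2 ⟨hy.1.2, k.symm⟩, by simp [h.ne]⟩
      · exact ⟨b, mem_nb.2 ⟨h.bB, k.symm⟩, by simp⟩
    · refine ⟨y, mem_nb.2 ⟨hy.1.2, ?_⟩, by simp [hy.1.1]⟩
      exact (mrg_adj_ne va e vb hy.1.1).1 hy.2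

theorem Cmp.nbA (h : Cmp H S a b A B) (hv : v ∈ A) (hv' : v ∉ B) :
    (nb H S v).card = (nb (H ⊔ star a {b}) A v).card := by
  have va : v ≠ a := fun e => hv' (e ▸ h.aB)
  have vb : v ≠ b := fun e => hv' (e ▸ h.bB)
  congr 1
  ext u; simp only [mem_nb]
  rw [edge_adj_ne (by tauto) (by tauto)]
  constructor
  · rintro ⟨k, l⟩
    refine ⟨?_, l⟩
    by_contra hu
    have : u ∈ B := by rw [← h.un] at k; exact (mem_union.1 k).resolve_left hu
    exact h.sep v hv u this hv' hu l
  · rintro ⟨k, l⟩; exact ⟨h.subA k, l⟩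

theorem O1 (hq : 3 ≤ q) (h : Ore q H S) : ∀ x ∈ S,
    (∃ X ⊆ S, x ∉ X ∧ 2 ≤ X.card ∧ pot q H X ≤ (q:ℤ)^2 + q - 2) ∨
    (∃ E ⊆ S, x ∉ E ∧ E.card = q ∧ Clq H E ∧ ∀ e ∈ E, (nb H S e).card = q) := by
  induction h with
  | @base H S h1 h2 =>
    intro x hx
    have hc := h1.clq h2
    refine Or.inr ⟨S.erase x, erase_subset _ _, notMem_erase _ _, by rw [card_erase_of_mem hx]; omega,
      hc.mono (erase_subset _ _), fun e he => ?_⟩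
    rw [hc.nb (mem_of_mem_erase he), card_erase_of_mem (mem_of_mem_erase he)]; omega
  | @comp H S a b A B h1 h2 h3 h4 i3 i4 =>
    intro x hx
    by_cases hA : x ∈ A
    · rcases i4 a (mem_erase.2 ⟨h2.ne, h2.aB⟩) with ⟨X, hX, ha, hc, hp⟩ | ⟨E, hE, ha, hc, hcl, hd⟩
      · have hb : b ∉ X := fun k => (ne_of_mem_erase (hX k)) rfl
        refine Or.inl ⟨X, fun y hy => h2.subB (mem_of_mem_erase (hX hy)), fun k => ?_, hc, ?_⟩
        · rcases h2.ab hA (mem_of_mem_erase (hX k)) with rfl | rfl <;> contradiction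
        · rwa [pot_mrg_ne q ha hb] at hp
      · have hb : b ∉ E := fun k => (ne_of_mem_erase (hE k)) rfl
        have nA : ∀ e ∈ E, e ∉ A := fun e he k => by
          rcases h2.ab k (mem_of_mem_erase (hE he)) with rfl | rfl <;> contradiction
        refine Or.inr ⟨E, fun y hy => h2.subB (mem_of_mem_erase (hE hy)), fun k => nA x k hA, hc, ?_, ?_⟩
        · intro u hu v hv huv
          exact (mrg_adj_ne (ne_of_mem_of_not_mem hu ha) (ne_of_mem_of_not_mem hv ha)
            (ne_of_mem_of_not_mem hu hb) (ne_of_mem_of_not_mem hv hb)).1 (hcl u hu v hv huv)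
        · intro e he
          rw [h2.nbB (mem_of_mem_erase (hE he)) (nA e he), hd e he]
    · exact Or.inl ⟨A, h2.subA, hA, by have := h3.crit.card (by omega); omega, (h2.potA h3).le⟩

theorem O2 (hq : 3 ≤ q) (h : Ore q H S) : ∀ Z ⊆ S, Clq H Z → S.card = q + 1 ∨
    (∃ X ⊆ S, Disjoint X Z ∧ 2 ≤ X.card ∧ pot q H X ≤ (q:ℤ)^2 + q - 2) ∨
    (∃ E ⊆ S, Disjoint E Z ∧ E.card = q ∧ Clq H E ∧ ∃ T ⊆ E, q ≤ T.card + 1 ∧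
      ∀ e ∈ T, (nb H S e).card = q) := by
  induction h with
  | base h1 h2 => exact fun _ _ _ => Or.inl h2
  | @comp H S a b A B h1 h2 h3 h4 i3 i4 =>
    intro Z hZ hcl
    right
    by_cases hA : Z ⊆ A
    · rcases O1 hq h4 a (mem_erase.2 ⟨h2.ne, h2.aB⟩) with ⟨X, hX, ha, hc, hp⟩ | ⟨E, hE, ha, hc, hcl, hd⟩
      · have hb : b ∉ X := fun k => (ne_of_mem_erase (hX k)) rfl
        refine Or.inl ⟨X, fun y hy => h2.subB (mem_of_mem_erase (hX hy)), ?_, hc, ?_⟩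
        · rw [Finset.disjoint_left]; intro x k k'
          rcases h2.ab (hA k') (mem_of_mem_erase (hX k)) with rfl | rfl <;> contradiction
        · rwa [pot_mrg_ne q ha hb] at hp
      · have hb : b ∉ E := fun k => (ne_of_mem_erase (hE k)) rfl
        have nA : ∀ e ∈ E, e ∉ A := fun e he k => by
          rcases h2.ab k (mem_of_mem_erase (hE he)) with rfl | rfl <;> contradiction
        refine Or.inr ⟨E, fun y hy => h2.subB (mem_of_mem_erase (hE hy)),
          Finset.disjoint_left.2 fun x k k' => nA x k (hA k'), hc, ?_, E, subset_rfl, by omega, ?_⟩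
        · intro u hu v hv huv
          exact (mrg_adj_ne (ne_of_mem_of_not_mem hu ha) (ne_of_mem_of_not_mem hv ha)
            (ne_of_mem_of_not_mem hu hb) (ne_of_mem_of_not_mem hv hb)).1 (hcl u hu v hv huv)
        · intro e he
          rw [h2.nbB (mem_of_mem_erase (hE he)) (nA e he), hd e he]
    · obtain ⟨z, hz, hzA⟩ := not_subset.1 hA
      have hzB : z ∈ B := by
        have := hZ hz; rw [← h2.un] at this; exact (mem_union.1 this).resolve_left hzA
      have hZB : ∀ x ∈ Z, x ∈ B := by
        intro x hx; by_contra hxB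
        have hxA : x ∈ A := by
          have := hZ hx; rw [← h2.un] at this; exact (mem_union.1 this).resolve_right hxB
        exact h2.sep x hxA z hzB hxB hzA (hcl x hx z hz (fun e => hzA (e ▸ hxA)))
      have hZA : ∀ x ∈ Z, x ∈ A → x = a ∨ x = b := fun x hx k => h2.ab k (hZB x hx)
      have nab : ¬ (a ∈ Z ∧ b ∈ Z) := fun k => h2.na (hcl a k.1 b k.2 h2.ne)
      have cab : Clq (H ⊔ star a {b}) {a, b} := by
        intro u hu v hv huv
        simp only [mem_insert, mem_singleton] at hu hv
        right; simp only [star, mem_singleton]; refine ⟨huv, ?_⟩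
        rcases hu with rfl | rfl <;> rcases hv with rfl | rfl <;> simp_all
      rcases i3 {a, b} (by intro x; simp only [mem_insert, mem_singleton]; rintro (rfl | rfl)
                           · exact h2.aA
                           · exact h2.bA) cab with hc | ⟨X, hX, hd, hc, hp⟩ | ⟨E, hE, hd, hc, hcl', T, hT, hTc, hdeg⟩
      · -- base
        have hcA := h3.crit.clq hc
        by_cases h0 : Disjoint A Z
        · exact Or.inl ⟨A, h2.subA, h0, by omega, (h2.potA h3).le⟩
        obtain ⟨c, hcA', hcZ⟩ := not_disjoint_iff.1 h0
        have hc' := hZA c hcZ hcA'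
        have hone : ∀ x ∈ Z, x ∈ A → x = c := by grind
        refine Or.inr ⟨A.erase c, (erase_subset _ _).trans h2.subA, ?_, by rw [card_erase_of_mem hcA']; omega,
          ?_, (A.erase a).erase b, ?_, ?_, ?_⟩
        · rw [Finset.disjoint_left]; intro x hx hx'
          exact (ne_of_mem_erase hx) (hone x hx' (mem_of_mem_erase hx))
        · intro u hu v hv huv
          refine (edge_adj_ne ?_ ?_).1 (hcA u (mem_of_mem_erase hu) v (mem_of_mem_erase hv) huv)
          · grind
          · grind
        · grind
        · rw [card_erase_of_mem (mem_erase.2 ⟨h2.ne.symm, h2.bA⟩), card_erase_of_mem h2.aA]; omega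
        · intro e he
          simp only [mem_erase] at he
          have : e ∉ B := fun k => by rcases h2.ab he.2.2 k with rfl | rfl <;> tauto
          rw [h2.nbA he.2.2 this, hcA.nb he.2.2, card_erase_of_mem he.2.2]; omega
      · have ha : a ∉ X := fun k => Finset.disjoint_left.1 hd k (by simp)
        have hb : b ∉ X := fun k => Finset.disjoint_left.1 hd k (by simp)
        refine Or.inl ⟨X, hX.trans h2.subA, ?_, hc, ?_⟩
        · rw [Finset.disjoint_left]; intro x k k'
          rcases hZA x k' (hX k) with rfl | rfl <;> contradiction
        · rwa [pot_edge_ne q (by tauto)] at hp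
      · have ha : a ∉ E := fun k => Finset.disjoint_left.1 hd k (by simp)
        have hb : b ∉ E := fun k => Finset.disjoint_left.1 hd k (by simp)
        refine Or.inr ⟨E, hE.trans h2.subA, ?_, hc, ?_, T, hT, hTc, ?_⟩
        · rw [Finset.disjoint_left]; intro x k k'
          rcases hZA x k' (hE k) with rfl | rfl <;> contradiction
        · intro u hu v hv huv
          refine (edge_adj_ne ?_ ?_).1 (hcl' u hu v hv huv)
          · grind
          · grind
        · intro e he
          have : e ∉ B := fun k => by rcases h2.ab (hE (hT he)) k with rfl | rfl <;> exact absurd (hT he) (by assumption)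
          rw [h2.nbA (hE (hT he)) this, hdeg e he]

theorem Ok.glue {f g : V → Fin q} (hf : Ok H A f) (hg : Ok H B g) (he : ∀ x ∈ A, x ∈ B → f x = g x)
    (h : ∀ u ∈ A, ∀ v ∈ B, u ∉ B → v ∉ A → ¬ H.Adj u v) :
    Ok H (A ∪ B) (fun x => if x ∈ A then f x else g x) := by
  intro x hx y hy hxy
  rw [mem_union] at hx hy
  by_cases xA : x ∈ A <;> by_cases yA : y ∈ A <;> simp only [xA, yA, if_true, if_false]
  · exact hf x xA y yA hxy
  · grind [mem_nb, nb_sub, Clq, Ok]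
  · have xB := hx.resolve_left xA
    by_cases yB : y ∈ B
    · rw [he y yA yB]; exact hg x xB y yB hxy
    · exact absurd hxy.symm (h y yA x xB yB xA)
  · exact hg x (hx.resolve_left xA) y (hy.resolve_left yA) hxy

theorem Ok.perm {f : V → Fin q} (h : Ok H S f) (π : Equiv.Perm (Fin q)) : Ok H S (fun x => π (f x)) :=
  fun x hx y hy hxy e => h x hx y hy hxy (π.injective e)

theorem perm2 {c1 c2 d1 d2 : Fin q} (h : c1 = c2 ↔ d1 = d2) :
    ∃ π : Equiv.Perm (Fin q), π c1 = d1 ∧ π c2 = d2 := by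
  by_cases hc : c1 = c2
  · have hd := h.1 hc
    subst hc; subst hd
    exact ⟨Equiv.swap c1 d1, by simp, by simp⟩
  · have hd : d1 ≠ d2 := fun k => hc (h.2 k)
    refine ⟨Equiv.swap (Equiv.swap c1 d1 c2) d2 * Equiv.swap c1 d1, ?_, ?_⟩
    · simp only [Equiv.Perm.mul_apply, Equiv.swap_apply_left]
      refine Equiv.swap_apply_of_ne_of_ne ?_ hd
      intro k
      have : Equiv.swap c1 d1 c1 = Equiv.swap c1 d1 c2 := by rw [← k]; simp
      exact hc ((Equiv.swap c1 d1).injective this)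
    · simp

theorem perm3 (hq : 4 ≤ q) {c1 c2 c3 d1 d2 e : Fin q} (h : c1 ≠ c2) (h' : d1 ≠ d2) (h3 : c3 ≠ c1)
    (h4 : c3 ≠ c2) : ∃ π : Equiv.Perm (Fin q), π c1 = d1 ∧ π c2 = d2 ∧ π c3 ≠ e := by
  obtain ⟨π, h1, h2⟩ := perm2 (q := q) (c1 := c1) (c2 := c2) (d1 := d1) (d2 := d2) (by tauto)
  by_cases k : π c3 = e
  · obtain ⟨e', he⟩ := exists_col (q := q) ({d1, d2, e} : Finset (Fin q)) id
      (lt_of_le_of_lt card_le_three (by omega))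
    simp only [mem_insert, mem_singleton, forall_eq_or_imp, forall_eq, id] at he
    have n1 : d1 ≠ e := by rw [← h1, ← k]; exact fun t => h3 (π.injective t).symm
    have n2 : d2 ≠ e := by rw [← h2, ← k]; exact fun t => h4 (π.injective t).symm
    refine ⟨Equiv.swap e e' * π, ?_, ?_, ?_⟩
    · simp only [Equiv.Perm.mul_apply, h1]; exact Equiv.swap_apply_of_ne_of_ne n1 he.1
    · simp only [Equiv.Perm.mul_apply, h2]; exact Equiv.swap_apply_of_ne_of_ne n2 he.2.1
    · simp only [Equiv.Perm.mul_apply, k, Equiv.swap_apply_left]; exact he.2.2.symm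
  · grind

def TC (H : SimpleGraph V) (S : Finset V) : Prop := ∀ A ⊆ S, ∀ B ⊆ S, Disjoint A B → A.Nonempty →
  B.Nonempty → (S \ (A ∪ B)).card ≤ 2 → ∃ u ∈ A, ∃ v ∈ B, H.Adj u v

theorem dc_aux1 {u' v' : V} (h1 : u' = u ∨ (u = a ∧ u' = b)) (h2 : v' = v ∨ (v = a ∧ v' = b))
    (h3 : (u' = x ∧ v' = y) ∨ (u' = y ∧ v' = x)) (hx : x ≠ b) (hy : y ≠ b) :
    (u = x ∧ v = y) ∨ (u = y ∧ v = x) := by grind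

theorem dc_aux2 {u' v' : V} (h1 : u' = u ∨ (u = a ∧ u' = b)) (h2 : v' = v ∨ (v = a ∧ v' = b))
    (h3 : (u' = b ∧ v' = y) ∨ (u' = y ∧ v' = b)) (hu : u ≠ b) (hv : v ≠ b) (hy : y ≠ b) (huv : u ≠ v) :
    (u = a ∧ v = y) ∨ (u = y ∧ v = a) := by grind

theorem dirac_core (h : Crit q H S) (hun : A ∪ B = S) (hint : A ∩ B = {a, b}) (hne : a ≠ b)
    (sep : ∀ u ∈ A, ∀ v ∈ B, u ∉ B → v ∉ A → ¬ H.Adj u v) (hA : Col q H A)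
    (h1 : ∀ f : V → Fin q, Ok H A f → f a = f b) (h2 : ∀ f : V → Fin q, Ok H B f → f a ≠ f b) :
    Cmp H S a b A B ∧ Crit q (H ⊔ star a {b}) A ∧ Crit q (mrg H a b) (B.erase b) := by
  have memab : ∀ x, x ∈ A → x ∈ B → x = a ∨ x = b := fun x k l => by
    have : x ∈ A ∩ B := mem_inter.2 ⟨k, l⟩
    rw [hint] at this; simpa using this
  have aAB : a ∈ A ∩ B := by rw [hint]; simp
  have bAB : b ∈ A ∩ B := by rw [hint]; simp
  rw [mem_inter] at aAB bAB
  have AS : A ⊆ S := hun ▸ subset_union_left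
  have BS : B ⊆ S := hun ▸ subset_union_right
  have na : ¬ H.Adj a b := by
    intro k; obtain ⟨f, hf⟩ := hA
    exact hf a aAB.1 b bAB.1 k (h1 f hf)
  have nab : ∀ x y, H.Adj x y → x ∈ A → y ∈ A → x ∈ B → y ∈ B → False := by
    intro x y k xA yA xB yB
    rcases memab x xA xB with rfl | rfl <;> rcases memab y yA yB with rfl | rfl
    · exact k.ne rfl
    · exact na k
    · exact na k.symm
    · exact k.ne rfl
  have cn : ∀ c ∈ B, H.Adj a c → ¬ H.Adj b c := by
    intro c hc hac hbc
    have cA : c ∉ A := by grind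
    obtain ⟨f, hf⟩ := h.ed a (AS aAB.1) c (BS hc) hac
    have fab : f a = f b := h1 f fun x hx y hy hxy e => by grind
    refine h.nc ⟨f, fun x hx y hy hxy e => ?_⟩
    have key : f b ≠ f c := fun k => by grind
    rcases hf x hx y hy hxy e with ⟨rfl, rfl⟩ | ⟨rfl, rfl⟩
    · exact key (fab ▸ e)
    · grind
  refine ⟨⟨hun, hint, hne, na, sep, cn⟩, ⟨?_, ?_, ?_⟩, ⟨?_, ?_, ?_⟩⟩
  · rintro ⟨f, hf⟩
    exact hf a aAB.1 b bAB.1 (Or.inr (by simp [star, hne])) (h1 f (hf.mono subset_rfl fun _ _ _ _ k => Or.inl k))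
  · intro v hv
    by_cases hvB : v ∈ B
    · refine ((h.vx v (AS hv)).mono (erase_subset_erase v AS) fun x hx y hy hxy => ?_)
      have hv' := memab v hv hvB
      refine (edge_adj_ne ?_ ?_).1 hxy
      · grind
      · grind
    · obtain ⟨f, hf⟩ := h.vx v (AS hv)
      have fab : f a ≠ f b := h2 f (hf.mono (fun x hx => mem_erase.2 ⟨fun e => hvB (e ▸ hx), BS hx⟩)
        fun _ _ _ _ k => k)
      refine ⟨f, fun x hx y hy hxy => ?_⟩
      rcases hxy with k | ⟨_, ⟨rfl, k⟩ | ⟨rfl, k⟩⟩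
      · exact hf x (erase_subset_erase v AS hx) y (erase_subset_erase v AS hy) k
      · grind
      · grind
  · intro x hx y hy hxy
    by_cases k : H.Adj x y
    · obtain ⟨f, hf⟩ := h.ed x (AS hx) y (AS hy) k
      have fab : f a ≠ f b := h2 f fun u hu v hv huv e => by grind
      refine ⟨f, fun u hu v hv huv e => ?_⟩
      rcases huv with k | ⟨_, ⟨rfl, k⟩ | ⟨rfl, k⟩⟩
      · grind
      · grind
      · grind
    · obtain ⟨f, hf⟩ := hA
      have hxy' : (x = a ∧ y = b) ∨ (x = b ∧ y = a) := by
        have := hxy.resolve_left k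
        simp only [star, mem_singleton] at this; tauto
      refine ⟨f, fun u hu v hv huv e => ?_⟩
      have huv' : (u = a ∧ v = b) ∨ (u = b ∧ v = a) := by
        have := huv.resolve_left fun k => hf u hu v hv k e
        simp only [star, mem_singleton] at this; tauto
      rcases hxy' with ⟨rfl, rfl⟩ | ⟨rfl, rfl⟩ <;> tauto
  · rintro ⟨g, hg⟩
    have : Ok H B (Function.update g b (g a)) := by
      refine Ok.upd (hg.mono subset_rfl fun x hx y hy hxy =>
        ⟨hxy.ne, ne_of_mem_erase hx, ne_of_mem_erase hy, Or.inl hxy⟩) ?_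
      intro u hu
      rw [mem_nb] at hu
      refine (hg a (mem_erase.2 ⟨hne, aAB.2⟩) u (mem_erase.2 ⟨hu.2.ne.symm, hu.1⟩) ?_).symm
      exact (mrg_adj_a hne na).2 ⟨hu.2.ne.symm, Or.inr hu.2⟩
    refine h2 _ this ?_
    rw [Function.update_of_ne hne, Function.update_self]
  · intro v hv
    have vb := ne_of_mem_erase hv
    have vB := mem_of_mem_erase hv
    by_cases va : v = a
    · subst va
      refine (h.vx v (BS vB)).mono (erase_subset_erase v ((erase_subset _ _).trans BS)) fun x hx y hy hxy => ?_
      simp only [mem_erase] at hx hy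
      exact (mrg_adj_ne hx.1 hy.1 hx.2.1 hy.2.1).1 hxy
    · have vA : v ∉ A := fun k => by rcases memab v k vB with k | k <;> contradiction
      obtain ⟨f, hf⟩ := h.vx v (BS vB)
      have fab : f a = f b := h1 f (hf.mono (fun x hx => mem_erase.2 ⟨fun e => vA (e ▸ hx), AS hx⟩)
        fun _ _ _ _ k => k)
      refine ⟨f, fun x hx y hy hxy => ?_⟩
      simp only [mem_erase] at hx hy
      rcases hxy.2.2.2 with k | ⟨rfl, k⟩ | ⟨rfl, k⟩
      · grind [mem_nb, nb_sub, Clq, Ok]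
      · grind [mem_nb, nb_sub, Clq, Ok]
      · grind [mem_nb, nb_sub, Clq, Ok]
  · have key : ∀ x ∈ B, ∀ y ∈ B, y ≠ b → H.Adj x y → ∃ f : V → Fin q,
        ∀ u ∈ B.erase b, ∀ v ∈ B.erase b, (mrg H a b).Adj u v → f u = f v →
        ∃ u' v', (u' = u ∨ (u = a ∧ u' = b)) ∧ (v' = v ∨ (v = a ∧ v' = b)) ∧
          ((u' = x ∧ v' = y) ∨ (u' = y ∧ v' = x)) := by
      intro x hx y hy yb hxy
      obtain ⟨f, hf⟩ := h.ed x (BS hx) y (BS hy) hxy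
      have fab : f a = f b := h1 f fun u hu v hv huv e => by grind
      refine ⟨f, fun u hu v hv huv e => ?_⟩
      rw [mem_erase] at hu hv
      rcases huv.2.2.2 with k | ⟨rfl, k⟩ | ⟨rfl, k⟩
      · exact ⟨u, v, Or.inl rfl, Or.inl rfl, hf u (BS hu.2) v (BS hv.2) k e⟩
      · exact ⟨b, v, Or.inr ⟨rfl, rfl⟩, Or.inl rfl, hf b (BS bAB.2) v (BS hv.2) k (fab ▸ e)⟩
      · exact ⟨u, b, Or.inl rfl, Or.inr ⟨rfl, rfl⟩, hf u (BS hu.2) b (BS bAB.2) k.symm (fab ▸ e)⟩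
    intro x hx y hy hxy
    rw [mem_erase] at hx hy
    have hxa : (mrg H a b).Adj x y → x ≠ y := fun k => k.ne
    rcases hxy.2.2.2 with k | ⟨rfl, k⟩ | ⟨rfl, k⟩
    · obtain ⟨f, hf⟩ := key x hx.2 y hy.2 hy.1 k
      refine ⟨f, fun u hu v hv huv e => ?_⟩
      obtain ⟨u', v', h1, h2, h3⟩ := hf u hu v hv huv e
      exact dc_aux1 h1 h2 h3 hx.1 hy.1
    · obtain ⟨f, hf⟩ := key b bAB.2 y hy.2 hy.1 k
      refine ⟨f, fun u hu v hv huv e => ?_⟩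
      obtain ⟨u', v', h1, h2, h3⟩ := hf u hu v hv huv e
      exact dc_aux2 h1 h2 h3 (ne_of_mem_erase hu) (ne_of_mem_erase hv) hy.1 huv.ne
    · obtain ⟨f, hf⟩ := key b bAB.2 x hx.2 hx.1 k
      refine ⟨f, fun u hu v hv huv e => ?_⟩
      obtain ⟨u', v', h1, h2, h3⟩ := hf u hu v hv huv e
      exact (dc_aux2 h1 h2 h3 (ne_of_mem_erase hu) (ne_of_mem_erase hv) hx.1 huv.ne).symm

theorem dirac (hq : 3 ≤ q) (h : Crit q H S) (hn : ¬ TC H S) : ∃ a b A B,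
    Cmp H S a b A B ∧ Crit q (H ⊔ star a {b}) A ∧ Crit q (mrg H a b) (B.erase b) := by
  simp only [TC] at hn
  push Not at hn
  obtain ⟨A0, hA0, B0, hB0, hd, nA, nB, hD, hsep⟩ := hn
  set D := S \ (A0 ∪ B0) with hDdef
  set A := A0 ∪ D with hA
  set B := B0 ∪ D with hB
  have un : A ∪ B = S := by grind
  have int : A ∩ B = D := by
    ext x; simp only [hA, hB, hDdef, mem_union, mem_sdiff, mem_inter]
    have := @Finset.disjoint_left _ A0 B0; have := @this.1 hd x; tauto
  have sep : ∀ u ∈ A, ∀ v ∈ B, u ∉ B → v ∉ A → ¬ H.Adj u v := by grind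
  have cA : Col q H A := h.sub (un ▸ subset_union_left) (by
    obtain ⟨z, hz⟩ := nB
    intro e
    have : z ∈ A := e ▸ hB0 hz
    simp only [hA, hDdef, mem_union, mem_sdiff] at this
    exact Finset.disjoint_left.1 hd (by tauto) hz)
  have cB : Col q H B := h.sub (un ▸ subset_union_right) (by
    obtain ⟨z, hz⟩ := nA
    intro e
    have : z ∈ B := e ▸ hA0 hz
    simp only [hB, hDdef, mem_union, mem_sdiff] at this
    exact Finset.disjoint_left.1 hd hz (by tauto))
  have glue : ∀ f g : V → Fin q, Ok H A f → Ok H B g → ¬ (∃ π : Equiv.Perm (Fin q), ∀ x ∈ D, π (g x) = f x) := by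
    rintro f g hf hg ⟨π, hπ⟩
    have := Ok.glue hf (hg.perm π) (fun x hx hx' => (hπ x (int ▸ mem_inter.2 ⟨hx, hx'⟩)).symm) sep
    rw [un] at this
    exact h.nc ⟨_, this⟩
  obtain ⟨f0, hf0⟩ := cA
  obtain ⟨g0, hg0⟩ := cB
  have hD2 : D.card = 2 := by
    by_contra hne
    have : D.card = 0 ∨ D.card = 1 := by omega
    rcases this with k | k
    · rw [card_eq_zero] at k
      exact glue f0 g0 hf0 hg0 ⟨1, by simp [k]⟩
    · obtain ⟨d, hd⟩ := card_eq_one.1 k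
      exact glue f0 g0 hf0 hg0 ⟨Equiv.swap (g0 d) (f0 d), by simp [hd]⟩
  obtain ⟨a, b, hab, hDe⟩ := card_eq_two.1 hD2
  have glue' : ∀ f g : V → Fin q, Ok H A f → Ok H B g → ¬ (g a = g b ↔ f a = f b) := by
    intro f g hf hg k
    obtain ⟨π, h1, h2⟩ := perm2 k
    exact glue f g hf hg ⟨π, by rw [hDe]; simp [h1, h2]⟩
  rw [hDe] at int
  by_cases k : f0 a = f0 b
  · have hB' : ∀ g : V → Fin q, Ok H B g → g a ≠ g b := fun g hg e => glue' f0 g hf0 hg (by tauto)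
    have hA' : ∀ f : V → Fin q, Ok H A f → f a = f b := fun f hf => by grind
    exact ⟨a, b, A, B, dirac_core h un int hab sep ⟨f0, hf0⟩ hA' hB'⟩
  · have hB' : ∀ g : V → Fin q, Ok H B g → g a = g b := fun g hg => by grind
    have hA' : ∀ f : V → Fin q, Ok H A f → f a ≠ f b := fun f hf e =>
      glue' f g0 hf hg0 (by have := hB' g0 hg0; tauto)
    exact ⟨a, b, B, A, dirac_core h (by rwa [union_comm]) (by rwa [inter_comm]) hab
      (fun u hu v hv k1 k2 k3 => sep v hv u hu k2 k1 k3.symm) ⟨g0, hg0⟩ hB' hA'⟩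

theorem two_le (hq : 3 ≤ q) (h : Crit q H S) : 2 ≤ S.card := by have := h.card (by omega); omega

theorem pot_of_star (hJ : J ≤ H ⊔ star u A) :
    pot q H S ≤ pot q J S + 2 * q * (A ∩ S).card := by
  have h1 := pot_star q H u A S
  have h2 := pot_mg (S := S) q (H := J) (J := H ⊔ star u A) fun _ _ _ _ h => hJ h
  linarith

theorem claimC (hq : 3 ≤ q) {F : SimpleGraph V} (hF : Ore q F S) :
    (∀ (J : SimpleGraph V) (X : Finset V), X.card ≤ S.card → Crit q J X → pot q J X ≤ (q:ℤ)^2 - q - 2) →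
    ∀ (D : SimpleGraph V) (u v w : V), F = D ⊔ star u {v} → u ≠ v → ¬ D.Adj u v → u ∈ S → v ∈ S → w ∈ S →
    w ≠ u → w ≠ v → (∀ X ⊆ S, X ≠ S → 2 ≤ X.card → (q:ℤ)^2 + q - 2 < pot q D X) →
    ∃ f : V → Fin q, Ok D S f ∧ f w ≠ f u := by
  induction hF with
  | @base F S h1 h2 =>
    intro IH D u v w hFD huv hD hu hv hw hwu hwv hX
    have auv : F.Adj u v := by rw [hFD]; right; simp [star, huv]
    obtain ⟨f, hf⟩ := h1.ed u hu v hv auv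
    refine ⟨f, fun x hx y hy hxy e => ?_, fun e => ?_⟩
    · rcases hf x hx y hy (by rw [hFD]; exact Or.inl hxy) e with ⟨rfl, rfl⟩ | ⟨rfl, rfl⟩
      · exact hD hxy
      · exact hD hxy.symm
    · rcases hf w hw u hu (h1.clq h2 w hw u hu hwu) e with ⟨rfl, rfl⟩ | ⟨rfl, _⟩
      · exact hwu rfl
      · exact hwv rfl
  | @comp F S a b A B h1 h2 h3 h4 i3 i4 =>
    intro IH D u v w hFD huv hD hu hv hw hwu hwv hX
    have auv : F.Adj u v := by rw [hFD]; right; simp [star, huv]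
    have nauv : ¬ ((u = a ∧ v = b) ∨ (u = b ∧ v = a)) := by
      rintro (⟨rfl, rfl⟩ | ⟨rfl, rfl⟩)
      · exact h2.na auv
      · exact h2.na auv.symm
    have cAB : (u ∈ A ∧ v ∈ A) → (u ∈ B ∧ v ∈ B) → False := fun k l => by
      have e1 := h2.ab k.1 l.1; have e2 := h2.ab k.2 l.2
      rcases e1 with e1 | e1 <;> rcases e2 with e2 | e2
      · grind
      · grind
      · grind
      · grind
    have BneA : ∃ z ∈ B, z ∉ A := by
      have := h4.crit.card (by omega)
      rw [card_erase_of_mem h2.bB] at this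
      have h5 : ({a, b} : Finset V).card < B.card := by grind
      obtain ⟨z, hz, hz'⟩ := exists_mem_notMem_of_card_lt_card h5
      refine ⟨z, hz, fun k => hz' ?_⟩
      rcases h2.ab k hz with rfl | rfl <;> simp
    have hnB : ¬ (u ∈ B ∧ v ∈ B) := by
      intro k
      obtain ⟨z, hz, hzA⟩ := BneA
      have := hX A h2.subA (fun e => hzA (e ▸ h2.subB hz)) (two_le hq h3.crit)
      have e : pot q D A = pot q F A := by
        rw [hFD, pot_edge_ne]; exact fun l => cAB l k
      rw [e, h2.potA h3] at this
      exact lt_irrefl _ this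
    have memS : ∀ x ∈ S, x ∈ A ∨ x ∈ B := fun x hx => by rw [← h2.un] at hx; exact mem_union.1 hx
    have huA : u ∈ A := by
      by_contra k
      have uB := (memS u hu).resolve_left k
      have vB : v ∉ B := by grind
      exact h2.sep v ((memS v hv).resolve_right vB) u uB vB k auv.symm
    have hvA : v ∈ A := by
      by_contra k
      have vB := (memS v hv).resolve_left k
      have uB : u ∉ B := by grind
      exact h2.sep u huA v vB uB k auv
    have DF : ∀ X ⊆ B, ∀ x ∈ X, ∀ y ∈ X, (F.Adj x y ↔ D.Adj x y) := fun X hXB x hx y hy => by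
      rw [hFD]; refine edge_adj_ne ?_ ?_
      · grind
      · grind
    have Dsep : ∀ u ∈ A, ∀ v ∈ B, u ∉ B → v ∉ A → ¬ D.Adj u v := fun x hx y hy k l m =>
      h2.sep x hx y hy k l (by rw [hFD]; exact Or.inl m)
    have neB : B ≠ S := by grind
    have gab : ∀ g : V → Fin q, Ok F B g → g a ≠ g b := by
      intro g hg e
      refine h4.crit.nc ⟨g, fun x hx y hy hxy => ?_⟩
      rw [mem_erase] at hx hy
      rcases hxy.2.2.2 with k | ⟨rfl, k⟩ | ⟨rfl, k⟩
      · exact hg x hx.2 y hy.2 k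
      · rw [e]; exact hg b h2.bB y hy.2 k
      · rw [e]; exact (hg b h2.bB x hx.2 k).symm
    have glue : ∀ f g : V → Fin q, Ok D A f → Ok F B g → f a = g a → f b = g b →
        Ok D S (fun x => if x ∈ A then f x else g x) := by
      intro f g hf hg e1 e2
      rw [← h2.un]
      refine hf.glue (hg.mono subset_rfl fun x hx y hy => (DF B subset_rfl x hx y hy).2) ?_ Dsep
      intro x xA xB
      rcases h2.ab xA xB with rfl | rfl <;> assumption
    have Dab : ¬ D.Adj a b := fun k => h2.na (by rw [hFD]; exact Or.inl k)
    have nD' : ¬ (D ⊔ star a {b}).Adj u v := by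
      rintro (k | ⟨_, ⟨k1, k2⟩ | ⟨k1, k2⟩⟩)
      · exact hD k
      · grind
      · grind
    have pD : pot q (D ⊔ star a {b}) A = pot q (F ⊔ star a {b}) A + 2 * q := by
      have e : F ⊔ star a {b} = (D ⊔ star a {b}) ⊔ star u {v} := by rw [hFD, sup_right_comm]
      rw [e, pot_edge q huA hvA huv nD']; ring
    by_cases hwA : w ∈ A
    · have cA : A.card ≤ S.card := card_le_card h2.subA
      obtain ⟨f, hf, hfw⟩ := i3 (fun J X hXc => IH J X (hXc.trans cA)) (D ⊔ star a {b}) u v w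
        (by rw [hFD, sup_right_comm]) huv nD' huA hvA hwA hwu hwv (by
          intro X hXA hXne hXc
          by_cases k : a ∈ X ∧ b ∈ X
          · have e1 := pot_edge q k.1 k.2 h2.ne Dab
            have int : X ∩ B = {a, b} := by
              rw [← h2.int]; ext x; simp only [mem_inter]
              refine ⟨fun l => ⟨hXA l.1, l.2⟩, fun l => ⟨?_, l.2⟩⟩
              rcases h2.ab l.1 l.2 with rfl | rfl
              · exact k.1
              · exact k.2
            have e2 := pot_glue (A := X) (B := B) (H := D) q (fun x hx y hy k1 k2 => by
              by_cases l : y ∈ A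
              · rcases h2.ab l hy with rfl | rfl <;> [exact absurd k.1 k2; exact absurd k.2 k2]
              · exact Dsep x (hXA hx) y hy k1 l)
            rw [int, pot_pair q h2.ne Dab] at e2
            have e3 : pot q D B = pot q F B := (pot_congr q (DF B subset_rfl)).symm
            rw [e3, h2.potB h4] at e2
            have := hX (X ∪ B) (union_subset (hXA.trans h2.subA) h2.subB) (by
              intro e
              refine hXne (subset_antisymm hXA fun x hx => ?_)
              have := h2.subA hx
              rw [← e, mem_union] at this
              rcases this with l | l
              · exact l
              · rcases h2.ab hx l with rfl | rfl
                · exact k.1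
                · exact k.2) (hXc.trans (card_le_card subset_union_left))
            rw [e1]; linarith
          · rw [pot_edge_ne q k]
            refine hX X (hXA.trans h2.subA) (fun e => ?_) hXc
            exact hXne (subset_antisymm hXA (e ▸ h2.subA)))
      obtain ⟨g, hg⟩ := h1.sub h2.subB neB
      have fab : f a ≠ f b := hf a h2.aA b h2.bA (Or.inr (by simp [star, h2.ne]))
      have := gab g hg
      obtain ⟨π, e1, e2⟩ := perm2 (c1 := g a) (c2 := g b) (d1 := f a) (d2 := f b) (iff_of_false this fab)
      refine ⟨_, glue f _ (hf.mono subset_rfl fun _ _ _ _ k => Or.inl k) (hg.perm π) e1.symm e2.symm, ?_⟩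
      simpa only [hwA, huA, if_true] using hfw
    · have hwB := (memS w hw).resolve_left hwA
      have wa : w ≠ a := fun e => hwA (e ▸ h2.aA)
      have wb : w ≠ b := fun e => hwA (e ▸ h2.bA)
      obtain ⟨f, hf⟩ := h3.crit.ed u huA v hvA (Or.inl auv)
      have fD : Ok (D ⊔ star a {b}) A f := fun x hx y hy hxy e => by
        have : (F ⊔ star a {b}).Adj x y := by grind
        rcases hf x hx y hy this e with ⟨rfl, rfl⟩ | ⟨rfl, rfl⟩
        · exact nD' hxy
        · exact nD' hxy.symm
      have fab : f a ≠ f b := fD a h2.aA b h2.bA (Or.inr (by simp [star, h2.ne]))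
      have fD' : Ok D A f := fD.mono subset_rfl fun _ _ _ _ k => Or.inl k
      suffices ∃ g : V → Fin q, Ok F B g ∧ g a = f a ∧ g b = f b ∧ g w ≠ f u by
        obtain ⟨g, hg, e1, e2, e3⟩ := this
        refine ⟨_, glue f g fD' hg e1.symm e2.symm, ?_⟩
        simpa only [hwA, huA, if_true, if_false] using e3
      have sub1 : ∀ c ∈ B, ∃ g : V → Fin q, Ok F B g ∧ (w ≠ c → g w ≠ g c) := by
        intro c hc
        by_contra hcon
        push Not at hcon
        have : ¬ Col q (F ⊔ star w {c}) B := by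
          rintro ⟨g, hg⟩
          obtain ⟨k1, k2⟩ := hcon g (hg.mono subset_rfl fun _ _ _ _ k => Or.inl k)
          exact hg w hwB c hc (Or.inr (by simp [star, k1])) k2
        obtain ⟨X, hXB, J, hJ, hcr⟩ := extract this
        have i1 := IH J X (card_le_card (hXB.trans h2.subB)) hcr
        have i2 := pot_of_star (q := q) (S := X) hJ
        have i3 : ({c} ∩ X : Finset V).card ≤ 1 := card_le_card inter_subset_left
        have i4 := hX X (hXB.trans h2.subB) (fun e => neB (subset_antisymm h2.subB (e ▸ hXB))) (two_le hq hcr)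
        rw [← pot_congr q (DF X hXB)] at i4
        have : (({c} ∩ X : Finset V).card : ℤ) ≤ 1 := by exact_mod_cast i3
        have hq' : (0:ℤ) ≤ q := by positivity
        nlinarith
      by_cases c1 : f u = f a
      · obtain ⟨g, hg, hgw⟩ := sub1 a h2.aB
        have := gab g hg
        obtain ⟨π, e1, e2⟩ := perm2 (c1 := g a) (c2 := g b) (d1 := f a) (d2 := f b) (iff_of_false this fab)
        refine ⟨_, hg.perm π, e1, e2, ?_⟩
        rw [c1, ← e1]; exact fun k => hgw wa (π.injective k)
      by_cases c2 : f u = f b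
      · obtain ⟨g, hg, hgw⟩ := sub1 b h2.bB
        have := gab g hg
        obtain ⟨π, e1, e2⟩ := perm2 (c1 := g a) (c2 := g b) (d1 := f a) (d2 := f b) (iff_of_false this fab)
        refine ⟨_, hg.perm π, e1, e2, ?_⟩
        rw [c2, ← e2]; exact fun k => hgw wb (π.injective k)
      by_cases c3 : ∃ g : V → Fin q, Ok F B g ∧ (g w = g a ∨ g w = g b)
      · obtain ⟨g, hg, hgw⟩ := c3
        have := gab g hg
        obtain ⟨π, e1, e2⟩ := perm2 (c1 := g a) (c2 := g b) (d1 := f a) (d2 := f b) (iff_of_false this fab)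
        refine ⟨_, hg.perm π, e1, e2, ?_⟩
        rcases hgw with k | k
        · grind
        · grind
      push Not at c3
      by_cases hq4 : 4 ≤ q
      · obtain ⟨g, hg⟩ := h1.sub h2.subB neB
        obtain ⟨π, e1, e2, e3⟩ := perm3 hq4 (e := f u) (gab g hg) fab (c3 g hg).1 (c3 g hg).2
        exact ⟨_, hg.perm π, e1, e2, e3⟩
      exfalso
      have q3 : q = 3 := by omega
      obtain ⟨t, htA, htB⟩ : ∃ t ∈ A, t ∉ B := by grind
      have nct : ¬ Col q (rwr F t {a, b, w}) (insert t B) := by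
        rintro ⟨g, hg⟩
        have hgB : Ok F B g := hg.mono (subset_insert _ _) fun x hx y hy hxy =>
          (rwr_adj (ne_of_mem_of_not_mem hx htB) (ne_of_mem_of_not_mem hy htB)).2 hxy
        have hn : ∀ z ∈ ({a, b, w} : Finset V), g t ≠ g z := by
          intro z hz
          have zB : z ∈ B := by
            simp only [mem_insert, mem_singleton] at hz
            rcases hz with rfl | rfl | rfl
            · exact h2.aB
            · exact h2.bB
            · exact hwB
          exact hg t (by simp) z (by simp [zB]) (rwr_adj_v.2 ⟨ne_of_mem_of_not_mem zB htB, hz⟩)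
        have n1 := hn a (by simp); have n2 := hn b (by simp); have n3 := hn w (by simp)
        have n4 := gab g hgB; have n5 := c3 g hgB
        have : ({g t, g a, g b, g w} : Finset (Fin q)).card = 4 := by grind
        have k := card_le_univ ({g t, g a, g b, g w} : Finset (Fin q))
        rw [this, Fintype.card_fin] at k; omega
      obtain ⟨X0, hX0, J, hJ, hcr⟩ := extract nct
      have cX0 : X0.card ≤ S.card := card_le_card (hX0.trans (insert_subset (h2.subA htA) h2.subB))
      have p0 := IH J X0 cX0 hcr
      have htX : t ∈ X0 := by
        by_contra k
        refine hcr.nc ?_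
        have hXB : X0 ⊆ B := by grind
        refine (h1.sub h2.subB neB).mono hXB fun x hx y hy hxy => ?_
        exact (rwr_adj (ne_of_mem_of_not_mem hx k) (ne_of_mem_of_not_mem hy k)).1 (hJ hxy)
      have nbt : nb J X0 t ⊆ {a, b, w} := fun z hz => by
        rw [mem_nb] at hz; exact (rwr_adj_v.1 (hJ hz.2)).2
      have cd := hcr.deg htX
      have e3 : nb J X0 t = {a, b, w} := eq_of_subset_of_card_le nbt (card_le_three.trans (by omega))
      have c3' : (nb J X0 t).card = 3 := by grind
      set X := X0.erase t with hXdef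
      have hXB : X ⊆ B := fun x hx => (mem_insert.1 (hX0 (mem_of_mem_erase hx))).resolve_left (ne_of_mem_erase hx)
      have pX : pot q F X ≤ 12 := by
        have e1 := pot_erase q J htX
        have e2 : pot q F X ≤ pot q J X := pot_mg q fun x hx y hy hxy =>
          (rwr_adj (ne_of_mem_erase hx) (ne_of_mem_erase hy)).1 (hJ hxy)
        rw [c3'] at e1; subst q3; norm_num at e1 p0; linarith
      have habX : a ∈ X ∧ b ∈ X := by
        have h1 : a ∈ nb J X0 t := by rw [e3]; simp
        have h2 : b ∈ nb J X0 t := by rw [e3]; simp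
        exact ⟨nb_erase J X0 t h1, nb_erase J X0 t h2⟩
      have int : A ∩ X = {a, b} := by
        ext x; simp only [mem_inter, mem_insert, mem_singleton]; constructor
        · rintro ⟨k, l⟩; exact h2.ab k (hXB l)
        · rintro (rfl | rfl)
          · exact ⟨h2.aA, habX.1⟩
          · exact ⟨h2.bA, habX.2⟩
      have e2 := pot_glue (A := A) (B := X) (H := D) q (fun x hx y hy k1 k2 k3 => by
        by_cases l : x ∈ B
        · rcases h2.ab hx l with rfl | rfl <;> [exact k1 habX.1; exact k1 habX.2]
        · exact Dsep x hx y (hXB hy) l k2 k3)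
      rw [int, pot_pair q h2.ne Dab, ← pot_congr q (DF X hXB)] at e2
      have e4 := pot_edge q h2.aA h2.bA h2.ne Dab
      rw [pD, h3.pot] at e4
      have := hX (A ∪ X) (union_subset h2.subA (hXB.trans h2.subB)) (by
        intro e
        have : X = B := by
          refine subset_antisymm hXB fun x hx => ?_
          have k := h2.subB hx
          rw [← e, mem_union] at k
          rcases k with k | k
          · rcases h2.ab k hx with rfl | rfl
            · exact habX.1
            · exact habX.2
          · exact k
        rw [this, h2.potB h4] at pX
        subst q3; norm_num at pX) ((two_le hq h3.crit).trans (card_le_card subset_union_left))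
      subst q3
      norm_num at *
      linarith

noncomputable def tw (H : SimpleGraph V) (S : Finset V) : ℕ :=
  ((S ×ˢ S).filter fun p => insert p.1 (nb H S p.1) = insert p.2 (nb H S p.2)).card

def Sm (H' : SimpleGraph V) (S' : Finset V) (H : SimpleGraph V) (S : Finset V) : Prop :=
  S'.card < S.card ∨ (S'.card = S.card ∧ (E H' S' S' < E H S S ∨ (E H' S' S' = E H S S ∧ tw H S < tw H' S')))

def yy (q : ℕ) : ℤ := max (2 * (q:ℤ) - 4) ((q:ℤ)^2 - 3 * q - 2)

structure Ctx (q : ℕ) (H : SimpleGraph V) (S : Finset V) : Prop where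
  hq : 3 ≤ q
  cr : Crit q H S
  tc : TC H S
  py : yy q < pot q H S
  big : q + 1 < S.card
  ih : ∀ H' S', Sm H' S' H S → Crit q H' S' → yy q < pot q H' S' → Ore q H' S'

theorem Ctx.hz (c : Ctx q H S) : (3:ℤ) ≤ q := by exact_mod_cast c.hq
theorem Ctx.p1 (c : Ctx q H S) : 2 * (q:ℤ) - 4 < pot q H S := lt_of_le_of_lt (le_max_left _ _) c.py
theorem Ctx.p2 (c : Ctx q H S) : (q:ℤ)^2 - 3 * q - 2 < pot q H S := lt_of_le_of_lt (le_max_right _ _) c.py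
theorem Ctx.sm (c : Ctx q H S) (h : Crit q J T) (hs : Sm J T H S) :
    (Ore q J T ∧ pot q J T = (q:ℤ)^2 - q - 2) ∨
    ((pot q J T ≤ 2 * (q:ℤ) - 4 ∨ pot q J T ≤ (q:ℤ)^2 - 3 * q - 2) ∧ pot q J T < pot q H S) := by
  by_cases k : yy q < pot q J T
  · have := c.ih J T hs h k
    exact Or.inl ⟨this, this.pot⟩
  · right
    have k' := not_lt.1 k
    exact ⟨le_max_iff.1 k', lt_of_le_of_lt k' c.py⟩

theorem Ctx.le (c : Ctx q H S) (h : Crit q J T) (hs : T.card < S.card) : pot q J T ≤ (q:ℤ)^2 - q - 2 := by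
  have := c.hz
  rcases c.sm h (Or.inl hs) with k | ⟨k | k, -⟩
  · exact k.2.le
  · nlinarith
  · linarith

def yg (H : SimpleGraph V) (R : Finset V) (φ : V → Fin q) : SimpleGraph V where
  Adj x y := x ≠ y ∧ ((x ∉ R ∧ y ∉ R ∧ H.Adj x y) ∨ (x ∈ R ∧ y ∈ R) ∨
    (x ∈ R ∧ y ∉ R ∧ ∃ r ∈ R, φ r = φ x ∧ H.Adj r y) ∨ (y ∈ R ∧ x ∉ R ∧ ∃ r ∈ R, φ r = φ y ∧ H.Adj r x))
  symm := ⟨fun _ _ h => ⟨h.1.symm, by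
    rcases h.2 with k | k | k | k
    · exact Or.inl ⟨k.2.1, k.1, k.2.2.symm⟩
    · grind
    · grind
    · exact Or.inr (Or.inr (Or.inl k))⟩⟩
  loopless := ⟨fun _ h => h.1 rfl⟩

structure MLr (q : ℕ) (H : SimpleGraph V) (S R : Finset V) (φ : V → Fin q) (X Z : Finset V)
    (J : SimpleGraph V) : Prop where
  XR : X ⊆ R
  ZS : Z ⊆ S
  ZR : Disjoint R Z
  inj : ∀ x ∈ X, ∀ y ∈ X, φ x = φ y → x = y
  cr : Crit q J (X ∪ Z)
  Xne : X.Nonempty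
  Zne : Z.Nonempty
  lt : (X ∪ Z).card < S.card
  Xq : X.card ≤ q
  zz : ∀ z ∈ Z, ∀ z' ∈ Z, J.Adj z z' → H.Adj z z'
  zx : ∀ z ∈ Z, ∀ x ∈ X, J.Adj z x → ∃ r ∈ R, φ r = φ x ∧ H.Adj z r

theorem ML (c : Crit q H S) (hq : 0 < q) {φ : V → Fin q} (hR : R ⊆ S) (h1 : q + 1 ≤ R.card) (h2 : R.card < S.card)
    (hφ : Ok H R φ) : ∃ X Z J, MLr q H S R φ X Z J := by
  obtain ⟨X0, hX0, hX1⟩ : ∃ X0 ⊆ R, (∀ x ∈ X0, ∀ y ∈ X0, φ x = φ y → x = y) ∧ X0.image φ = R.image φ := by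
    obtain ⟨X0, h, h'⟩ := exists_subset_injOn_image_eq_of_surjOn (s := (R : Set V)) (t := R.image φ) (f := φ) (by
      intro y hy; simpa using hy)
    refine ⟨X0, by exact_mod_cast h, fun x hx y hy e => h'.1 hx hy e, h'.2⟩
  have cX0 : X0.card ≤ q := by
    have : (X0.image φ).card = X0.card := card_image_of_injOn fun x hx y hy e => hX1.1 x hx y hy e
    rw [← this]; simpa using card_le_univ (X0.image φ)
  have rep : ∀ r ∈ R, ∃ x ∈ X0, φ x = φ r := fun r hr => by
    have : φ r ∈ X0.image φ := by grind
    simpa using this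
  have nc : ¬ Col q (yg H R φ) (X0 ∪ (S \ R)) := by
    rintro ⟨ψ, hψ⟩
    choose! ρ hρ1 hρ2 using rep
    refine c.nc ⟨fun x => if x ∈ R then ψ (ρ x) else ψ x, fun x hx y hy hxy => ?_⟩
    by_cases xR : x ∈ R <;> by_cases yR : y ∈ R <;> simp only [xR, yR, if_true, if_false]
    · refine hψ _ (by simp [hρ1 x xR]) _ (by simp [hρ1 y yR]) ⟨fun e => ?_, Or.inr (Or.inl ⟨hX0 (hρ1 x xR), hX0 (hρ1 y yR)⟩)⟩
      exact hφ x xR y yR hxy (by rw [← hρ2 x xR, ← hρ2 y yR, e])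
    · exact hψ _ (by simp [hρ1 x xR]) _ (by simp [hy, yR]) ⟨ne_of_mem_of_not_mem (hX0 (hρ1 x xR)) yR,
        Or.inr (Or.inr (Or.inl ⟨hX0 (hρ1 x xR), yR, x, xR, (hρ2 x xR).symm, hxy⟩))⟩
    · exact hψ _ (by simp [hx, xR]) _ (by simp [hρ1 y yR]) ⟨(ne_of_mem_of_not_mem (hX0 (hρ1 y yR)) xR).symm,
        Or.inr (Or.inr (Or.inr ⟨hX0 (hρ1 y yR), xR, y, yR, (hρ2 y yR).symm, hxy.symm⟩))⟩
    · exact hψ _ (by simp [hx, xR]) _ (by simp [hy, yR]) ⟨hxy.ne, Or.inl ⟨xR, yR, hxy⟩⟩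
  obtain ⟨W, hW, J, hJ, hcr⟩ := extract nc
  have eW : (W ∩ R) ∪ (W \ R) = W := by ext; simp; tauto
  have WX : W ∩ R ⊆ X0 := fun x hx => by grind
  have WS : W \ R ⊆ S := fun x hx => by grind
  have zz : ∀ z ∈ W \ R, ∀ z' ∈ W \ R, J.Adj z z' → H.Adj z z' := fun z hz z' hz' k => by
    rw [mem_sdiff] at hz hz'
    have := (hJ k).2; tauto
  refine ⟨W ∩ R, W \ R, J, inter_subset_right, WS, disjoint_sdiff, fun x hx y hy => hX1.1 x (WX hx) y (WX hy),
    by rwa [eW], ?_, ?_, ?_, (card_le_card WX).trans cX0, zz, ?_⟩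
  · by_contra hn
    rw [not_nonempty_iff_eq_empty] at hn
    rw [hn, empty_union] at eW
    rw [← eW] at hcr
    refine hcr.nc ((c.sub WS ?_).mono subset_rfl zz)
    intro e
    have : R.Nonempty := card_pos.1 (by omega)
    obtain ⟨r, hr⟩ := this
    have k := hR hr
    rw [← e, mem_sdiff] at k; exact k.2 hr
  · by_contra hn
    rw [not_nonempty_iff_eq_empty] at hn
    rw [hn, union_empty] at eW
    have := hcr.card hq
    rw [← eW] at this
    have := card_le_card WX
    omega
  · rw [eW]
    refine lt_of_le_of_lt (card_le_card hW) ?_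
    refine lt_of_le_of_lt (card_union_le _ _) ?_
    rw [card_sdiff_of_subset hR]; omega
  · intro z hz x hx k
    rw [mem_sdiff] at hz; rw [mem_inter] at hx
    rcases (hJ k).2 with l | l | l | ⟨-, -, r, hr, e, l⟩
    · grind
    · grind
    · grind
    · exact ⟨r, hr, e, l.symm⟩

def pc (q : ℕ) (j : ℕ) : ℤ := (j:ℤ) * ((q:ℤ)^2 + 2*q - 2 - q * j)

theorem pc_one : pc q 1 = (q:ℤ)^2 + q - 2 := by simp [pc]; ring
theorem pc_le {j : ℕ} (hq : 2 ≤ q) (h1 : 1 ≤ j) (h2 : j ≤ q) : (q:ℤ)^2 + q - 2 ≤ pc q j := by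
  have a0 : (1:ℤ) ≤ j := by exact_mod_cast h1
  have a1 : (0:ℤ) ≤ (j:ℤ) - 1 := by linarith
  have a2 : (j:ℤ) ≤ q := by exact_mod_cast h2
  have a3 : (2:ℤ) ≤ q := by exact_mod_cast hq
  have : (0:ℤ) ≤ ((j:ℤ) - 1) * ((q:ℤ)^2 + q - 2 - q * j) := mul_nonneg a1 (by nlinarith)
  unfold pc; nlinarith
theorem pc_le2 {j : ℕ} (hq : 2 ≤ q) (h1 : 2 ≤ j) (h2 : j ≤ q) : 2 * (q:ℤ)^2 - 2 * q ≤ pc q j := by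
  have a1 : (2:ℤ) ≤ j := by exact_mod_cast h1
  have a2 : (j:ℤ) ≤ q := by exact_mod_cast h2
  have a3 : (2:ℤ) ≤ q := by exact_mod_cast hq
  have : (0:ℤ) ≤ ((q:ℤ) - j) * ((q:ℤ) * j - 2 * q + 2) := mul_nonneg (by linarith) (by nlinarith)
  unfold pc; nlinarith

theorem pot_small (hq : 3 ≤ q) (H : SimpleGraph V) (h1 : 2 ≤ R.card) (h2 : R.card ≤ q) :
    2 * (q:ℤ)^2 - 2 * q ≤ pot q H R :=
  (pc_le2 (by omega) h1 h2).trans (pot_clq_le q H R)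

section
variable {φ : V → Fin q} (m : MLr q H S R φ X Z J)
include m

theorem MLr.nbz {z : V} (hz : z ∈ Z) :
    (nb J X z).card + (nb H (R.filter fun r => ∀ x ∈ X, φ r ≠ φ x) z).card ≤ (nb H R z).card := by
  have : ∀ x ∈ nb J X z, ∃ r ∈ R, φ r = φ x ∧ H.Adj z r := fun x hx => by
    rw [mem_nb] at hx; exact m.zx z hz x hx.1 hx.2
  choose! ρ h1 h2 h3 using this
  have i1 : ((nb J X z).image ρ).card = (nb J X z).card := by
    refine card_image_of_injOn fun x hx y hy e => ?_
    refine m.inj x (nb_sub hx) y (nb_sub hy) ?_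
    rw [← h2 x hx, ← h2 y hy, e]
  rw [← i1, ← card_union_of_disjoint]
  · refine card_le_card (union_subset ?_ ?_)
    · grind [mem_nb, nb_sub, Clq, Ok]
    · grind [mem_nb, nb_sub, Clq, Ok]
  · rw [Finset.disjoint_left]; intro r hr hr'
    obtain ⟨x, hx, rfl⟩ := mem_image.1 hr
    rw [mem_nb, mem_filter] at hr'
    exact hr'.1.2 x (nb_sub hx) (h2 x hx)

theorem MLr.ezx : E J Z X + E H Z (R.filter fun r => ∀ x ∈ X, φ r ≠ φ x) ≤ E H Z R := by
  rw [E_sum, E_sum, E_sum, ← sum_add_distrib]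
  exact sum_le_sum fun z hz => by exact_mod_cast m.nbz hz

theorem MLr.ezz : E J Z Z ≤ E H Z Z := E_mono subset_rfl subset_rfl m.zz

theorem MLr.XZ : Disjoint X Z := disjoint_of_subset_left m.XR m.ZR

theorem MLr.eq : pot q H (R ∪ Z) = pot q H R + pot q J (X ∪ Z) - pot q J X - q * (E H Z Z - E J Z Z)
    - 2 * q * (E H Z R - E J Z X) := by
  rw [pot_union q H m.ZR, pot_union q J m.XZ, E_sym H R Z, E_sym J X Z]
  have : pot q H Z - pot q J Z = - q * (E H Z Z - E J Z Z) := by unfold pot; ring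
  linarith

theorem MLr.le : pot q H (R ∪ Z) ≤ pot q H R + pot q J (X ∪ Z) - pc q X.card
    - 2 * q * E H Z (R.filter fun r => ∀ x ∈ X, φ r ≠ φ x) := by
  have h1 := m.eq
  have h2 := m.ezx
  have h3 := m.ezz
  have h4 : pc q X.card ≤ pot q J X := pot_clq_le q J X
  have hq : (0:ℤ) ≤ q := by positivity
  nlinarith [mul_le_mul_of_nonneg_left h2 hq, mul_le_mul_of_nonneg_left h3 hq]

theorem MLr.sub (hR : R ⊆ S) : R ∪ Z ⊆ S := union_subset hR m.ZS
theorem MLr.Xpos : 1 ≤ X.card := m.Xne.card_pos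
end

theorem eq_or_lt (h : T ⊆ S) : T = S ∨ T.card < S.card := by
  rcases h.eq_or_ssubset with k | k
  · exact Or.inl k
  · exact Or.inr (card_lt_card k)

theorem Ctx.subcol (c : Ctx q H S) (h : T ⊆ S) (h' : T.card < S.card) : Col q H T :=
  c.cr.sub h (fun e => by rw [e] at h'; exact lt_irrefl _ h')

theorem Ctx.S1 (c : Ctx q H S) : ∀ R ⊆ S, 2 ≤ R.card → R.card < S.card → (q:ℤ)^2 - q - 2 < pot q H R := by
  by_contra hcon
  push Not at hcon
  obtain ⟨R0, a1, a2, a3, a4⟩ := hcon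
  obtain ⟨R, hR, hmin⟩ := exists_min_image (S.powerset.filter fun R => 2 ≤ R.card ∧ R.card < S.card)
    (fun R => pot q H R) ⟨R0, by simp [a1, a2, a3]⟩
  simp only [mem_filter, mem_powerset] at hR hmin
  have pR := (hmin R0 ⟨a1, a2, a3⟩).trans a4
  have hz := c.hz
  have cR : q + 1 ≤ R.card := by
    by_contra k
    have := pot_small c.hq H hR.2.1 (by omega)
    nlinarith
  obtain ⟨φ, hφ⟩ := c.subcol hR.1 hR.2.2
  obtain ⟨X, Z, J, m⟩ := ML c.cr (by omega) hR.1 cR hR.2.2 hφ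
  have h1 := m.le
  have h2 := pc_le (by omega) m.Xpos m.Xq
  have h3 := c.le m.cr m.lt
  have h4 := E_nn H Z (R.filter fun r => ∀ x ∈ X, φ r ≠ φ x)
  have h5 : (0:ℤ) ≤ 2 * q * E H Z (R.filter fun r => ∀ x ∈ X, φ r ≠ φ x) := by positivity
  rcases eq_or_lt (m.sub hR.1) with k | k
  · rw [k] at h1; have := c.p2; linarith
  · have := hmin (R ∪ Z) ⟨m.sub hR.1, hR.2.1.trans (card_le_card subset_union_left), k⟩
    linarith

theorem Ctx.S2 (c : Ctx q H S) : ∀ R ⊆ S, 2 ≤ R.card → R.card < S.card → (q:ℤ)^2 + q - 2 < pot q H R := by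
  by_contra hcon
  push Not at hcon
  obtain ⟨R0, a1, a2, a3, a4⟩ := hcon
  obtain ⟨R, hR, hmin⟩ := exists_min_image (S.powerset.filter fun R => 2 ≤ R.card ∧ R.card < S.card ∧
    pot q H R ≤ (q:ℤ)^2 + q - 2) (fun R => R.card) ⟨R0, by simp [a1, a2, a3, a4]⟩
  simp only [mem_filter, mem_powerset] at hR hmin
  obtain ⟨RS, R2, Rn, pR⟩ := hR
  have hz := c.hz
  have cR : q + 1 ≤ R.card := by
    by_contra k
    have := pot_small c.hq H R2 (by omega)
    nlinarith
  have key : ∀ φ : V → Fin q, Ok H R φ → pot q H S + 2 * q ≤ pot q H R ∧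
      ∃ x0, ∀ r ∈ R, ∀ z ∈ S, z ∉ R → H.Adj z r → φ r = φ x0 := by
    intro φ hφ
    obtain ⟨X, Z, J, m⟩ := ML c.cr (by omega) RS cR Rn hφ
    have h1 := m.le
    have h2 := pc_le (by omega) m.Xpos m.Xq
    have h3 := c.le m.cr m.lt
    have h4 := E_nn H Z (R.filter fun r => ∀ x ∈ X, φ r ≠ φ x)
    have h5 : (0:ℤ) ≤ 2 * q * E H Z (R.filter fun r => ∀ x ∈ X, φ r ≠ φ x) := by positivity
    have e : R ∪ Z = S := by
      rcases eq_or_lt (m.sub RS) with k | k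
      · exact k
      · have := c.S1 (R ∪ Z) (m.sub RS) (R2.trans (card_le_card subset_union_left)) k
        linarith
    rw [e] at h1
    refine ⟨by linarith, ?_⟩
    have p1 := c.p1; have p2 := c.p2
    have hO : pot q J (X ∪ Z) = (q:ℤ)^2 - q - 2 := by
      rcases c.sm m.cr (Or.inl m.lt) with k | ⟨-, k⟩
      · exact k.2
      · linarith
    have hX : X.card = 1 := by
      by_contra k
      have := pc_le2 (q := q) (j := X.card) (by omega) (by have := m.Xpos; omega) m.Xq
      nlinarith
    have hm : E H Z (R.filter fun r => ∀ x ∈ X, φ r ≠ φ x) < 1 := by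
      by_contra k
      have : (q:ℤ) * 1 ≤ q * E H Z (R.filter fun r => ∀ x ∈ X, φ r ≠ φ x) :=
        mul_le_mul_of_nonneg_left (not_lt.1 k) (by linarith)
      nlinarith
    obtain ⟨x0, hx0⟩ := card_eq_one.1 hX
    refine ⟨x0, fun r hr z hz hzR hadj => ?_⟩
    by_contra k
    have hzZ : z ∈ Z := by grind
    have : E H {z} {r} ≤ E H Z (R.filter fun r => ∀ x ∈ X, φ r ≠ φ x) := E_ms H (by simpa) (by
      simp [hr, hx0]; exact k)
    have e1 : E H {z} {r} = 1 := by simp [E, hadj, filter_singleton]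
    linarith
  set D := R.filter (fun r => ∃ z ∈ S, z ∉ R ∧ H.Adj z r) with hD
  have mono : ∀ φ : V → Fin q, Ok H R φ → ∀ r ∈ D, ∀ r' ∈ D, φ r = φ r' := by grind
  have cD : 2 < D.card := by
    by_contra k
    obtain ⟨r, hr, z, hz, hadj⟩ := c.tc (R \ D) (sdiff_subset.trans RS) (S \ R) sdiff_subset
      (disjoint_of_subset_left sdiff_subset disjoint_sdiff) (by
        rw [← card_pos]; have := le_card_sdiff D R; have := c.hq; omega) (by
        rw [← card_pos]; have := le_card_sdiff R S; omega) (by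
        refine le_trans (card_le_card (t := D) ?_) (by omega)
        intro x hx; simp only [mem_sdiff, mem_union, not_or] at hx; tauto)
    rw [mem_sdiff] at hr hz
    exact hr.2 (mem_filter.2 ⟨hr.1, z, hz.1, hz.2, hadj.symm⟩)
  obtain ⟨u, v, w, hu, hv, hw, huv, huw, hvw⟩ := two_lt_card_iff.1 cD
  have DR : D ⊆ R := filter_subset _ _
  obtain ⟨φ0, hφ0⟩ := c.subcol RS Rn
  have pS := (key φ0 hφ0).1
  have nuv : ¬ H.Adj u v := by grind [mem_nb, nb_sub, Clq, Ok]
  have nc : ¬ Col q (H ⊔ star u {v}) R := by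
    rintro ⟨f, hf⟩
    exact hf u (DR hu) v (DR hv) (Or.inr (by simp [star, huv]))
      (mono f (hf.mono subset_rfl fun _ _ _ _ k => Or.inl k) u hu v hv)
  obtain ⟨X, hX, J, hJ, hcr⟩ := extract nc
  have cXS : X.card < S.card := lt_of_le_of_lt (card_le_card hX) Rn
  have eX : X = R := by
    have h1 := c.le hcr cXS
    have h2 := pot_of_star (q := q) (S := X) hJ
    have h3 : ({v} ∩ X : Finset V).card ≤ 1 := card_le_card inter_subset_left
    have h3' : (({v} ∩ X : Finset V).card : ℤ) ≤ 1 := by exact_mod_cast h3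
    have := hmin X ⟨hX.trans RS, two_le c.hq hcr, cXS, by nlinarith⟩
    exact eq_of_subset_of_card_le hX this
  subst eX
  have pe := pot_edge q (DR hu) (DR hv) huv nuv
  have pJ := pot_mg (S := X) q (H := J) (J := H ⊔ star u {v}) fun _ _ _ _ h => hJ h
  have hyo : yy q < pot q J X := by
    have := c.py; linarith
  have hO := c.ih J X (Or.inl Rn) hcr hyo
  have full : ∀ x ∈ X, ∀ y ∈ X, (H ⊔ star u {v}).Adj x y → J.Adj x y := by
    intro x hx y hy hxy
    by_contra k
    have := E_lt2 (H := J) (J := H ⊔ star u {v}) (A := X) (fun _ _ _ _ h => hJ h) hx hy hxy k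
    have h1 := hO.pot
    have h2 := c.S1 X RS R2 Rn
    unfold KY.pot at h1 h2 pe
    nlinarith [mul_le_mul_of_nonneg_left this (by linarith : (0:ℤ) ≤ q)]
  have Juv : J.Adj u v := full u (DR hu) v (DR hv) (Or.inr (by simp [star, huv]))
  have hDH : ∀ x ∈ X, ∀ y ∈ X, ((J \ star u {v}).Adj x y ↔ H.Adj x y) := by
    intro x hx y hy
    rw [SimpleGraph.sdiff_adj]; constructor
    · rintro ⟨k1, k2⟩; exact (hJ k1).resolve_right k2
    · intro k; refine ⟨full x hx y hy (Or.inl k), ?_⟩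
      rintro ⟨_, ⟨rfl, l⟩ | ⟨rfl, l⟩⟩
      · grind
      · rw [mem_singleton] at l; subst l; exact nuv k.symm
  obtain ⟨f, hf, hfw⟩ := claimC c.hq hO (fun J' X' k1 k2 => c.le k2 (lt_of_le_of_lt k1 Rn)) (J \ star u {v}) u v w (by
      refine (sdiff_sup_cancel ?_).symm
      intro x y h
      rcases h with ⟨_, ⟨rfl, l⟩ | ⟨rfl, l⟩⟩
      · grind
      · rw [mem_singleton] at l; rw [l]; exact Juv.symm) huv
    (fun k => nuv ((hDH u (DR hu) v (DR hv)).1 k)) (DR hu) (DR hv) (DR hw) huw.symm hvw.symm (by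
      intro Y hY hYne hYc
      by_contra k
      rw [pot_congr q fun x hx y hy => hDH x (hY hx) y (hY hy)] at k
      have := hmin Y ⟨hY.trans RS, hYc, lt_of_le_of_lt (card_le_card hY) Rn, not_lt.1 k⟩
      exact hYne (eq_of_subset_of_card_le hY this))
  exact hfw (mono f (hf.mono subset_rfl fun x hx y hy k => (hDH x hx y hy).2 k) w hw u hu)

theorem Ctx.addE (c : Ctx q H S) (i : ℤ) (K : SimpleGraph V) (hT : T ⊆ S) (hTn : T.card < S.card)
    (h1 : ∀ X ⊆ T, pot q H X ≤ pot q K X + 2 * q * i)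
    (h2 : ∀ X ⊆ T, 2 ≤ X.card → (q:ℤ)^2 - q - 2 + 2 * q * i < pot q H X) : Col q K T := by
  by_contra hc
  obtain ⟨X, hX, J, hJ, hcr⟩ := extract hc
  have a1 := c.le hcr (lt_of_le_of_lt (card_le_card hX) hTn)
  have a2 := h1 X hX
  have a3 := h2 X hX (two_le c.hq hcr)
  have a4 := pot_mg (S := X) q (H := J) (J := K) fun _ _ _ _ h => hJ h
  linarith

theorem Ctx.addS (c : Ctx q H S) (i : ℕ) {N : Finset V} (u : V) (hN : N.card ≤ i) (hT : T ⊆ S) (hTn : T.card < S.card)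
    (h2 : ∀ X ⊆ T, 2 ≤ X.card → (q:ℤ)^2 - q - 2 + 2 * q * i < pot q H X) : Col q (H ⊔ star u N) T := by
  refine c.addE i _ hT hTn (fun X hX => ?_) h2
  have h1 := pot_star q H u N X
  have h3 : (N ∩ X).card ≤ i := (card_le_card inter_subset_left).trans hN
  have h4 : ((N ∩ X).card : ℤ) ≤ i := by exact_mod_cast h3
  have := mul_le_mul_of_nonneg_left h4 (by have := c.hz; linarith : (0:ℤ) ≤ q)
  linarith

theorem Ctx.one (c : Ctx q H S) {N : Finset V} (u : V) (hN : N.card ≤ 1) (hT : T ⊆ S) (hTn : T.card < S.card) :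
    Col q (H ⊔ star u N) T := by
  refine c.addS 1 u hN hT hTn fun X hX h => ?_
  have := c.S2 X (hX.trans hT) h (lt_of_le_of_lt (card_le_card hX) hTn)
  push_cast; linarith

theorem Ctx.dia (c : Ctx q H S) (hT : T ⊆ S) (hc : T.card = q + 1)
    (h : ∀ x ∈ T, ∀ y ∈ T, x ≠ y → H.Adj x y ∨ (x = u ∧ y = v) ∨ (x = v ∧ y = u)) : False := by
  have := c.one (N := {v}) u (by simp) hT (by have := c.big; omega)
  refine Clq.ncol (S := T) (H := H ⊔ star u {v}) ?_ (by omega) this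
  intro x hx y hy hxy
  rcases h x hx y hy hxy with k | k
  · exact Or.inl k
  · right; simp only [star, mem_singleton]; exact ⟨hxy, by tauto⟩

theorem sdr {E : Finset V} {F : V → Finset (Fin q)} {Q : Finset (Fin q)} (hQ : E.card ≤ Q.card) (x : V → ℕ)
    (h1 : ∀ e ∈ E, (F e).card ≤ 1 + x e) (h2 : ∑ e ∈ E, x e + 1 < E.card) (h3 : ∀ c ∈ Q, ∃ e ∈ E, c ∉ F e) :
    ∃ g : V → Fin q, (∀ e ∈ E, g e ∈ Q ∧ g e ∉ F e) ∧ ∀ e ∈ E, ∀ e' ∈ E, g e = g e' → e = e' := by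
  have key : ∀ J ⊆ E, J.card ≤ (J.biUnion fun e => Q \ F e).card := by
    intro J hJ
    by_cases hJE : J = E
    · subst hJE
      refine hQ.trans (card_le_card fun c hc => ?_)
      obtain ⟨e, he, h⟩ := h3 c hc
      exact mem_biUnion.2 ⟨e, he, mem_sdiff.2 ⟨hc, h⟩⟩
    by_contra hcon
    push Not at hcon
    have hlt : J.card < E.card := card_lt_card (hJ.ssubset_of_ne hJE)
    have hpos : 1 ≤ J.card := by omega
    have hx : ∀ e ∈ J, E.card - J.card ≤ x e := by
      intro e he
      have := h1 e (hJ he)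
      have k1 : Q \ (J.biUnion fun e => Q \ F e) ⊆ F e := by grind
      have k2 := card_le_card k1
      have k3 := le_card_sdiff (J.biUnion fun e => Q \ F e) Q
      omega
    have h4 : J.card * (E.card - J.card) ≤ ∑ e ∈ E, x e := by
      calc _ = ∑ e ∈ J, (E.card - J.card) := by simp
        _ ≤ ∑ e ∈ J, x e := sum_le_sum hx
        _ ≤ _ := sum_le_sum_of_subset hJ
    obtain ⟨d, hd⟩ : ∃ d, E.card = J.card + 1 + d := ⟨E.card - J.card - 1, by omega⟩
    obtain ⟨j, hj⟩ : ∃ j, J.card = j + 1 := ⟨J.card - 1, by omega⟩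
    rw [hd, hj] at h4 h2
    have : j + 1 + 1 + d - (j + 1) = d + 1 := by omega
    rw [this] at h4
    nlinarith
  obtain ⟨g, hg1, hg2⟩ := (Finset.all_card_le_biUnion_card_iff_exists_injective
    (fun e : {e // e ∈ E} => Q \ F e.1)).1 (by
      intro s
      have := key (s.map (Function.Embedding.subtype _)) (by
        intro e he; simp at he; exact he.1)
      rw [card_map] at this
      refine this.trans (le_of_eq (congrArg card ?_))
      ext c; simp)
  by_cases hne : E.Nonempty
  · obtain ⟨e0, he0⟩ := hne
    refine ⟨fun e => if h : e ∈ E then g ⟨e, h⟩ else g ⟨e0, he0⟩, fun e he => ?_, fun e he e' he' h => ?_⟩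
    · grind
    · grind
  · rw [not_nonempty_iff_eq_empty] at hne
    subst hne; simp at h2

theorem ext_inj {f g : V → Fin q} (hf : Ok H (S \ T) f) (hg : ∀ e ∈ T, ∀ e' ∈ T, g e = g e' → e = e')
    (h : ∀ e ∈ T, ∀ u ∈ nb H (S \ T) e, f u ≠ g e) : Col q H S := by
  refine ⟨fun x => if x ∈ T then g x else f x, fun x hx y hy hxy => ?_⟩
  by_cases xT : x ∈ T <;> by_cases yT : y ∈ T <;> simp only [xT, yT, if_true, if_false]
  · exact fun e => hxy.ne (hg x xT y yT e)
  · grind [mem_nb, nb_sub, Clq, Ok]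
  · exact h y yT x (mem_nb.2 ⟨mem_sdiff.2 ⟨hx, xT⟩, hxy.symm⟩)
  · grind [mem_nb, nb_sub, Clq, Ok]

theorem nb_split (H : SimpleGraph V) (hT : T ⊆ S) (v : V) :
    (nb H S v).card = (nb H (S \ T) v).card + (nb H T v).card := by
  rw [← card_union_of_disjoint]
  · congr 1; ext u; simp only [mem_union, mem_nb, mem_sdiff]
    constructor
    · grind
    · grind
  · rw [Finset.disjoint_left]; intro u h1 h2
    rw [mem_nb, mem_sdiff] at h1; rw [mem_nb] at h2
    exact h1.1.2 h2.1

theorem nb_out (h : Clq H T) (hT : T ⊆ S) (hv : v ∈ T) :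
    (nb H S v).card = (nb H (S \ T) v).card + (T.card - 1) := by
  rw [nb_split H hT, h.nb hv, card_erase_of_mem hv]

theorem Ctx.dia2 (c : Ctx q H S) (hT : T ⊆ S) (hcl : Clq H T) (hc : T.card = q) {f : V} (hf : f ∈ S) (hfT : f ∉ T)
    (hA : A ⊆ T) (hAc : q ≤ A.card + 1) (h : ∀ e ∈ A, H.Adj f e) : False := by
  obtain ⟨v, hv⟩ : ∃ v, ∀ e ∈ T, e ∉ A → e = v := by
    have : (T \ A).card ≤ 1 := by rw [card_sdiff_of_subset hA]; omega
    rcases (T \ A).eq_empty_or_nonempty with k | ⟨v, hv⟩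
    · exact ⟨f, fun e he he' => by have : e ∈ T \ A := mem_sdiff.2 ⟨he, he'⟩
                                   rw [k] at this; simp at this⟩
    · exact ⟨v, fun e he he' => card_le_one.1 this _ (mem_sdiff.2 ⟨he, he'⟩) _ hv⟩
  refine c.dia (T := insert f T) (u := f) (v := v) (insert_subset hf hT) (by rw [card_insert_of_notMem hfT, hc]) ?_
  intro x hx y hy hxy
  rw [mem_insert] at hx hy
  rcases hx with rfl | hx <;> rcases hy with rfl | hy
  · exact absurd rfl hxy
  · grind
  · by_cases k : x ∈ A
    · exact Or.inl (h x k).symm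
    · grind
  · exact Or.inl (hcl x hx y hy hxy)

theorem Ctx.AE (c : Ctx q H S) (hT : T ⊆ S) (hcl : Clq H T) (hc : T.card = q) (ha : a ∈ T) (hb : b ∈ T)
    (da : (nb H S a).card = q) (db : (nb H S b).card = q) (hu : u ∈ S) (huT : u ∉ T) (hau : H.Adj a u) :
    H.Adj b u := by
  by_contra hbu
  have hab : a ≠ b := by rintro rfl; exact hbu hau
  have hq := c.hq
  have ea := nb_out hcl hT ha
  have eb := nb_out hcl hT hb
  obtain ⟨u', hu'⟩ := card_eq_one.1 (by omega : (nb H (S \ T) a).card = 1)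
  obtain ⟨w, hw⟩ := card_eq_one.1 (by omega : (nb H (S \ T) b).card = 1)
  have : u ∈ nb H (S \ T) a := mem_nb.2 ⟨mem_sdiff.2 ⟨hu, huT⟩, hau⟩
  rw [hu', mem_singleton] at this
  subst this
  have hwm : w ∈ nb H (S \ T) b := by rw [hw]; simp
  rw [mem_nb, mem_sdiff] at hwm
  have huw : u ≠ w := by grind
  have hlt : (S \ {a, b}).card < S.card := card_lt_card ⟨sdiff_subset, fun h => by
    have := h (hT ha); simp at this⟩
  obtain ⟨f, hf⟩ := c.one (N := {w}) u (by simp) (T := S \ {a, b}) sdiff_subset hlt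
  have abT : ({a, b} : Finset V) ⊆ T := by grind
  have uab : u ∈ S \ {a, b} := by grind
  have wab : w ∈ S \ {a, b} := by grind
  have fuw : f u ≠ f w := hf u uab w wab (Or.inr (by simp [star, huw]))
  obtain ⟨g, hg1, hg2⟩ := sdr (E := {a, b}) (F := fun e => if e = a then {f u} else {f w})
    (Q := univ \ (T \ {a, b}).image f) (by
      have h1 := le_card_sdiff ((T \ {a, b}).image f) univ
      have h2 : ((T \ {a, b}).image f).card ≤ (T \ {a, b}).card := card_image_le
      rw [card_sdiff_of_subset abT] at h2
      rw [card_pair hab] at *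
      simp at h1 ⊢; omega) (fun _ => 0) (by
      intro e _; split_ifs <;> simp) (by simp [card_pair hab]) (by
      intro d _
      by_cases k : d = f u
      · grind
      · exact ⟨a, by simp, by simp [k]⟩)
  refine c.cr.nc (ext_inj (hf.mono subset_rfl fun _ _ _ _ k => Or.inl k) hg2 ?_)
  intro e he z hz e1
  have hge := hg1 e he
  rw [mem_nb] at hz
  by_cases zT : z ∈ T
  · grind
  · have hz2 : z ∈ nb H (S \ T) e := mem_nb.2 ⟨mem_sdiff.2 ⟨(mem_sdiff.1 hz.1).1, zT⟩, hz.2⟩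
    rw [mem_insert, mem_singleton] at he
    rcases he with rfl | rfl
    · grind
    · grind

theorem Ctx.AEd (c : Ctx q H S) (hT : T ⊆ S) (hcl : Clq H T) (hc : T.card = q) (hA : A ⊆ T) (hAc : q ≤ A.card + 1)
    (h : ∀ e ∈ A, (nb H S e).card = q) : False := by
  have hq := c.hq
  obtain ⟨a, ha⟩ : A.Nonempty := card_pos.1 (by omega)
  have ea := nb_out hcl hT (hA ha)
  obtain ⟨f, hf⟩ := card_eq_one.1 (by have := h a ha; omega : (nb H (S \ T) a).card = 1)
  have hfm : f ∈ nb H (S \ T) a := by rw [hf]; simp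
  rw [mem_nb, mem_sdiff] at hfm
  exact c.dia2 hT hcl hc hfm.1.1 hfm.1.2 hA hAc fun e he =>
    (c.AE hT hcl hc (hA ha) (hA he) (h a ha) (h e he) hfm.1.1 hfm.1.2 hfm.2).symm

theorem Ctx.EM (c : Ctx q H S) (i : ℕ) (hT : T ⊆ S) (hcl : Clq H T) (hc : T.card = q) (hi : i + 2 ≤ q)
    (hi1 : 1 ≤ i) (hs : ∑ e ∈ T, ((nb H S e).card - q) ≤ i)
    (h : ∀ X ⊆ S \ T, 2 ≤ X.card → (q:ℤ)^2 - q - 2 + 2 * q * i < pot q H X) : False := by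
  have hq := c.hq
  have out : ∀ e ∈ T, (nb H (S \ T) e).card = 1 + ((nb H S e).card - q) := fun e he => by
    have := nb_out hcl hT he
    have := c.cr.deg (hT he)
    omega
  obtain ⟨e0, he0, hx0⟩ : ∃ e0 ∈ T, (nb H S e0).card - q = 0 := by
    by_contra hcon
    push Not at hcon
    have : ∑ e ∈ T, 1 ≤ ∑ e ∈ T, ((nb H S e).card - q) := sum_le_sum fun e he => by
      have := hcon e he; omega
    simp at this; omega
  obtain ⟨f, hf⟩ := card_eq_one.1 (by have := out e0 he0; omega : (nb H (S \ T) e0).card = 1)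
  have hfm : f ∈ nb H (S \ T) e0 := by rw [hf]; simp
  rw [mem_nb, mem_sdiff] at hfm
  by_cases hex : ∃ e ∈ T, ¬ H.Adj f e ∧ 1 + ((nb H S e).card - q) ≤ i
  · obtain ⟨e, he, hfe, hei⟩ := hex
    have hlt : (S \ T).card < S.card := card_lt_card ⟨sdiff_subset, fun h => by
      have := h (hT he); simp [he] at this⟩
    obtain ⟨φ, hφ⟩ := c.addS i (N := nb H (S \ T) e) f (by rw [out e he]; exact hei) (T := S \ T) sdiff_subset hlt h
    obtain ⟨g, hg1, hg2⟩ := sdr (E := T) (F := fun e => (nb H (S \ T) e).image φ) (Q := univ) (by simp [hc])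
      (fun e => (nb H S e).card - q) (fun e he => by rw [← out e he]; exact card_image_le) (by omega) (by
        intro d _
        by_cases k : d = φ f
        · refine ⟨e, he, fun hd => ?_⟩
          obtain ⟨z, hz, e1⟩ := mem_image.1 hd
          rw [k] at e1
          have hz' := mem_nb.1 hz
          refine hφ f (mem_sdiff.2 hfm.1) z hz'.1 (Or.inr ?_) e1.symm
          have : z ≠ f := by rintro rfl; exact hfe hz'.2.symm
          exact star_adj_f.2 ⟨this, hz⟩
        · refine ⟨e0, he0, fun hd => ?_⟩
          simp only [hf, image_singleton, mem_singleton] at hd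
          exact k hd)
    refine c.cr.nc (ext_inj (hφ.mono subset_rfl fun _ _ _ _ k => Or.inl k) hg2 ?_)
    intro e' he' z hz e1
    exact (hg1 e' he').2 (mem_image.2 ⟨z, hz, e1⟩)
  · push Not at hex
    refine c.dia2 hT hcl hc hfm.1.1 hfm.1.2 (A := T.filter (H.Adj f)) (filter_subset _ _) ?_ (fun e he => (mem_filter.1 he).2)
    by_contra hcon
    have hc2 := card_filter_add_card_filter_not (s := T) (H.Adj f)
    have h2 : 1 < (T.filter fun e => ¬ H.Adj f e).card := by omega
    have h3 : (T.filter fun e => ¬ H.Adj f e).card * i ≤ i := by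
      calc _ = ∑ e ∈ T.filter (fun e => ¬ H.Adj f e), i := by simp
        _ ≤ ∑ e ∈ T.filter (fun e => ¬ H.Adj f e), ((nb H S e).card - q) := sum_le_sum fun e he => by grind
        _ ≤ ∑ e ∈ T, ((nb H S e).card - q) := sum_le_sum_of_subset (filter_subset _ _)
        _ ≤ i := hs
    nlinarith

theorem hlem : ∀ (i : ℕ) (C : Finset (V × V)), 2 * i + 1 ≤ C.card → ∃ J : SimpleGraph V,
    (∀ X, E J X X ≤ 2 * i) ∧ ∀ M : V → Prop, (∀ x y, M x → M y → ¬ J.Adj x y) →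
      i ≤ (C.filter fun c => ¬ M c.2).card ∨ ∃ u, ∀ c ∈ C, M c.2 → c.2 = u := by
  intro i
  induction i with
  | zero =>
    intro C _
    exact ⟨⊥, fun X => by rw [E_zero]; simp; simp, fun M _ => Or.inl (Nat.zero_le _)⟩
  | succ i ih =>
    intro C hC
    obtain ⟨c1, hc1, hmax⟩ := exists_max_image C (fun c => (C.filter fun d => d.2 = c.2).card) (card_pos.1 (by omega))
    by_cases hex : ∃ c2 ∈ C, c2.2 ≠ c1.2
    · obtain ⟨c2, hc2, hne⟩ := hex
      have hne' : c2 ≠ c1 := by grind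
      have h2 : c2 ∈ C.erase c1 := mem_erase.2 ⟨hne', hc2⟩
      set C' := (C.erase c1).erase c2 with hC'
      have cC' : C'.card + 2 = C.card := by grind
      have memC : ∀ c, c ∈ C ↔ c = c1 ∨ c = c2 ∨ c ∈ C' := by grind
      obtain ⟨J, hJ1, hJ2⟩ := ih C' (by omega)
      refine ⟨J ⊔ star c1.2 {c2.2}, fun X => ?_, fun M hM => ?_⟩
      · have h3 := E_sup_le J (star c1.2 {c2.2}) X X
        have h4 := E_star c1.2 {c2.2} X
        have h5 : (({c2.2} ∩ X : Finset V).card : ℤ) ≤ 1 := by grind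
        have := hJ1 X
        push_cast; linarith
      · have hM12 : ¬ (M c1.2 ∧ M c2.2) := fun k => hM _ _ k.1 k.2 (Or.inr (star_adj_f.2 ⟨hne, by simp⟩))
        have sub : C'.filter (fun c => ¬ M c.2) ⊆ C.filter fun c => ¬ M c.2 :=
          filter_subset_filter _ (fun c hc => (memC c).2 (Or.inr (Or.inr hc)))
        have n1 : c1 ∉ C' := by simp [hC']
        have n2 : c2 ∉ C' := by simp [hC']
        have step : (C'.filter (fun c => ¬ M c.2)).card + 1 ≤ (C.filter fun c => ¬ M c.2).card := by
          by_cases k : M c1.2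
          · have k2 : ¬ M c2.2 := fun k2 => hM12 ⟨k, k2⟩
            rw [← card_insert_of_notMem (s := C'.filter (fun c => ¬ M c.2)) (a := c2) (by simp [n2])]
            exact card_le_card (insert_subset (by simp [hc2, k2]) sub)
          · rw [← card_insert_of_notMem (s := C'.filter (fun c => ¬ M c.2)) (a := c1) (by simp [n1])]
            exact card_le_card (insert_subset (by simp [hc1, k]) sub)
        rcases hJ2 M (fun x y hx hy k => hM x y hx hy (Or.inl k)) with k | ⟨u, hu⟩
        · left; omega
        · by_cases hm : i ≤ (C'.filter (fun c => ¬ M c.2)).card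
          · left; omega
          right
          have hsum := card_filter_add_card_filter_not (s := C') (fun c => M c.2)
          have hpos : i + 2 ≤ (C'.filter (fun c => M c.2)).card := by omega
          have hsubu : C'.filter (fun c => M c.2) ⊆ C.filter fun d => d.2 = u := fun c hc => by grind
          have hcu := card_le_card hsubu
          obtain ⟨d, hd⟩ := card_pos.1 (by omega : 0 < (C'.filter (fun c => M c.2)).card)
          have hd2 := mem_filter.1 hd
          have hdu := hu d hd2.1 hd2.2
          have hmx := hmax d ((memC d).2 (Or.inr (Or.inr hd2.1)))
          rw [hdu] at hmx
          have e1 : c1.2 = u := by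
            by_contra hcon
            have : (C.filter fun d => d.2 = c1.2).erase c1 ⊆ C'.filter fun c => ¬ M c.2 := fun c hc => by grind
            have h6 := card_le_card this
            rw [card_erase_of_mem (by simp [hc1])] at h6
            omega
          have hMu : M c1.2 := by grind
          refine ⟨u, fun c hc hMc => ?_⟩
          rcases (memC c).1 hc with rfl | rfl | k
          · exact e1
          · grind
          · exact hu c k hMc
    · push Not at hex
      refine ⟨⊥, fun X => ?_, fun M _ => Or.inr ⟨c1.2, fun c hc _ => hex c hc⟩⟩
      rw [E_zero (by simp)]; positivity

theorem MLr.extra {φ : V → Fin q} (m : MLr q H S R φ X Z J) (hS : R ∪ Z = S) (hT : T ⊆ Z) (hcl : Clq J T) :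
    2 * ∑ e ∈ T, (((nb H S e).card : ℤ) - (nb J (X ∪ Z) e).card) ≤
      (E H Z Z - E J Z Z) + 2 * (E H Z R - E J Z X) := by
  have h0 : ∑ e ∈ T, (((nb H S e).card : ℤ) - (nb J (X ∪ Z) e).card) = (E H T R - E J T X) + (E H T Z - E J T Z) := by
    rw [sum_sub_distrib, ← E_sum, ← E_sum, ← hS, E_ur H m.ZR, E_ur J m.XZ]; ring
  rw [h0]
  have h1 : E H T R - E J T X ≤ E H Z R - E J Z X := by
    rw [E_sum H T, E_sum H Z, E_sum J T, E_sum J Z, ← sum_sub_distrib, ← sum_sub_distrib]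
    refine sum_le_sum_of_subset_of_nonneg hT fun z hz _ => ?_
    have := m.nbz hz
    have : ((nb J X z).card:ℤ) ≤ (nb H R z).card := by exact_mod_cast (by omega)
    linarith
  have e1 : T ∪ (Z \ T) = Z := by simpa using hT
  have d1 : Disjoint T (Z \ T) := disjoint_sdiff
  have mn : ∀ A ⊆ Z, ∀ B ⊆ Z, E J A B ≤ E H A B := fun A hA B hB =>
    E_mono subset_rfl subset_rfl fun u hu v hv k => m.zz u (hA hu) v (hB hv) k
  have eT : ∀ K : SimpleGraph V, E K Z Z = E K T T + 2 * E K T (Z \ T) + E K (Z \ T) (Z \ T) := fun K => by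
    conv_lhs => rw [← e1]
    rw [E_ul K d1, E_ur K d1, E_ur K d1, E_sym K (Z \ T) T]; ring
  have eT2 : ∀ K : SimpleGraph V, E K T Z = E K T T + E K T (Z \ T) := fun K => by
    conv_lhs => rw [← e1]
    rw [E_ur K d1]
  have c1 : E H T T = E J T T := by
    have := mn T hT T hT
    have k1 := E_cl H T
    have k2 := hcl.E
    linarith
  have c2 := mn (Z \ T) sdiff_subset (Z \ T) sdiff_subset
  rw [eT, eT, eT2, eT2]
  linarith

def Ty (q : ℕ) (H : SimpleGraph V) (S X : Finset V) : Prop :=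
  Clq H (S \ X) ∧ (S \ X).card + 1 = q ∧ ∀ t ∈ S \ X, (nb H S t).card = q

theorem Ty.out (h : Ty q H S X) (hX : X ⊆ S) {t : V} (ht : t ∈ S \ X) : (nb H X t).card = 2 := by
  have := nb_out h.1 sdiff_subset ht
  rw [h.2.2 t ht, Finset.sdiff_sdiff_eq_self hX] at this
  have := h.2.1
  have := card_pos.2 ⟨t, ht⟩
  omega

theorem Ty.add (h : Ty q H S X) (hX : X ⊆ S) (hT : T ⊆ S \ X) :
    pot q H (X ∪ T) = pot q H X + T.card * ((q:ℤ)^2 - 2 * q - 2 - q * T.card) := by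
  have d : Disjoint X T := disjoint_of_subset_right hT disjoint_sdiff
  rw [pot_union q H d, (h.1.mono hT).pot, E_sym, E_sum]
  have : ∑ v ∈ T, ((nb H X v).card : ℤ) = ∑ v ∈ T, 2 := sum_congr rfl fun t ht => by
    rw [h.out hX (hT ht)]; rfl
  rw [this]; simp; ring

theorem Ty.pot (h : Ty q H S X) (hX : X ⊆ S) : pot q H X = KY.pot q H S + ((q:ℤ)^2 + q - 2) := by
  have := h.add hX subset_rfl
  rw [union_sdiff_of_subset hX] at this
  have h2 : ((S \ X).card : ℤ) = q - 1 := by have := h.2.1; push_cast [← this]; ring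
  rw [h2] at this
  rw [this]; ring

theorem low_small (hq : 3 ≤ q) (h1 : 2 ≤ R.card) (h2 : R.card ≤ q) (hp : pot q H R ≤ 2 * (q:ℤ)^2 - 2 * q) :
    R.card = q ∧ Clq H R := by
  have hz : (3:ℤ) ≤ q := by exact_mod_cast hq
  have k := pot_clq_le q H R
  have e : R.card = q := by
    by_contra hne
    have a1 : (2:ℤ) ≤ R.card := by exact_mod_cast h1
    have a2 : (R.card:ℤ) + 1 ≤ q := by exact_mod_cast (by omega)
    have : (1:ℤ) * 2 ≤ ((q:ℤ) - R.card) * ((q:ℤ) * R.card - 2 * q + 2) :=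
      mul_le_mul (by linarith) (by nlinarith) (by norm_num) (by linarith)
    nlinarith
  refine ⟨e, fun u hu v hv huv => ?_⟩
  by_contra hn
  have := E_lt2 (H := H) (J := ⊤) (A := R) (fun x _ y _ h => h.ne) hu hv huv hn
  have k2 := E_cl (⊤ : SimpleGraph V) R
  unfold pot at hp
  rw [e] at hp k2
  nlinarith [mul_le_mul_of_nonneg_left (this.trans k2) (by linarith : (0:ℤ) ≤ q)]

theorem Ctx.n1 (c : Ctx q H S) (hX : X ⊆ S) (h : X.card + 1 = S.card) :
    pot q H S - ((q:ℤ)^2 + q - 2) + 2 * q * q ≤ pot q H X := by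
  obtain ⟨v, hv⟩ := card_eq_one.1 (by rw [card_sdiff_of_subset hX]; omega : (S \ X).card = 1)
  have hvm : v ∈ S \ X := by rw [hv]; simp
  rw [mem_sdiff] at hvm
  have e : X = S.erase v := by
    refine eq_of_subset_of_card_le (fun z hz => mem_erase.2 ⟨fun e => hvm.2 (e ▸ hz), hX hz⟩) ?_
    rw [card_erase_of_mem hvm.1]; omega
  rw [e, pot_erase q H hvm.1]
  have : (q:ℤ) ≤ (nb H S v).card := by exact_mod_cast c.cr.deg hvm.1
  have := mul_le_mul_of_nonneg_left this (by have := c.hz; linarith : (0:ℤ) ≤ 2 * q)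
  linarith

theorem ls_ar1 {l p q : ℤ} (hq : 3 ≤ q) (h1 : 1 ≤ l) (h2 : l + 3 ≤ q) (p1 : 2 * q - 4 < p)
    (p2 : q^2 - 3*q - 2 < p) : 2 * q^2 - 2 * q < p + (q^2 + q - 2) + l * (q^2 - 2*q - 2 - q * l) := by
  have h4 : 4 ≤ q := by linarith
  rcases eq_or_lt_of_le h4 with k | k
  · grind
  · have k' : 5 ≤ q := k
    rcases eq_or_lt_of_le h1 with rfl | e
    · nlinarith
    · have e' : 2 ≤ l := e
      have h5 : q - 2 ≤ q^2 - 2*q - 2 - q*l := by nlinarith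
      have : 2 * (q - 2) ≤ l * (q^2 - 2*q - 2 - q*l) := mul_le_mul e' h5 (by linarith) (by linarith)
      linarith

theorem ls_ar2 {q : ℕ} {p : ℤ} (hq : 3 ≤ q) (h1 : (q:ℤ)^2 + q - 2 < p) (h2 : p ≤ 2 * (q:ℤ)^2 - 2 * q) :
    ∃ i : ℕ, 1 ≤ i ∧ 2 * i + 1 ≤ q ∧ (q:ℤ)^2 - q - 2 + 2 * q * i < p ∧ p ≤ (q:ℤ)^2 - q - 2 + 2 * q * (i + 1) := by
  have hz : (3:ℤ) ≤ q := by exact_mod_cast hq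
  have hex : ∃ i : ℕ, p ≤ (q:ℤ)^2 - q - 2 + 2 * q * (i + 1) := ⟨q, by nlinarith⟩
  have hs := Nat.find_spec hex
  have hmin := fun m => Nat.find_min hex (m := m)
  set i := Nat.find hex
  have hi1 : 1 ≤ i := by grind
  have hl : (q:ℤ)^2 - q - 2 + 2 * q * i < p := by
    have := hmin (i - 1) (by omega)
    push Not at this
    have e : ((i - 1 : ℕ) : ℤ) = i - 1 := by push_cast [hi1]; ring
    rw [e] at this
    simpa using this
  refine ⟨i, hi1, ?_, hl, hs⟩
  by_contra k
  have : (q:ℤ) ≤ 2 * i := by exact_mod_cast (by omega)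
  nlinarith

theorem ls_ar3 {q j p : ℤ} (h1 : 3 ≤ j) (h2 : j + 1 ≤ q) (p1 : 2 * q - 4 < p) :
    2 * q^2 - 2 * q + (q^2 - q - 2) - j * (q^2 + 2*q - 2 - q*j) < p := by
  have : 0 ≤ (q - j - 1) * (j - 3) := mul_nonneg (by linarith) (by linarith)
  have h3 : q - 3 ≤ (q - j) * (j - 2) := by nlinarith
  have := mul_le_mul_of_nonneg_left h3 (by linarith : 0 ≤ q)
  nlinarith

theorem MLr.single {φ : V → Fin q} (m : MLr q H S R φ {x} Z J) (c : Crit q H S) (hR : R ⊆ S) (h2 : 2 ≤ R.card)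
    (hu : u ∈ R) (h : ∀ z ∈ Z, ∀ r ∈ R, φ r = φ x → H.Adj z r → r = u) : False := by
  obtain ⟨f, hf⟩ := c.sub (T := insert u Z) (insert_subset (hR hu) m.ZS) (by
    intro e
    have : R ⊆ {u} := fun r hr => by
      have k := hR hr
      rw [← e, mem_insert] at k
      rcases k with k | k
      · simp [k]
      · exact absurd k (Finset.disjoint_left.1 m.ZR hr)
    have := card_le_card this
    simp at this; omega)
  have xZ : x ∉ Z := Finset.disjoint_left.1 m.ZR (m.XR (by simp))
  refine m.cr.nc ⟨fun z => if z = x then f u else f z, ?_⟩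
  have key : ∀ z ∈ Z, J.Adj z x → f z ≠ f u := fun z hz k => by
    obtain ⟨r, hr, e, k2⟩ := m.zx z hz x (by simp) k
    have := h z hz r hr e k2
    subst this
    exact hf z (by simp [hz]) r (by simp) k2
  intro y hy z hz k
  rw [mem_union, mem_singleton] at hy hz
  rcases hy with rfl | hy <;> rcases hz with rfl | hz
  · exact absurd rfl k.ne
  · have : z ≠ y := by rintro rfl; exact xZ hz
    simp only [this, if_true, if_false]; exact (key z hz k.symm).symm
  · grind
  · have h1 : y ≠ x := by rintro rfl; exact xZ hy
    have h2 : z ≠ x := by rintro rfl; exact xZ hz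
    simp only [h1, h2, if_false]
    exact hf y (by simp [hy]) z (by simp [hz]) (m.zz y hy z hz k)

set_option maxHeartbeats 1000000 in
theorem Ctx.LS (c : Ctx q H S) : ∀ X ⊆ S, 2 ≤ X.card → X.card + 2 ≤ S.card → pot q H X ≤ 2 * (q:ℤ)^2 - 2 * q →
    (X.card = q ∧ Clq H X) ∨ Ty q H S X := by
  by_contra hcon
  push Not at hcon
  obtain ⟨X0, a1, a2, a3, a4, a5⟩ := hcon
  obtain ⟨R, hR, hmin⟩ := exists_min_image (S.powerset.filter fun R => 2 ≤ R.card ∧ R.card + 2 ≤ S.card ∧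
    pot q H R ≤ 2 * (q:ℤ)^2 - 2 * q ∧ ¬ (R.card = q ∧ Clq H R) ∧ ¬ Ty q H S R)
    (fun R => pot q H R) ⟨X0, by simp only [mem_filter, mem_powerset]; exact ⟨a1, a2, a3, a4, fun k => a5.1 k.1 k.2, a5.2⟩⟩
  simp only [mem_filter, mem_powerset] at hR hmin
  obtain ⟨RS, R2, Rn, pR, nc, nT⟩ := hR
  have hz := c.hz
  have hq := c.hq
  have p1 := c.p1
  have p2 := c.p2
  have cR : q + 1 ≤ R.card := by
    by_contra k
    exact nc (low_small hq R2 (by omega) pR)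
  have clqpot : ∀ Y : Finset V, Y.card = q → Clq H Y → pot q H Y = 2 * (q:ℤ)^2 - 2 * q := fun Y h1 h2 => by
    rw [h2.pot, h1]; ring
  have low : ∀ Y ⊆ S, 2 ≤ Y.card → Y.card + 2 ≤ S.card → pot q H Y < pot q H R → Ty q H S Y := by grind
  have h1 : ∀ Y ⊆ R, 2 ≤ Y.card → pot q H R ≤ pot q H Y := by
    intro Y hY Y2
    by_contra hlt
    push Not at hlt
    have ty := low Y (hY.trans RS) Y2 ((Nat.add_le_add_right (card_le_card hY) 2).trans Rn) hlt
    have ad := ty.add (hY.trans RS) (T := R \ Y) (sdiff_subset_sdiff RS subset_rfl)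
    rw [union_sdiff_of_subset hY, ty.pot (hY.trans RS)] at ad
    have cY : (S \ Y).card + 1 = q := ty.2.1
    rw [card_sdiff_of_subset (hY.trans RS)] at cY
    have cRY : (R \ Y).card = R.card - Y.card := card_sdiff_of_subset hY
    have : Y.card < R.card := card_lt_card (hY.ssubset_of_ne (by rintro rfl; exact lt_irrefl _ hlt))
    have := ls_ar1 (l := (R \ Y).card) hz (by exact_mod_cast (by omega)) (by exact_mod_cast (by omega)) p1 p2
    linarith
  have h2 : ∀ Y ⊆ S, 2 ≤ Y.card → Y.card + 2 ≤ S.card → pot q H R - 3 ≤ pot q H Y := by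
    intro Y hY Y2 Yn
    by_contra hlt
    push Not at hlt
    have := (low Y hY Y2 Yn (by linarith)).pot hY
    linarith
  have h3 : ∀ Y ⊆ S, 2 ≤ Y.card → Y.card + q ≤ S.card → pot q H R ≤ pot q H Y := by
    intro Y hY Y2 Yn
    by_contra hlt
    push Not at hlt
    have := (low Y hY Y2 (by omega) hlt).2.1
    rw [card_sdiff_of_subset hY] at this
    omega
  obtain ⟨i, i1, iq, il, iu⟩ := ls_ar2 hq (c.S2 R RS R2 (by omega)) pR
  have span : ∀ φ : V → Fin q, Ok H R φ → ∀ X Z J, MLr q H S R φ X Z J → R ∪ Z = S := by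
    intro φ hφ X Z J m
    by_contra hne
    have m1 := m.le
    have m2 := pc_le (by omega) m.Xpos m.Xq
    have m3 := c.le m.cr m.lt
    have m4 := E_nn H Z (R.filter fun r => ∀ x ∈ X, φ r ≠ φ x)
    have m5 : (0:ℤ) ≤ 2 * q * E H Z (R.filter fun r => ∀ x ∈ X, φ r ≠ φ x) := by positivity
    have hlt := (eq_or_lt (m.sub RS)).resolve_left hne
    have h2' : 2 ≤ (R ∪ Z).card := R2.trans (card_le_card subset_union_left)
    by_cases k : (R ∪ Z).card + 1 = S.card
    · have := c.n1 (m.sub RS) k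
      linarith
    · have := h2 (R ∪ Z) (m.sub RS) h2' (by omega)
      linarith
  have pSR : pot q H S ≤ pot q H R - 2 * q := by
    obtain ⟨φ, hφ⟩ := c.subcol RS (by omega)
    obtain ⟨X, Z, J, m⟩ := ML c.cr (by omega) RS cR (by omega) hφ
    have m1 := m.le
    have m2 := pc_le (by omega) m.Xpos m.Xq
    have m3 := c.le m.cr m.lt
    have m4 := E_nn H Z (R.filter fun r => ∀ x ∈ X, φ r ≠ φ x)
    have m5 : (0:ℤ) ≤ 2 * q * E H Z (R.filter fun r => ∀ x ∈ X, φ r ≠ φ x) := by positivity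
    rw [span φ hφ X Z J m] at m1
    linarith
  set D := S \ R with hD
  have dRD : Disjoint R D := disjoint_sdiff
  have uRD : R ∪ D = S := union_sdiff_of_subset RS
  have cD : D.card = S.card - R.card := card_sdiff_of_subset RS
  set C := (D ×ˢ R).filter fun p => H.Adj p.1 p.2 with hC
  have cC : ∀ P : V → Prop, ((C.filter fun p => P p.2).card : ℤ) = E H D (R.filter P) := by
    intro P
    have e : C.filter (fun p => P p.2) = (D ×ˢ R.filter P).filter fun p => H.Adj p.1 p.2 := by grind
    rw [e, card_filter, sum_product]; simp [E]
  have cCE : (C.card : ℤ) = E H D R := by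
    have := cC fun _ => True
    simpa using this
  have hCi : 2 * i + 1 ≤ C.card := by
    have k1 := pot_union q H dRD
    rw [uRD, E_sym, ← cCE] at k1
    have k2 := h2 D sdiff_subset (by omega) (by omega)
    by_contra hcon
    have k3 : (C.card:ℤ) ≤ 2 * i := by exact_mod_cast (by omega)
    have k4 := mul_le_mul_of_nonneg_left k3 (by linarith : (0:ℤ) ≤ 2 * q)
    have k5 : 2 * (i:ℤ) + 1 ≤ q := by exact_mod_cast iq
    have k6 := mul_le_mul_of_nonneg_left k5 (by linarith : (0:ℤ) ≤ q)
    linarith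
  obtain ⟨K, hK1, hK2⟩ := hlem i C hCi
  obtain ⟨φ, hφ'⟩ := c.addE i (H ⊔ K) RS (by omega) (fun Y hY => by
    have k1 := E_sup_le H K Y Y
    have k2 := hK1 Y
    unfold KY.pot
    linarith [mul_le_mul_of_nonneg_left (k1.trans (add_le_add_right k2 (E H Y Y))) (by linarith : (0:ℤ) ≤ q)])
    (fun Y hY Y2 => by have := h1 Y hY Y2; linarith)
  have hφ : Ok H R φ := hφ'.mono subset_rfl fun _ _ _ _ k => Or.inl k
  obtain ⟨X, Z, J, m⟩ := ML c.cr (by omega) RS cR (by omega) hφ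
  have hS := span φ hφ X Z J m
  have hZD : Z = D := by
    rw [hD, ← hS, union_sdiff_left, sdiff_eq_self_of_disjoint m.ZR.symm]
  have meq := m.eq
  have mle := m.le
  rw [hS] at meq mle
  have potJ : ∀ Y ⊆ Z, pot q H Y ≤ pot q J Y := fun Y hY =>
    pot_mg q fun u hu v hv k => m.zz u (hY hu) v (hY hv) k
  have noX : ∀ Y ⊆ Z, 2 ≤ Y.card → pot q J Y ≤ (q:ℤ)^2 + q - 2 → False := by
    intro Y hY Y2 k
    have k1 := c.S2 Y (hY.trans m.ZS) Y2 (lt_of_le_of_lt (card_le_card hY) (by rw [hZD]; omega))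
    have := potJ Y hY
    linarith
  by_cases hX1 : X.card = 1
  · obtain ⟨x0, rfl⟩ := card_eq_one.1 hX1
    have hxR : x0 ∈ R := m.XR (by simp)
    have eF : (R.filter fun r => ∀ x ∈ ({x0} : Finset V), φ r ≠ φ x) = R.filter fun r => ¬ φ r = φ x0 := by
      ext; simp
    rw [hX1, pc_one, eF] at mle
    rcases hK2 (fun v => v ∈ R ∧ φ v = φ x0) (fun x y hx hy k =>
        hφ' x hx.1 y hy.1 (Or.inr k) (by rw [hx.2, hy.2])) with k | ⟨u, hu⟩
    · have k1 := (cC (fun v => ¬ (v ∈ R ∧ φ v = φ x0))).trans (congrArg (E H D) (by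
        ext r; simp only [mem_filter]
        exact ⟨fun h => ⟨h.1, fun e => h.2 ⟨h.1, e⟩⟩, fun h => ⟨h.1, fun e => h.2 e.2⟩⟩ :
          _ = R.filter fun r => ¬ φ r = φ x0))
      rw [← hZD] at k1
      have k2 : (i:ℤ) ≤ E H Z (R.filter fun r => ¬ φ r = φ x0) := by grind
      have k3 := mul_le_mul_of_nonneg_left k2 (by linarith : (0:ℤ) ≤ 2 * q)
      rcases c.sm m.cr (Or.inl m.lt) with ⟨hO, pO⟩ | ⟨-, kk⟩
      · have e1 : pot q J {x0} = (q:ℤ)^2 + q - 2 := by simp [pot]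
        rw [e1, pO] at meq
        have ext2 : (E H Z Z - E J Z Z) + 2 * (E H Z R - E J Z {x0}) < 2 * (i + 1) := by
          by_contra hcon
          have := mul_le_mul_of_nonneg_left (not_lt.1 hcon) (by linarith : (0:ℤ) ≤ q)
          linarith
        rcases O1 hq hO x0 (by simp) with ⟨Y, hY, hxY, Y2, pY⟩ | ⟨Y, hY, hxY, Yc, Ycl, Yd⟩
        · grind
        · have hYZ : Y ⊆ Z := fun y hy => by grind
          have hx := m.extra hS hYZ Ycl
          refine c.EM i (hYZ.trans m.ZS) (fun u hu v hv huv => m.zz u (hYZ hu) v (hYZ hv) (Ycl u hu v hv huv)) Yc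
            (by omega) i1 ?_ ?_
          · have e2 : ((∑ e ∈ Y, ((nb H S e).card - q) : ℕ) : ℤ) =
                ∑ e ∈ Y, (((nb H S e).card : ℤ) - (nb J ({x0} ∪ Z) e).card) := by
              rw [Nat.cast_sum]
              refine sum_congr rfl fun e he => ?_
              rw [Yd e he, Nat.cast_sub (c.cr.deg (m.ZS (hYZ he)))]
            have : ((∑ e ∈ Y, ((nb H S e).card - q) : ℕ) : ℤ) < i + 1 := by rw [e2]; linarith
            have h9 : (∑ e ∈ Y, ((nb H S e).card - q)) < i + 1 := by exact_mod_cast this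
            omega
          · intro X' hX' X2
            have := h3 X' (hX'.trans sdiff_subset) X2 (by
              have := card_le_card hX'
              rw [card_sdiff_of_subset (hYZ.trans m.ZS)] at this
              have := card_le_card (hYZ.trans m.ZS)
              omega)
            linarith
      · linarith
    · have hd := m.cr.deg (v := x0) (by simp)
      obtain ⟨z, hz'⟩ := card_pos.1 (by omega : 0 < (nb J ({x0} ∪ Z) x0).card)
      rw [mem_nb, mem_union, mem_singleton] at hz'
      have hzZ : z ∈ Z := hz'.1.resolve_left hz'.2.ne.symm
      obtain ⟨r, hr, e, k2⟩ := m.zx z hzZ x0 (by simp) hz'.2.symm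
      have all : ∀ z ∈ Z, ∀ r ∈ R, φ r = φ x0 → H.Adj z r → r = u := fun z hz r hr e k =>
        hu (z, r) (by simp [hC, ← hZD, hz, hr, k]) ⟨hr, e⟩
      have hur := all z hzZ r hr e k2
      subst hur
      exact m.single c.cr RS R2 hr all
  · have X2 : 2 ≤ X.card := by have := m.Xpos; omega
    have pcX := pc_le2 (by omega) X2 m.Xq
    have pX := pot_clq_le q J X
    have exn : 0 ≤ (E H Z Z - E J Z Z) + 2 * (E H Z R - E J Z X) := by
      have := m.extra hS (T := ∅) (by simp) (by intro u hu; simp at hu)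
      simpa using this
    rcases c.sm m.cr (Or.inl m.lt) with ⟨hO, pO⟩ | ⟨-, kk⟩
    · have pcX' : 2 * (q:ℤ)^2 - 2 * q ≤ pot q J X := pcX.trans pX
      have ext0 : (E H Z Z - E J Z Z) + 2 * (E H Z R - E J Z X) < 2 := by
        by_contra hcon
        have := mul_le_mul_of_nonneg_left (not_lt.1 hcon) (by linarith : (0:ℤ) ≤ q)
        linarith
      have pJX : pot q J X ≤ pot q H R + ((q:ℤ)^2 - q - 2) - pot q H S := by
        have := mul_nonneg (by linarith : (0:ℤ) ≤ q) exn
        linarith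
      have degs : ∀ z ∈ Z, (nb J (X ∪ Z) z).card = q → (nb H S z).card = q := fun z hz k => by
        have h8 := m.extra hS (T := {z}) (by simpa) (by intro u hu v hv h; simp at hu hv; exact absurd (hu.trans hv.symm) h)
        rw [sum_singleton, k] at h8
        have h9 : ((nb H S z).card : ℤ) < q + 1 := by linarith
        have h10 : (nb H S z).card < q + 1 := by exact_mod_cast h9
        have := c.cr.deg (m.ZS hz)
        omega
      have Xcl : Clq J X := by
        intro u hu v hv huv
        by_contra hn
        have h8 := E_lt2 (H := J) (J := ⊤) (A := X) (fun x _ y _ h => h.ne) hu hv huv hn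
        have h9 := E_cl (⊤ : SimpleGraph V) X
        have h10 := mul_le_mul_of_nonneg_left (h8.trans h9) (by linarith : (0:ℤ) ≤ q)
        have h11 : pc q X.card + 2 * q ≤ pot q J X := by
          unfold pot pc; linarith
        linarith
      rcases O2 hq hO X subset_union_left Xcl with k | ⟨Y, hY, hd, Y2, pY⟩ | ⟨Y, hY, hd, Yc, Ycl, T, hT, Tc, Td⟩
      · have hWc := hO.crit.clq k
        have cXZ : (X ∪ Z).card = X.card + Z.card := card_union_of_disjoint m.XZ
        have cZ : Z.card = S.card - R.card := by rw [hZD, cD]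
        have j2 : X.card = 2 := by
          by_contra hne
          have := ls_ar3 (q := q) (j := X.card) (p := pot q H S) (by exact_mod_cast (by omega)) (by exact_mod_cast (by omega)) p1
          linarith
        refine nT ⟨?_, ?_, ?_⟩ <;> rw [← hD, ← hZD]
        · exact fun u hu v hv huv => m.zz u hu v hv (hWc u (by simp [hu]) v (by simp [hv]) huv)
        · omega
        · intro t ht
          refine degs t ht ?_
          rw [hWc.nb (by simp [ht]), card_erase_of_mem (by simp [ht]), k]; rfl
      · exact noX Y (fun y hy => (mem_union.1 (hY hy)).resolve_left (Finset.disjoint_left.1 hd hy)) Y2 pY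
      · have hYZ : Y ⊆ Z := fun y hy => (mem_union.1 (hY hy)).resolve_left (Finset.disjoint_left.1 hd hy)
        exact c.AEd (hYZ.trans m.ZS) (fun u hu v hv huv => m.zz u (hYZ hu) v (hYZ hv) (Ycl u hu v hv huv)) Yc hT Tc
          fun e he => degs e (hYZ (hT he)) (Td e he)
    · have m5 : (0:ℤ) ≤ 2 * q * E H Z (R.filter fun r => ∀ x ∈ X, φ r ≠ φ x) := by
        have := E_nn H Z (R.filter fun r => ∀ x ∈ X, φ r ≠ φ x)
        positivity
      linarith

theorem Ctx.LSa (c : Ctx q H S) (hX : X ⊆ S) (h2 : 2 ≤ X.card) (hn : X.card + 2 ≤ S.card) :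
    2 * (q:ℤ)^2 - 2 * q - 4 < pot q H X := by
  by_contra hcon
  rcases c.LS X hX h2 hn (by linarith) with k | k
  · have := k.2.pot q
    rw [k.1] at this; nlinarith
  · have := k.pot hX
    have := c.p2; linarith

noncomputable def cl (H : SimpleGraph V) (S : Finset V) (x : V) : Finset V :=
  S.filter fun y => insert y (nb H S y) = insert x (nb H S x)

theorem cl_sub : cl H S x ⊆ S := filter_subset _ _
theorem cl_eq (h : y ∈ cl H S x) : insert y (nb H S y) = insert x (nb H S x) := (mem_filter.1 h).2
theorem cl_self (h : x ∈ S) : x ∈ cl H S x := mem_filter.2 ⟨h, rfl⟩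
theorem notMem_nb : x ∉ nb H S x := fun h => (mem_nb.1 h).2.ne rfl
theorem cl_deg (h : y ∈ cl H S x) : (nb H S y).card = (nb H S x).card := by
  have := congrArg card (cl_eq h)
  rw [card_insert_of_notMem notMem_nb, card_insert_of_notMem notMem_nb] at this
  omega
theorem cl_adj (h : y ∈ cl H S x) (hz : z ∈ S) (h1 : z ≠ y) (h2 : z ≠ x) : H.Adj y z ↔ H.Adj x z := by
  have := congrArg (z ∈ ·) (cl_eq h)
  simpa [mem_insert, mem_nb, hz, h1, h2] using this
theorem cl_adjx (h : y ∈ cl H S x) (hne : y ≠ x) : H.Adj x y := by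
  have : y ∈ insert x (nb H S x) := by rw [← cl_eq h]; simp
  rw [mem_insert, mem_nb] at this
  exact (this.resolve_left hne).2
theorem cl_nb (h : y ∈ cl H S x) (hv : v ∈ S) (hxv : H.Adj x v) (hn : v ∉ cl H S x) : H.Adj y v := by
  have h1 : v ≠ y := by rintro rfl; exact hn h
  exact (cl_adj h hv h1 hxv.ne.symm).2 hxv

theorem nb_rwr (hN : N ⊆ S) (hv : v ∉ N) : nb (rwr H v N) S v = N := by
  ext z; rw [mem_nb, rwr_adj_v]
  exact ⟨fun h => h.2.2, fun h => ⟨hN h, fun e => hv (e ▸ h), h⟩⟩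

theorem pot_rwr (q : ℕ) (hN : N ⊆ S) (hv : v ∉ N) (hvS : v ∈ S) :
    pot q (rwr H v N) S = pot q H S + 2 * q * ((nb H S v).card - N.card) := by
  have h1 := pot_erase q (rwr H v N) hvS
  have h2 := pot_erase q H hvS
  have h3 : pot q (rwr H v N) (S.erase v) = pot q H (S.erase v) :=
    pot_congr q fun x hx y hy => rwr_adj (mem_erase.1 hx).1 (mem_erase.1 hy).1
  rw [nb_rwr hN hv] at h1
  linarith

theorem E_pot (h : pot q H S = pot q J S) (hq : 0 < q) : E H S S = E J S S := by
  unfold pot at h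
  have : (q:ℤ) ≠ 0 := by exact_mod_cast hq.ne'
  have h2 : (q:ℤ) * E H S S = q * E J S S := by linarith
  exact mul_left_cancel₀ this h2

theorem E_pot_lt (h : pot q H S < pot q J S) : E J S S < E H S S := by
  by_contra k
  have hq : (0:ℤ) ≤ q := by positivity
  have := mul_le_mul_of_nonneg_left (not_lt.1 k) hq
  unfold pot at h; linarith

theorem Crit.ntw (c : Crit q H S) (hx : x ∈ S) (hv : v ∈ S) (hxv : H.Adj x v) (hn : v ∉ cl H S x)
    (hd : (nb H S v \ cl H S x).card < q) : ¬ Col q (rwr H v ((insert x (nb H S x)).erase v)) S := by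
  rintro ⟨ψ, hψ⟩
  obtain ⟨d, hd⟩ := exists_col _ ψ hd
  set G' := rwr H v ((insert x (nb H S x)).erase v) with hG
  have av : ∀ y ∈ cl H S x, ∀ z ∈ S, z ≠ v → (z = y ∨ H.Adj y z) → ψ z ≠ ψ v := by
    intro y hy z hz hzv h
    refine (hψ v hv z hz ?_).symm
    rw [hG, rwr_adj_v]
    refine ⟨hzv, mem_erase.2 ⟨hzv, ?_⟩⟩
    rw [← cl_eq hy, mem_insert, mem_nb]
    exact h.imp id fun k => ⟨hz, k⟩
  have uniq : ∀ y ∈ cl H S x, ∀ z ∈ cl H S x, ψ y = ψ z → y = z := by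
    intro y hy z hz e
    by_contra hne
    have hadj : H.Adj y z := by
      have : z ∈ insert y (nb H S y) := by rw [cl_eq hy, ← cl_eq hz]; simp
      rw [mem_insert, mem_nb] at this
      exact (this.resolve_left (Ne.symm hne)).2
    refine hψ y (cl_sub hy) z (cl_sub hz) ?_ e
    exact (rwr_adj (by rintro rfl; exact hn hy) (by rintro rfl; exact hn hz)).2 hadj
  refine c.nc ⟨fun z => if z = v then d else if z ∈ cl H S x ∧ ψ z = d then ψ v else ψ z, ?_⟩
  have key : ∀ y ∈ S, ∀ z ∈ S, y ≠ v → z ≠ v → H.Adj y z → y ∈ cl H S x → ψ y = d →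
      ¬ (z ∈ cl H S x ∧ ψ z = d) ∧ ψ v ≠ ψ z := by
    intro y hy z hz h1 h2 h3 h4 h5
    exact ⟨fun k => h3.ne (uniq y h4 z k.1 (by rw [h5, k.2])), (av y h4 z hz h2 (Or.inr h3)).symm⟩
  have keyv : ∀ z ∈ S, z ≠ v → H.Adj v z → d ≠ (if z ∈ cl H S x ∧ ψ z = d then ψ v else ψ z) := by grind [mem_nb, nb_sub, Clq, Ok]
  intro y hy z hz hyz
  by_cases e1 : y = v
  · subst e1
    have e2 : z ≠ y := hyz.ne.symm
    simp only [e2, if_true, if_false]; exact keyv z hz e2 hyz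
  · by_cases e2 : z = v
    · subst e2
      simp only [e1, if_true, if_false]; exact (keyv y hy e1 hyz.symm).symm
    · simp only [e1, e2, if_false]
      have base : ψ y ≠ ψ z := hψ y hy z hz ((rwr_adj e1 e2).2 hyz)
      by_cases k1 : y ∈ cl H S x ∧ ψ y = d
      · grind
      · by_cases k2 : z ∈ cl H S x ∧ ψ z = d
        · have := key z hz y hy e2 e1 hyz.symm k2.1 k2.2
          rw [if_neg k1, if_pos k2]; exact this.2.symm
        · grind

theorem Ctx.twn (c : Ctx q H S) (hx : x ∈ S) (dx : (nb H S x).card = q) (hv : v ∈ S) (hxv : H.Adj x v)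
    (hG : ¬ Col q (rwr H v ((insert x (nb H S x)).erase v)) S) :
    Clq H ((insert x (nb H S x)).erase v) ∨
    (∃ Y ⊆ S, v ∉ Y ∧ (insert x (nb H S x)).erase v ⊆ Y ∧ Ty q H S Y ∧ pot q H Y = 2 * (q:ℤ)^2 - 2 * q) ∨
    ∃ F ≤ rwr H v ((insert x (nb H S x)).erase v), Crit q F S := by
  set N := (insert x (nb H S x)).erase v with hN
  have hvN : v ∉ N := by simp [hN]
  have cN : N.card = q := by
    rw [hN, card_erase_of_mem (by simp [mem_nb, hv, hxv]), card_insert_of_notMem notMem_nb]; omega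
  obtain ⟨W, hW, F, hF, hcr⟩ := extract hG
  rcases eq_or_lt hW with rfl | hlt
  · grind
  have hz := c.hz
  have hq := c.hq
  have FH : ∀ y ∈ W.erase v, ∀ z ∈ W.erase v, F.Adj y z → H.Adj y z := fun y hy z hz k =>
    (rwr_adj (mem_erase.1 hy).1 (mem_erase.1 hz).1).1 (hF k)
  have vW : v ∈ W := by
    by_contra hvW
    rw [erase_eq_of_notMem hvW] at FH
    exact hcr.nc ((c.subcol hW hlt).mono subset_rfl FH)
  have nF : nb F W v = N := by
    have h1 : nb F W v ⊆ N := fun z hz => by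
      rw [mem_nb] at hz
      exact (rwr_adj_v.1 (hF hz.2)).2
    exact eq_of_subset_of_card_le h1 (by rw [cN]; exact hcr.deg vW)
  have NW : N ⊆ W.erase v := by rw [← nF]; exact nb_erase _ _ _
  have p1 := pot_erase q F vW
  rw [nF, cN] at p1
  have cW : (W.erase v).card + 1 = W.card := card_erase_add_one vW
  have W2 : 2 ≤ (W.erase v).card := by have := card_le_card NW; omega
  have WS : W.erase v ⊆ S := (erase_subset _ _).trans hW
  have l1 := c.LSa WS W2 (by omega)
  have l2 := c.S2 _ WS W2 (by omega)
  have p2 := pot_mg (S := W.erase v) q (H := F) (J := H) FH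
  have hO : pot q F W = (q:ℤ)^2 - q - 2 := by
    rcases c.sm hcr (Or.inl hlt) with k | ⟨k | k, -⟩
    · exact k.2
    · nlinarith
    · nlinarith
  rw [hO] at p1
  have ex : pot q H (W.erase v) = 2 * (q:ℤ)^2 - 2 * q := by
    by_cases k : ∀ y ∈ W.erase v, ∀ z ∈ W.erase v, H.Adj y z → F.Adj y z
    · have := pot_mg (S := W.erase v) q (H := H) (J := F) k
      linarith
    · push Not at k
      obtain ⟨y, hy, z, hz, k1, k2⟩ := k
      have := E_lt2 (H := F) (J := H) FH hy hz k1 k2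
      have := mul_le_mul_of_nonneg_left this (by linarith : (0:ℤ) ≤ q)
      unfold pot at p1 l1
      linarith
  rcases c.LS _ WS W2 (by omega) ex.le with k | k
  · grind [mem_nb, nb_sub, Clq, Ok]
  · grind

theorem Ctx.M (c : Ctx q H S) (hx : x ∈ S) (dx : (nb H S x).card = q) (hv : v ∈ S) (hxv : H.Adj x v)
    (d1 : q < (nb H S v).card) (d2 : (nb H S v).card < q + (cl H S x).card) :
    Clq H ((insert x (nb H S x)).erase v) := by
  have hn : v ∉ cl H S x := fun h => by rw [cl_deg h, dx] at d1; exact lt_irrefl _ d1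
  have hcl : cl H S x ⊆ nb H S v := fun y hy => mem_nb.2 ⟨cl_sub hy, (cl_nb hy hv hxv hn).symm⟩
  have hG := c.cr.ntw hx hv hxv hn (by rw [card_sdiff_of_subset hcl]; have := c.hq; omega)
  rcases c.twn hx dx hv hxv hG with k | ⟨Y, hY, hvY, -, ty, -⟩ | ⟨F, hF, hcr⟩
  · exact k
  · have := ty.2.2 v (mem_sdiff.2 ⟨hv, hvY⟩); omega
  · exfalso
    have hz := c.hz
    have hp := pot_rwr (H := H) q (S := S) (N := (insert x (nb H S x)).erase v) (v := v)
      ((erase_subset _ _).trans (insert_subset hx nb_sub)) (by simp) hv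
    have cN : ((insert x (nb H S x)).erase v).card = q := by
      rw [card_erase_of_mem (by simp [mem_nb, hv, hxv]), card_insert_of_notMem notMem_nb]; omega
    rw [cN] at hp
    have hp2 := pot_mg (S := S) q (H := F) (J := rwr H v ((insert x (nb H S x)).erase v)) fun _ _ _ _ h => hF h
    have d1' : (1:ℤ) ≤ (nb H S v).card - q := by grind
    have := mul_le_mul_of_nonneg_left d1' (by linarith : (0:ℤ) ≤ 2 * q)
    have hlt : pot q H S + 2 * q ≤ pot q F S := by linarith
    rcases c.sm hcr (Or.inr ⟨rfl, Or.inl (E_pot_lt (q := q) (by linarith))⟩) with k | ⟨-, k⟩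
    · have := c.p2; linarith [k.2]
    · linarith

theorem Ctx.AE2 (c : Ctx q H S) (hT : T ⊆ S) (hcl : Clq H T) (hc : T.card = q) (hA : A ⊆ T) (hAc : q ≤ A.card + 1)
    (h : ∀ e ∈ A, (nb H S e).card ≤ q + 1) (ha : a ∈ A) (hb : b ∈ A) (hab : a ≠ b)
    (da : (nb H S a).card = q) (db : (nb H S b).card = q) : False := by
  by_cases hall : ∀ e ∈ A, (nb H S e).card = q
  · exact c.AEd hT hcl hc hA hAc hall
  push Not at hall
  obtain ⟨v, hv, dv⟩ := hall
  have dv' : (nb H S v).card = q + 1 := by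
    have := h v hv; have := c.cr.deg (hT (hA hv)); omega
  have aT := hA ha
  have bT := hA hb
  have vT := hA hv
  have hq := c.hq
  have ea := nb_out hcl hT aT
  obtain ⟨f, hf⟩ := card_eq_one.1 (by omega : (nb H (S \ T) a).card = 1)
  have hfm : f ∈ nb H (S \ T) a := by rw [hf]; simp
  rw [mem_nb, mem_sdiff] at hfm
  have bf := c.AE hT hcl hc aT bT da db hfm.1.1 hfm.1.2 hfm.2
  have clos : ∀ e ∈ T, (nb H S e).card = q → H.Adj e f → insert e (nb H S e) = insert f T := by
    intro e he de hef
    symm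
    refine eq_of_subset_of_card_le ?_ ?_
    · grind [mem_nb, nb_sub, Clq, Ok]
    · rw [card_insert_of_notMem notMem_nb, card_insert_of_notMem hfm.1.2]; omega
  have ca := clos a aT da hfm.2
  have cb := clos b bT db bf
  have hva : v ≠ a := by rintro rfl; omega
  have hav := hcl a aT v vT hva.symm
  have c2 : 2 ≤ (cl H S a).card := by
    rw [← card_pair hab]
    refine card_le_card fun z hz => ?_
    rw [mem_insert, mem_singleton] at hz
    rcases hz with rfl | rfl
    · exact cl_self (hT aT)
    · exact mem_filter.2 ⟨hT bT, by rw [ca, cb]⟩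
  have hM := c.M (hT aT) da (hT vT) hav (by omega) (by omega)
  rw [ca] at hM
  have hvf : v ≠ f := by grind
  refine c.dia2 hT hcl hc hfm.1.1 hfm.1.2 (A := T.erase v) (erase_subset _ _)
    (by rw [card_erase_of_mem vT]; omega) fun e he => ?_
  rw [mem_erase] at he
  exact hM f (by simp [hvf.symm]) e (by simp [he]) (by rintro rfl; exact hfm.1.2 he.2)

theorem pot_submod1 (q : ℕ) (ha : a ∈ A) (ha' : a ∉ B) (hb : b ∈ B) (hb' : b ∉ A) (hab : H.Adj a b) :
    pot q H (A ∪ B) + pot q H (A ∩ B) + 2 * q ≤ pot q H A + pot q H B := by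
  have h1 : A ∪ B = A ∪ (B \ A) := by simp
  have h2 : B = (A ∩ B) ∪ (B \ A) := by ext; simp; tauto
  have d2 : Disjoint (A ∩ B) (B \ A) :=
    disjoint_of_subset_left inter_subset_left disjoint_sdiff
  have e2 := pot_union q H d2
  rw [← h2] at e2
  rw [h1, pot_union q H disjoint_sdiff, e2]
  have h3 : A = (A ∩ B) ∪ (A \ B) := by ext; simp; tauto
  have d3 : Disjoint (A ∩ B) (A \ B) :=
    disjoint_of_subset_left inter_subset_right disjoint_sdiff
  have e3 := E_ul H d3 (B \ A)
  rw [← h3] at e3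
  have e4 : E H {a} {b} ≤ E H (A \ B) (B \ A) := E_ms H (by simp [ha, ha']) (by simp [hb, hb'])
  have e5 : E H {a} {b} = 1 := by simp [E, hab, filter_singleton]
  have hq : (0:ℤ) ≤ q := by positivity
  have := mul_le_mul_of_nonneg_left (by linarith : E H (A ∩ B) (B \ A) + 1 ≤ E H A (B \ A)) hq
  linarith

theorem oe_col {T P : Finset V} (hTS : T ⊆ S) (hy : y ∈ S) (hyT : y ∉ T) (hP : P ⊆ (S \ T).erase y)
    (hPc : Clq H P) (hc : P.card + T.card = q) (hN : (nb H S y \ T).card ≤ P.card)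
    (ht : ∀ e ∈ T, ∀ z ∈ S, H.Adj e z → z ∈ T ∨ z ∈ P ∨ z = y)
    (hu : u ∈ nb H S y \ T) {ψ : V → Fin q} (hψ : Ok H ((S \ T).erase y) ψ) (h : ∀ p ∈ P, ψ u ≠ ψ p) : Col q H S := by
  have iP : (P.image ψ).card = P.card := card_image_of_injOn fun p hp p' hp' e =>
    hPc.inj (hψ.mono hP fun _ _ _ _ k => k) hp hp' e
  obtain ⟨d, hd1, hd2⟩ : ∃ d ∈ P.image ψ, d ∉ (nb H S y \ T).image ψ := by
    by_contra hcon
    push Not at hcon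
    have h1 : P.image ψ ⊆ ((nb H S y \ T).image ψ).erase (ψ u) := fun d hd => by grind
    have h2 := card_le_card h1
    rw [card_erase_of_mem (mem_image_of_mem _ hu), iP] at h2
    have h3 : ((nb H S y \ T).image ψ).card ≤ _ := card_image_le
    have h4 : 0 < (nb H S y \ T).card := card_pos.2 ⟨u, hu⟩
    have h5 : 0 < ((nb H S y \ T).image ψ).card := by grind
    omega
  have hu1 : Ok H (S \ T) (Function.update ψ y d) := hψ.upd fun z hz e => hd2 (by
    rw [← e]; refine mem_image_of_mem _ ?_
    rw [mem_nb, mem_sdiff] at hz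
    exact mem_sdiff.2 ⟨mem_nb.2 ⟨hz.1.1, hz.2⟩, hz.1.2⟩)
  have hcc : T.card ≤ ((univ : Finset (Fin q)) \ P.image ψ).card := by
    rw [card_sdiff_of_subset (subset_univ _), iP, card_univ, Fintype.card_fin]; omega
  obtain ⟨Q, hQ, hQc⟩ := exists_subset_card_eq hcc
  obtain ⟨g⟩ : Nonempty (T ≃ Q) := ⟨(Finset.equivOfCardEq hQc.symm)⟩
  refine ext_inj (T := T) (g := fun e => if k : e ∈ T then (g ⟨e, k⟩ : Fin q) else d) hu1 ?_ ?_
  · intro e he e' he' k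
    simp only [he, he', dif_pos] at k
    have := g.injective (Subtype.ext k)
    simpa using this
  · grind [mem_nb, nb_sub, Clq, Ok]

theorem oe_ar {q c : ℤ} (h1 : 2 ≤ c) (h2 : c + 2 ≤ q) : c * (q * c - q^2 + 2) ≤ -2*q^2 + 6*q - 4 := by
  have h : 0 ≤ q * ((c - 2) * (q - 2 - c)) := mul_nonneg (by linarith) (mul_nonneg (by linarith) (by linarith))
  nlinarith

set_option maxHeartbeats 2000000 in
theorem Ctx.OE (c : Ctx q H S) (hx : x ∈ S) (dx : (nb H S x).card = q) (hy : y ∈ S) (dy : (nb H S y).card = q)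
    (hxy : H.Adj x y) (hyT : y ∉ cl H S x) (ht2 : 2 ≤ (cl H S x).card)
    (hcl : Clq H ((insert x (nb H S x)).erase y)) : False := by
  set T := cl H S x with hT
  set X := (insert x (nb H S x)).erase y with hX
  have hq := c.hq
  have hz := c.hz
  have cX : X.card = q := by
    rw [hX, card_erase_of_mem (by simp [mem_nb, hy, hxy]), card_insert_of_notMem notMem_nb]; omega
  have XS : X ⊆ S := (erase_subset _ _).trans (insert_subset hx nb_sub)
  have TS : T ⊆ S := cl_sub
  have yX : y ∉ X := notMem_erase _ _
  have TX : T ⊆ X := fun e he => mem_erase.2 ⟨fun k => hyT (k ▸ he), by rw [← cl_eq he]; simp⟩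
  have Ty' : ∀ e ∈ T, H.Adj y e := fun e he => (cl_nb he hy hxy hyT).symm
  have Tn : ∀ e ∈ T, ∀ z ∈ S, H.Adj e z → z ∈ X ∨ z = y := fun e he z hz k => by
    by_cases l : z = y
    · exact Or.inr l
    · exact Or.inl (mem_erase.2 ⟨l, by rw [← cl_eq he]; simp [mem_nb, hz, k]⟩)
  have Tny : T ⊆ nb H S y := fun e he => mem_nb.2 ⟨TS he, Ty' e he⟩
  set P := X \ T with hP
  have cP : P.card + T.card = q := by rw [hP, card_sdiff_of_subset TX]; have := card_le_card TX; omega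
  have PX : P ⊆ X := sdiff_subset
  have PS : P ⊆ S := PX.trans XS
  have cN : (nb H S y \ T).card = P.card := by grind
  have miss : ∀ p ∈ X, (∀ e ∈ X, e ≠ p → H.Adj y e) → False := fun p hp k =>
    c.dia2 XS hcl cX hy yX (A := X.erase p) (erase_subset _ _) (by rw [card_erase_of_mem hp]; omega)
      fun e he => k e (mem_of_mem_erase he) (ne_of_mem_erase he)
  obtain ⟨u, hu, huP⟩ : ∃ u ∈ nb H S y \ T, u ∉ P := by
    by_contra k
    push Not at k
    have e : nb H S y \ T = P := eq_of_subset_of_card_le k cN.ge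
    refine miss x (TX (cl_self hx)) fun e' he' _ => ?_
    by_cases l : e' ∈ T
    · exact Ty' e' l
    · grind [mem_nb, nb_sub, Clq, Ok]
  have huS : u ∈ S := nb_sub (mem_sdiff.1 hu).1
  have huT : u ∉ T := (mem_sdiff.1 hu).2
  have hyu : H.Adj y u := (mem_nb.1 (mem_sdiff.1 hu).1).2
  have uX : u ∉ X := by grind
  set N0 := P.filter (fun p => ¬ H.Adj u p) with hN0
  set V1 := (S \ T).erase y with hV1
  have PV : P ⊆ V1 := by grind
  have uV : u ∈ V1 := mem_erase.2 ⟨hyu.ne.symm, mem_sdiff.2 ⟨huS, huT⟩⟩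
  have KuP : ∀ p ∈ P, (H ⊔ star u N0).Adj u p := fun p hp => by
    by_cases k : H.Adj u p
    · exact Or.inl k
    · exact Or.inr (star_adj_f.2 ⟨fun e => huP (e ▸ hp), mem_filter.2 ⟨hp, k⟩⟩)
  have nc : ¬ Col q (H ⊔ star u N0) V1 := by
    rintro ⟨ψ, hψ⟩
    refine c.cr.nc (oe_col TS hy hyT PV (hcl.mono PX) cP cN.le ?_ hu
      (hψ.mono subset_rfl fun _ _ _ _ k => Or.inl k) fun p hp => hψ u uV p (PV hp) (KuP p hp))
    intro e he z hz k
    rcases Tn e he z hz k with l | l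
    · grind
    · grind
  obtain ⟨S', hS', F, hF, hcr⟩ := extract nc
  have V1S : V1 ⊆ S := (erase_subset _ _).trans sdiff_subset
  have cV1 : V1.card + T.card + 1 = S.card := by grind
  have S'S := hS'.trans V1S
  have cS' : S'.card < S.card := by have := card_le_card hS'; omega
  have S'2 := two_le hq hcr
  have off : ∀ A : Finset V, u ∉ A → ∀ a ∈ A, ∀ b ∈ A, F.Adj a b → H.Adj a b := fun A hA a ha b hb k =>
    (hF k).resolve_right (star_adj_ne (fun e => hA (e ▸ ha)) (fun e => hA (e ▸ hb)))
  have uS' : u ∈ S' := by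
    by_contra k
    exact hcr.nc ((c.subcol S'S cS').mono subset_rfl (off S' k))
  have pS' := pot_of_star (S := S') (q := q) hF
  have pF := c.le hcr cS'
  set c' := (P ∩ S').card with hc'
  have NP : N0 ⊆ P := filter_subset _ _
  have c'' : (N0 ∩ S').card ≤ c' := card_le_card (inter_subset_inter_right NP)
  have c''z : ((N0 ∩ S').card : ℤ) ≤ c' := by exact_mod_cast c''
  have m1 := mul_le_mul_of_nonneg_left c''z (by linarith : (0:ℤ) ≤ 2 * q)
  have c2 : 2 ≤ c' := by
    by_contra k
    have h1 : (c' : ℤ) ≤ 1 := by grind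
    have := mul_le_mul_of_nonneg_left h1 (by linarith : (0:ℤ) ≤ 2 * q)
    have := c.S2 S' S'S S'2 cS'
    linarith
  have c3 : c' ≤ P.card := card_le_card inter_subset_left
  have c2z : (2:ℤ) ≤ c' := by exact_mod_cast c2
  have c3z : (c':ℤ) + 2 ≤ q := by grind
  have q4 : (4:ℤ) ≤ q := by linarith
  have ar := oe_ar c2z c3z
  have eXS : S' ∩ X = P ∩ S' := by grind
  have pX := hcl.pot q
  rw [cX] at pX
  have pI : pot q H (S' ∩ X) = (c':ℤ) * ((q:ℤ)^2 + 2*q - 2 - q * c') := by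
    rw [eXS, (hcl.mono (inter_subset_left.trans PX) : Clq H (P ∩ S')).pot q]
  have sub := pot_submod q H S' X
  have hSx : pot q H (S' ∪ X) ≤ pot q F S' + 4 * q - 4 := by linarith
  have ySX : y ∉ S' ∪ X := fun k => by grind
  have pQ := pot_insert q H ySX
  set Q := insert y (S' ∪ X) with hQ
  have QS : Q ⊆ S := insert_subset hy (union_subset S'S XS)
  have nbQ : nb H (S' ∪ X) y = nb H Q y := (nb_ins H _ y).symm
  have dQ : (nb H Q y).card + (S.card - Q.card) ≥ q := by
    have h1 : nb H S y ⊆ nb H Q y ∪ (S \ Q) := fun z hz => by grind [mem_nb, nb_sub, Clq, Ok]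
    have h2 := (card_le_card h1).trans (card_union_le _ _)
    rw [card_sdiff_of_subset QS] at h2; omega
  have dQ3 : 3 ≤ (nb H Q y).card := by
    have h1 : insert u T ⊆ nb H Q y := fun z hz => by grind [mem_nb, nb_sub, Clq, Ok]
    have := card_le_card h1
    rw [card_insert_of_notMem huT] at this; omega
  rw [nbQ] at pQ
  have cQ := card_le_card QS
  have Q2 : 2 ≤ Q.card := by grind
  have p1 := c.p1; have p2 := c.p2
  rcases (by omega : Q.card + 2 ≤ S.card ∨ Q.card + 1 = S.card ∨ Q.card = S.card) with hn | hn | hn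
  · have l1 := c.LSa QS Q2 hn
    have d3 : (3:ℤ) ≤ (nb H Q y).card := by exact_mod_cast dQ3
    have := mul_le_mul_of_nonneg_left d3 (by linarith : (0:ℤ) ≤ 2 * q)
    linarith
  · have l1 := c.n1 QS hn
    have d3 : (q:ℤ) ≤ (nb H Q y).card + 1 := by grind
    have := mul_le_mul_of_nonneg_left d3 (by linarith : (0:ℤ) ≤ 2 * q)
    have : 0 ≤ ((q:ℤ) - 4) * (q - 1) := mul_nonneg (by linarith) (by linarith)
    linarith
  have eQ : Q = S := eq_of_subset_of_card_le QS hn.ge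
  rw [eQ, dy] at pQ
  have q5 : (q:ℤ) ≤ 5 := by
    by_contra k
    have k' : (6:ℤ) ≤ q := by linarith
    have : 0 ≤ ((q:ℤ) - 6) * (q - 1) := mul_nonneg (by linarith) (by linarith)
    linarith
  have hO : Ore q F S' := by
    rcases c.sm hcr (Or.inl cS') with k | ⟨k, -⟩
    · exact k.1
    · exfalso
      have h45 : q = 4 ∨ q = 5 := by grind
      rcases h45 with rfl | rfl <;> norm_num at * <;> rcases k with k | k <;> linarith
  have loss : pot q H S + 2 * q ≤ 4 * q - 8 → False := fun k => by linarith
  have PS' : P ⊆ S' := by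
    by_contra k
    obtain ⟨p, hp, hpS⟩ := not_subset.1 k
    by_cases hn : ∃ z ∈ S', z ∉ X ∧ H.Adj z p
    · obtain ⟨z, h1, h2, h3⟩ := hn
      have := pot_submod1 q h1 h2 (PX hp) hpS h3
      refine loss ?_
      linarith
    · refine (mem_sdiff.1 hp).2 (mem_filter.2 ⟨PS hp, ?_⟩)
      have h1 : insert p (nb H S p) ⊆ insert x (nb H S x) := by
        have e0 : insert x (nb H S x) = insert y X := by
          rw [hX, insert_erase]; simp [mem_nb, hy, hxy]
        rw [e0]
        refine insert_subset (by simp [PX hp]) fun z hz => ?_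
        rw [mem_nb] at hz
        by_contra l
        simp only [mem_insert, not_or] at l
        have : z ∈ Q := by grind
        simp only [hQ, mem_insert, mem_union, l, or_false, false_or] at this
        exact hn ⟨z, this, l.2, hz.2.symm⟩
      refine eq_of_subset_of_card_le h1 ?_
      rw [card_insert_of_notMem notMem_nb, card_insert_of_notMem notMem_nb, dx]
      have := c.cr.deg (PS hp); omega
  have eS' : S' = V1 := by grind
  have uP : ∀ p ∈ P, ¬ H.Adj u p := by
    intro p hp k
    have : (N0 ∩ S').card + 1 ≤ c' := by
      refine card_lt_card (Finset.ssubset_iff_subset_ne.2 ⟨inter_subset_inter_right NP, fun e => ?_⟩)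
      have h1 : p ∈ P ∩ S' := by grind
      rw [← e, mem_inter, hN0, mem_filter] at h1
      exact h1.1.2 k
    have t1 : ((N0 ∩ S').card : ℤ) + 1 ≤ c' := by exact_mod_cast this
    have t2 := mul_le_mul_of_nonneg_left t1 (by linarith : (0:ℤ) ≤ 2 * q)
    exact loss (by linarith)
  have FK : ∀ a ∈ S', ∀ b ∈ S', (H ⊔ star u N0).Adj a b → F.Adj a b := by
    intro a ha b hb k
    by_contra l
    have t1 := E_lt2 (H := F) (J := H ⊔ star u N0) (A := S') (fun _ _ _ _ k => hF k) ha hb k l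
    have t2 := mul_le_mul_of_nonneg_left t1 (by linarith : (0:ℤ) ≤ q)
    have t3 := pot_star q H u N0 S'
    have t4 : pot q (H ⊔ star u N0) S' + 2 * q ≤ pot q F S' := by unfold pot; linarith
    exact loss (by linarith)
  have ZS : insert u P ⊆ S' := insert_subset uS' PS'
  have Zc : Clq F (insert u P) := by
    intro a ha b hb hne
    have aS := ZS ha
    have bS := ZS hb
    rw [mem_insert] at ha hb
    rcases ha with rfl | ha <;> rcases hb with rfl | hb
    · exact absurd rfl hne
    · grind
    · exact FK _ aS _ bS (KuP a ha).symm
    · grind [mem_nb, nb_sub, Clq, Ok]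
  have nS : ∀ e ∈ S', e ∉ X → nb H S e ⊆ insert y (nb H S' e) := by
    intro e he heX z hz
    rw [mem_nb] at hz
    rw [mem_insert, mem_nb]
    by_cases k : z = y
    · exact Or.inl k
    · refine Or.inr ⟨?_, hz.2⟩
      rw [eS']
      refine mem_erase.2 ⟨k, mem_sdiff.2 ⟨hz.1, fun l => ?_⟩⟩
      rcases Tn z l e (S'S he) hz.2.symm with m | m
      · exact heX m
      · grind
  rcases O2 hq hO _ ZS Zc with k | ⟨X', hX', dj, k2, k3⟩ | ⟨E', hE', dj, k2, k3, T0, hT0, k4, k5⟩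
  · have Fc := hcr.clq k
    refine miss x (TX (cl_self hx)) fun p hp _ => ?_
    by_cases l : p ∈ T
    · exact Ty' p l
    have hp' : p ∈ P := mem_sdiff.2 ⟨hp, l⟩
    have hpx : p ≠ x := by grind
    have hxp : H.Adj x p := hcl x (TX (cl_self hx)) p hp hpx.symm
    by_contra npy
    have e1 : nb H (S \ X) p = (S'.erase u) \ P := by
      ext z
      rw [mem_nb, mem_sdiff (s := S), mem_sdiff (s := S'.erase u), mem_erase (s := S')]
      constructor
      · rintro ⟨⟨h1, h2⟩, h3⟩
        refine ⟨⟨?_, ?_⟩, fun h => h2 (PX h)⟩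
        · rintro rfl; exact uP p hp' h3.symm
        · rw [eS']
          exact mem_erase.2 ⟨by rintro rfl; exact npy h3.symm, mem_sdiff.2 ⟨h1, fun h => h2 (TX h)⟩⟩
      · rintro ⟨⟨h1, h2⟩, h3⟩
        have h4 : z ∉ X := fun h => by grind
        refine ⟨⟨S'S h2, h4⟩, ?_⟩
        exact (hF (Fc p (PS' hp') z h2 (fun e => h4 (e ▸ hp)))).resolve_right
          (star_adj_ne (fun e => huP (e ▸ hp')) h1)
    have e2 := nb_out hcl XS hp
    rw [e1, card_sdiff_of_subset (fun z hz => mem_erase.2 ⟨fun e => huP (by rw [← e]; exact hz), PS' hz⟩),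
      card_erase_of_mem uS', k, cX] at e2
    have hM := c.M hx dx (PS hp') hxp (by omega) (by rw [← hT]; omega)
    refine miss p hp fun e he hne => ?_
    refine hM y ?_ e ?_ (by rintro rfl; exact yX he)
    · grind [mem_nb, nb_sub, Clq, Ok]
    · grind
  · have := pot_mg q (H := F) (J := H) (off X' (fun h => Finset.disjoint_left.1 dj h (mem_insert_self _ _)))
    have X'S := hX'.trans S'S
    have := c.S2 X' X'S k2 (lt_of_le_of_lt (card_le_card hX') cS')
    linarith
  · have uE : u ∉ E' := fun h => Finset.disjoint_left.1 dj h (mem_insert_self _ _)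
    have EX : ∀ e ∈ E', e ∉ X := fun e he h => by
      have := hS' (hE' he)
      rw [hV1, mem_erase, mem_sdiff] at this
      exact Finset.disjoint_left.1 dj he (mem_insert_of_mem (mem_sdiff.2 ⟨h, this.2.2⟩))
    have ES := hE'.trans S'S
    have dg : ∀ e ∈ T0, (nb H S' e).card ≤ q := fun e he => by
      rw [← k5 e he]
      refine card_le_card fun z hz => ?_
      rw [mem_nb] at hz ⊢
      exact ⟨hz.1, FK e (hE' (hT0 he)) z hz.1 (Or.inl hz.2)⟩
    have yS' : y ∉ S' := by grind
    have c0 : (T0.filter fun e => H.Adj y e).card + 1 ≤ P.card := by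
      rw [← cN, ← card_insert_of_notMem (a := u) (s := T0.filter fun e => H.Adj y e)
        (fun h => uE (hT0 (mem_filter.1 h).1))]
      refine card_le_card (insert_subset hu fun e he => ?_)
      rw [mem_filter] at he
      exact mem_sdiff.2 ⟨mem_nb.2 ⟨ES (hT0 he.1), he.2⟩, fun h => EX e (hT0 he.1) (TX h)⟩
    have c1 := card_filter_add_card_filter_not (s := T0) (fun e => H.Adj y e)
    obtain ⟨a, b, ha, hb, hab⟩ := one_lt_card_iff.1 (by omega : 1 < (T0.filter fun e => ¬ H.Adj y e).card)
    have dL : ∀ e ∈ T0.filter (fun e => ¬ H.Adj y e), (nb H S e).card = q := fun e he => by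
      rw [mem_filter] at he
      refine le_antisymm ?_ (c.cr.deg (ES (hT0 he.1)))
      refine le_trans (card_le_card fun z hz => ?_) (dg e he.1)
      have := nS e (hE' (hT0 he.1)) (EX e (hT0 he.1)) hz
      rw [mem_insert] at this
      refine this.resolve_left ?_
      rintro rfl
      exact he.2 (mem_nb.1 hz).2.symm
    refine c.AE2 ES (fun p hp r hr hne => off E' uE p hp r hr (k3 p hp r hr hne)) k2 hT0 k4 (fun e he => ?_)
      (mem_of_mem_filter a ha) (mem_of_mem_filter b hb) hab (dL a ha) (dL b hb)
    have := (card_le_card (nS e (hE' (hT0 he)) (EX e (hT0 he)))).trans (card_insert_le _ _)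
    have := dg e he
    omega

theorem hall2 {F : V → Finset (Fin q)} (hT : T.card + 1 ≤ q) (h : ∀ e ∈ T, (F e).card ≤ 2)
    (hab : ∃ a ∈ T, ∃ b ∈ T, (F a ∩ F b).card ≤ 1) :
    ∃ g : V → Fin q, (∀ e ∈ T, g e ∉ F e) ∧ ∀ e ∈ T, ∀ e' ∈ T, g e = g e' → e = e' := by
  obtain ⟨a, ha, b, hb, hab⟩ := hab
  have key := (Finset.all_card_le_biUnion_card_iff_exists_injective
    (fun e : T => (univ : Finset (Fin q)) \ F e)).1 (by
    intro s
    have card : ∀ D : Finset (Fin q), ((univ : Finset (Fin q)) \ D).card = q - D.card := fun D => by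
      rw [card_sdiff_of_subset (subset_univ _), card_univ, Fintype.card_fin]
    have sT : s.card ≤ T.card := by
      have := card_le_univ s
      rwa [Fintype.card_coe] at this
    rcases s.eq_empty_or_nonempty with rfl | ⟨e, he⟩
    · simp
    by_cases hs : s = univ
    · have h1 : (univ : Finset (Fin q)) \ (F a ∩ F b) ⊆ s.biUnion fun e : T => univ \ F e := by
        intro d hd
        rw [mem_sdiff, mem_inter, not_and_or] at hd
        rw [mem_biUnion]
        rcases hd.2 with k | k
        · exact ⟨⟨a, ha⟩, by rw [hs]; simp, by simp [k]⟩
        · exact ⟨⟨b, hb⟩, by rw [hs]; simp, by simp [k]⟩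
      have h2 := card_le_card h1
      rw [card] at h2
      omega
    · have h1 : (univ : Finset (Fin q)) \ F e ⊆ s.biUnion fun e : T => univ \ F e :=
        subset_biUnion_of_mem (fun e : T => (univ : Finset (Fin q)) \ F e) he
      have h2 := card_le_card h1
      rw [card] at h2
      have h3 := h e e.2
      have h4 : s.card < T.card := by
        have := card_lt_univ_of_notMem (s := s) (x := (not_forall.1 (fun k => hs (eq_univ_iff_forall.2 k))).choose)
          (not_forall.1 (fun k => hs (eq_univ_iff_forall.2 k))).choose_spec
        rwa [Fintype.card_coe] at this
      omega)
  obtain ⟨g, hg1, hg2⟩ := key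
  refine ⟨fun e => if k : e ∈ T then g ⟨e, k⟩ else ⟨0, by omega⟩, fun e he => ?_, fun e he e' he' k => ?_⟩
  · grind
  · grind

theorem pot_gap (q : ℕ) (h : ∀ a ∈ S, ∀ b ∈ S, F.Adj a b → J.Adj a b) :
    (∀ a ∈ S, ∀ b ∈ S, (F.Adj a b ↔ J.Adj a b)) ∨ pot q J S + 2 * q ≤ pot q F S := by
  by_cases k : ∀ a ∈ S, ∀ b ∈ S, J.Adj a b → F.Adj a b
  · grind
  · right
    push Not at k
    obtain ⟨a, ha, b, hb, k1, k2⟩ := k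
    have t1 := E_lt2 h ha hb k1 k2
    have t2 := mul_le_mul_of_nonneg_left t1 (by positivity : (0:ℤ) ≤ q)
    unfold pot; linarith

theorem nbI (hx : x ∈ S) (hz : z ∈ S) : z ∈ insert x (nb H S x) ↔ x ∈ insert z (nb H S z) := by
  simp only [mem_insert, mem_nb, hx, hz, true_and]
  exact ⟨fun h => h.elim (fun e => Or.inl e.symm) fun h => Or.inr h.symm,
    fun h => h.elim (fun e => Or.inl e.symm) fun h => Or.inr h.symm⟩

theorem tw_lt (hx : x ∈ S) (hv : v ∈ S) (hxv : H.Adj x v) (hn : v ∉ cl H S x)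
    (hF : ∀ a ∈ S, ∀ b ∈ S, (F.Adj a b ↔ (rwr H v ((insert x (nb H S x)).erase v)).Adj a b))
    (hc : (cl H S v).card ≤ (cl H S x).card) : tw H S < tw F S := by
  set D0 := (S ×ˢ S).filter fun p => p.1 ≠ v ∧ p.2 ≠ v ∧ insert p.1 (nb H S p.1) = insert p.2 (nb H S p.2) with hD0
  have h1 : tw H S ≤ D0.card + (cl H S v).card + (cl H S v).card := by
    have e1 : ((cl H S v).image fun w => (v, w)).card ≤ (cl H S v).card := card_image_le
    have e2 : ((cl H S v).image fun w => (w, v)).card ≤ (cl H S v).card := card_image_le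
    refine le_trans (card_le_card (t := (D0 ∪ (cl H S v).image fun w => (v, w)) ∪ (cl H S v).image fun w => (w, v)) ?_)
      ((card_union_le _ _).trans (add_le_add ((card_union_le _ _).trans (add_le_add le_rfl e1)) e2))
    rintro ⟨p, r⟩ hp
    rw [mem_filter, mem_product] at hp
    simp only [mem_union, mem_image, hD0, mem_filter, mem_product, Prod.mk.injEq]
    by_cases k : p = v
    · subst k; exact Or.inl (Or.inr ⟨r, mem_filter.2 ⟨hp.1.2, hp.2.symm⟩, rfl, rfl⟩)
    by_cases k' : r = v
    · subst k'; exact Or.inr ⟨p, mem_filter.2 ⟨hp.1.1, hp.2⟩, rfl, rfl⟩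
    exact Or.inl (Or.inl ⟨hp.1, k, k', hp.2⟩)
  have nF : ∀ p ∈ S, p ≠ v → insert p (nb F S p) =
      (insert p (nb H S p)).erase v ∪ (if p ∈ insert x (nb H S x) then {v} else ∅) := by
    intro p hp hpv
    ext z
    have h1 := fun hz : z ∈ S => hF p hp z hz
    by_cases hz : z ∈ S
    · by_cases k : z = v
      · subst k
        have : (rwr H z ((insert x (nb H S x)).erase z)).Adj p z ↔ p ∈ insert x (nb H S x) := by
          rw [SimpleGraph.adj_comm, rwr_adj_v]; simp [hpv]
        rw [mem_insert, mem_nb, h1 hz, this]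
        split_ifs with l <;> simp [l, hz, hpv.symm]
      · rw [mem_insert, mem_nb, h1 hz, rwr_adj hpv k]
        split_ifs with l <;> simp [k, hz, mem_nb]
    · grind [mem_nb, nb_sub, Clq, Ok]
  have nv : insert v (nb F S v) = insert x (nb H S x) := by
    ext z
    by_cases k : z = v
    · subst k; simp [mem_nb, hv, hxv]
    · have h1 : z ∈ insert x (nb H S x) → z ∈ S := fun h => by grind [mem_nb, nb_sub, Clq, Ok]
      rw [mem_insert, mem_nb]
      by_cases hz : z ∈ S
      · rw [hF v hv z hz, rwr_adj_v, mem_erase]; simp [k, hz]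
      · grind
  have nc : ∀ w ∈ cl H S x, insert w (nb F S w) = insert x (nb H S x) := by
    intro w hw
    have hwv : w ≠ v := by grind
    have hwx : w ∈ insert x (nb H S x) := by rw [← cl_eq hw]; simp
    rw [nF w (cl_sub hw) hwv, if_pos hwx, cl_eq hw]
    ext z
    simp only [mem_union, mem_erase, mem_singleton]
    constructor
    · grind
    · grind
  have h2 : D0.card + ((cl H S x).card + 1) + (cl H S x).card ≤ tw F S := by
    have e1 : ((insert v (cl H S x)).image fun w => (v, w)).card = (cl H S x).card + 1 := by
      rw [card_image_of_injective _ (fun a b h => (Prod.mk.inj h).2), card_insert_of_notMem hn]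
    have e2 : ((cl H S x).image fun w => (w, v)).card = (cl H S x).card :=
      card_image_of_injective _ (fun a b h => (Prod.mk.inj h).1)
    rw [← e1, ← card_union_of_disjoint, ← e2, ← card_union_of_disjoint]
    · refine card_le_card ?_
      rintro ⟨p, r⟩ hp
      simp only [mem_union, mem_image, hD0, mem_filter, mem_product, Prod.mk.injEq] at hp
      rw [mem_filter, mem_product]
      rcases hp with (⟨k1, k2, k3, k4⟩ | ⟨w, hw, rfl, rfl⟩) | ⟨w, hw, rfl, rfl⟩
      · refine ⟨k1, ?_⟩
        dsimp only
        rw [nF p k1.1 k2, nF r k1.2 k3, k4]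
        have : p ∈ insert x (nb H S x) ↔ r ∈ insert x (nb H S x) := by
          rw [nbI hx k1.1, nbI hx k1.2, k4]
        simp only [this]
      · grind [mem_nb, nb_sub, Clq, Ok]
      · grind [mem_nb, nb_sub, Clq, Ok]
    · rw [Finset.disjoint_left]
      rintro ⟨p, r⟩ hp hp'
      simp only [mem_union, mem_image, hD0, mem_filter, mem_product, Prod.mk.injEq] at hp hp'
      obtain ⟨w, hw, rfl, rfl⟩ := hp'
      rcases hp with k | ⟨w', hw', e, -⟩
      · grind
      · exact hn (e ▸ hw)
    · rw [Finset.disjoint_left]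
      rintro ⟨p, r⟩ hp hp'
      simp only [mem_image, hD0, mem_filter, mem_product, Prod.mk.injEq] at hp hp'
      obtain ⟨w, hw, rfl, rfl⟩ := hp'
      exact hp.2.1 rfl
  omega

theorem Ctx.spn (c : Ctx q H S) (hx : x ∈ S) (dx : (nb H S x).card = q) (hv : v ∈ S) (dv : (nb H S v).card = q)
    (hxv : H.Adj x v) (hn : v ∉ cl H S x) (hc : (cl H S v).card ≤ (cl H S x).card)
    (hF : F ≤ rwr H v ((insert x (nb H S x)).erase v)) (hcr : Crit q F S) :
    Ore q F S ∧ pot q H S = (q:ℤ)^2 - q - 2 ∧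
      ∀ a ∈ S, ∀ b ∈ S, (F.Adj a b ↔ (rwr H v ((insert x (nb H S x)).erase v)).Adj a b) := by
  have hp := pot_rwr (H := H) q (S := S) (N := (insert x (nb H S x)).erase v) (v := v)
    ((erase_subset _ _).trans (insert_subset hx nb_sub)) (by simp) hv
  have cN : ((insert x (nb H S x)).erase v).card = q := by
    rw [card_erase_of_mem (by simp [mem_nb, hv, hxv]), card_insert_of_notMem notMem_nb]; omega
  rw [cN, dv, sub_self, mul_zero, add_zero] at hp
  have hz := c.hz
  have p2 := c.p2
  rcases pot_gap (S := S) (F := F) (J := rwr H v ((insert x (nb H S x)).erase v)) q (fun _ _ _ _ h => hF h) with k | k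
  · have e : pot q F S = pot q H S := by rw [← hp]; exact pot_congr q k
    rcases c.sm hcr (Or.inr ⟨rfl, Or.inr ⟨E_pot e (by omega), tw_lt hx hv hxv hn k hc⟩⟩) with l | ⟨-, l⟩
    · grind
    · linarith
  · exfalso
    rcases c.sm hcr (Or.inr ⟨rfl, Or.inl (E_pot_lt (q := q) (by linarith))⟩) with l | ⟨-, l⟩
    · linarith [l.2]
    · linarith

theorem Ctx.gad (c : Ctx q H S) (hT : T ⊆ S) (hTc : T.card < S.card) (hv : v ∈ T) (hN : N.card ≤ q)
    (nc : ¬ Col q (rwr H v N) T) : ∃ Y ⊆ T.erase v, N ⊆ Y ∧ N.card = q ∧ pot q H Y ≤ 2 * (q:ℤ)^2 - 2 * q := by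
  obtain ⟨W, hW, F, hF, hcr⟩ := extract nc
  have WS := hW.trans hT
  have hlt : W.card < S.card := lt_of_le_of_lt (card_le_card hW) hTc
  have FH : ∀ y ∈ W.erase v, ∀ z ∈ W.erase v, F.Adj y z → H.Adj y z := fun y hy z hz k =>
    (rwr_adj (mem_erase.1 hy).1 (mem_erase.1 hz).1).1 (hF k)
  have vW : v ∈ W := by
    by_contra hvW
    rw [erase_eq_of_notMem hvW] at FH
    exact hcr.nc ((c.subcol WS hlt).mono subset_rfl FH)
  have h1 : nb F W v ⊆ N := fun z hz => by
    rw [mem_nb] at hz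
    exact (rwr_adj_v.1 (hF hz.2)).2
  have dg := hcr.deg vW
  have nF : nb F W v = N := eq_of_subset_of_card_le h1 (hN.trans dg)
  have p1 := pot_erase q F vW
  rw [nF] at p1 dg
  have cN : N.card = q := le_antisymm hN dg
  rw [cN] at p1
  refine ⟨W.erase v, erase_subset_erase _ hW, by rw [← nF]; exact nb_erase _ _ _, cN, ?_⟩
  have p2 := pot_mg (S := W.erase v) q (H := F) (J := H) FH
  have p3 := c.le hcr hlt
  linarith

theorem pairext (hq : 4 ≤ q) {ψ : V → Fin q} (hst : s ≠ t) (h : Ok H ((S.erase t).erase s) ψ)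
    (hs : ((nb H ((S.erase t).erase s) s).image ψ).card ≤ 3)
    (ht : ((nb H ((S.erase t).erase s) t).image ψ).card ≤ 2) :
    ∃ ψ' : V → Fin q, Ok H S ψ' ∧ ∀ z, z ≠ s → z ≠ t → ψ' z = ψ z := by
  have ex : ∀ D : Finset (Fin q), D.card ≤ 3 → ∃ d, d ∉ D := fun D hD => by
    have : D.card < (univ : Finset (Fin q)).card := by rw [card_univ, Fintype.card_fin]; omega
    obtain ⟨d, -, hd⟩ := exists_mem_notMem_of_card_lt_card this
    exact ⟨d, hd⟩
  obtain ⟨d, hd⟩ := ex _ hs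
  obtain ⟨d', hd'⟩ := ex (insert d ((nb H ((S.erase t).erase s) t).image ψ)) ((card_insert_le _ _).trans (by omega))
  have h1 : Ok H (S.erase t) (Function.update ψ s d) := h.upd fun z hz e => hd (by
    rw [← e]
    refine mem_image_of_mem _ ?_
    rw [mem_nb] at hz ⊢
    exact ⟨mem_erase.2 ⟨hz.2.ne.symm, hz.1⟩, hz.2⟩)
  refine ⟨Function.update (Function.update ψ s d) t d', h1.upd fun z hz e => hd' ?_, fun z h1 h2 => by
    rw [Function.update_of_ne h2, Function.update_of_ne h1]⟩
  rw [mem_nb] at hz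
  rw [mem_insert]
  by_cases k : z = s
  · grind
  · right
    rw [Function.update_of_ne k] at e
    rw [← e]
    exact mem_image_of_mem _ (mem_nb.2 ⟨mem_erase.2 ⟨k, mem_erase.2 ⟨hz.2.ne.symm, hz.1⟩⟩, hz.2⟩)

theorem two_c {M1 M2 : Finset (Fin q)} (h1 : M1.Nonempty) (h2 : M2.Nonempty) (c1 : M1.card ≤ 2) (c2 : M2.card ≤ 2)
    (h : (M1 ∪ M2).card ≤ 3) : ∃ c, (insert c M1).card ≤ 2 ∧ (insert c M2).card ≤ 2 := by
  by_cases e : (M1 ∩ M2).Nonempty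
  · obtain ⟨c, hc⟩ := e
    rw [mem_inter] at hc
    exact ⟨c, by rwa [insert_eq_self.2 hc.1], by rwa [insert_eq_self.2 hc.2]⟩
  · rw [not_nonempty_iff_eq_empty] at e
    have := card_union_add_card_inter M1 M2
    rw [e, card_empty] at this
    by_cases k : M1.card ≤ 1
    · obtain ⟨c, hc⟩ := h2
      exact ⟨c, (card_insert_le _ _).trans (by omega), by rwa [insert_eq_self.2 hc]⟩
    · obtain ⟨c, hc⟩ := h1
      exact ⟨c, by rwa [insert_eq_self.2 hc], (card_insert_le _ _).trans (by omega)⟩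

theorem bow (hq : 4 ≤ q) (nc : ¬ Col q H S) {t1 t2 t3 p r : V} {A3 B' : Finset V} (h13 : t1 ≠ t3) (hpr : r ≠ p)
    (h21 : t2 ≠ t1) (h23 : t2 ≠ t3)
    (hA : A.Nonempty) (hAc : A.card ≤ 2) (hA3 : A3.card ≤ 2) (hB : B.Nonempty) (hBc : B.card ≤ 2) (hB' : B'.card ≤ 2)
    (h1 : ∀ z ∈ S, H.Adj t1 z → z = t2 ∨ z = t3 ∨ z ∈ A) (h3 : ∀ z ∈ S, H.Adj t3 z → z = t2 ∨ z = t1 ∨ z ∈ A3)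
    (h2 : ∀ z ∈ S, H.Adj t2 z → z = t1 ∨ z = t3 ∨ z = p ∨ z = r)
    (hp : ∀ z ∈ S, H.Adj p z → z = t2 ∨ z = r ∨ z ∈ B) (hr : ∀ z ∈ S, H.Adj r z → z = t2 ∨ z = p ∨ z ∈ B')
    (hBt : ∀ z ∈ B, z ≠ t1 ∧ z ≠ t3)
    {ψ : V → Fin q} (hψ : Ok H ((((((S.erase p).erase r).erase t1).erase t3)).erase t2) ψ) :
    4 ≤ (A.image ψ ∪ B.image ψ).card := by
  by_contra hlt
  obtain ⟨c, c1, c2⟩ := two_c (hA.image ψ) (hB.image ψ) (card_image_le.trans hAc) (card_image_le.trans hBc)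
    (by omega)
  have k1 := hψ.upd (c := c) (by
    intro u hu
    simp only [mem_nb, mem_erase] at hu
    have := h2 u hu.1.2.2.2.2 hu.2
    simp_all)
  set ψ1 := Function.update ψ t2 c with hψ1
  have e2 : ψ1 t2 = c := by simp [hψ1]
  have en : ∀ z, z ≠ t2 → ψ1 z = ψ z := by grind
  obtain ⟨ψ2, k2, l2⟩ := pairext (H := H) (S := (S.erase p).erase r) (s := t3) (t := t1) hq h13.symm k1
    (by
      refine card_image_le.trans ((card_le_card (t := insert t2 A3) fun z hz => ?_).trans
        ((card_insert_le _ _).trans (by omega)))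
      simp only [mem_nb, mem_erase] at hz
      have := h3 z hz.1.2.2.2.2 hz.2
      simp_all)
    (by
      refine (card_le_card (t := insert c (A.image ψ)) fun k hk => ?_).trans c1
      obtain ⟨z, hz, rfl⟩ := mem_image.1 hk
      simp only [mem_nb, mem_erase] at hz
      by_cases hz2 : z = t2
      · grind
      rw [en z hz2]
      have := h1 z hz.1.2.2.2.2 hz.2
      exact mem_insert_of_mem (mem_image_of_mem _ (by tauto)))
  obtain ⟨ψ3, k3, l3⟩ := pairext (H := H) (S := S) (s := r) (t := p) hq hpr k2
    (by
      refine card_image_le.trans ((card_le_card (t := insert t2 B') fun z hz => ?_).trans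
        ((card_insert_le _ _).trans (by omega)))
      simp only [mem_nb, mem_erase] at hz
      have := hr z hz.1.2.2 hz.2
      simp_all)
    (by
      refine (card_le_card (t := insert c (B.image ψ)) fun k hk => ?_).trans c2
      obtain ⟨z, hz, rfl⟩ := mem_image.1 hk
      simp only [mem_nb, mem_erase] at hz
      by_cases hz2 : z = t2
      · grind
      have := hp z hz.1.2.2 hz.2
      have hzB : z ∈ B := by tauto
      rw [l2 z (hBt z hzB).2 (hBt z hzB).1, en z hz2]
      exact mem_insert_of_mem (mem_image_of_mem _ hzB))
  exact nc ⟨_, k3⟩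

theorem tx_h (nc : ¬ Col q H S) (hX : X ⊆ S) (h : Ty q H S X) {ψ : V → Fin q} (hψ : Ok H X ψ)
    (ha : a ∈ S \ X) (hb : b ∈ S \ X) : 2 ≤ ((nb H X a).image ψ ∩ (nb H X b).image ψ).card := by
  by_contra hlt
  have e : S \ (S \ X) = X := Finset.sdiff_sdiff_eq_self hX
  obtain ⟨g, g1, g2⟩ := hall2 (T := S \ X) (F := fun e => (nb H X e).image ψ) (by rw [h.2.1])
    (fun e he => card_image_le.trans (h.out hX he).le) ⟨a, ha, b, hb, by omega⟩
  refine nc (ext_inj (T := S \ X) (f := ψ) (g := g) (by rwa [e]) g2 ?_)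
  rw [e]
  intro t ht u hu hh
  exact g1 t ht (mem_image.2 ⟨u, hu, hh⟩)

theorem tx_low (c : Ctx q H S) (hX : X ⊆ S) (h : Ty q H S X) (hp : pot q H X = 2 * (q:ℤ)^2 - 2 * q)
    (hY : Y ⊆ S) (h2 : 2 ≤ Y.card) (h3 : Y.card + 2 ≤ S.card) : 2 * (q:ℤ)^2 - 2 * q ≤ pot q H Y := by
  by_contra hlt
  rcases c.LS Y hY h2 h3 (by omega) with ⟨k1, k2⟩ | k
  · have := k2.pot q; rw [k1] at this; linarith
  · have := k.pot hY; have := h.pot hX; omega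

theorem tx_ne (c : Ctx q H S) (hX : X ⊆ S) (h : Ty q H S X) : ∃ a ∈ S \ X, ∃ b ∈ S \ X, nb H X a ≠ nb H X b := by
  by_contra hn
  push Not at hn
  have hq := c.hq
  obtain ⟨t, ht⟩ : (S \ X).Nonempty := card_pos.1 (by have := h.2.1; omega)
  obtain ⟨p, r, hpr, e⟩ := card_eq_two.1 (h.out hX ht)
  have hap : ∀ s ∈ S \ X, H.Adj s p := fun s hs => (mem_nb.1 (by rw [hn s hs t ht, e]; simp : p ∈ nb H X s)).2
  have har : ∀ s ∈ S \ X, H.Adj s r := fun s hs => (mem_nb.1 (by rw [hn s hs t ht, e]; simp : r ∈ nb H X s)).2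
  have hpX : p ∈ X := by grind [mem_nb, nb_sub, Clq, Ok]
  have hrX : r ∈ X := by grind [mem_nb, nb_sub, Clq, Ok]
  have hpT : p ∉ S \ X := by simp [hpX]
  have hrT : r ∉ S \ X := by simp [hrX]
  refine c.dia2 (T := insert p (S \ X)) (insert_subset (hX hpX) sdiff_subset) ?_
    (by rw [card_insert_of_notMem hpT, h.2.1]) (hX hrX) (by simp [hpr.symm, hrX]) (A := S \ X) (subset_insert _ _)
    h.2.1.ge fun s hs => (har s hs).symm
  intro u hu v hv huv
  rcases mem_insert.1 hu with e1 | hu' <;> rcases mem_insert.1 hv with e2 | hv'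
  · grind
  · exact e1 ▸ (hap v hv').symm
  · exact e2 ▸ hap u hu'
  · exact h.1 u hu' v hv' huv

theorem tx5 (hq : 5 ≤ q) (c : Ctx q H S) (hX : X ⊆ S) (h : Ty q H S X) (hp : pot q H X = 2 * (q:ℤ)^2 - 2 * q) : False := by
  obtain ⟨a, ha, b, hb, hne⟩ := tx_ne c hX h
  have ca := h.out hX ha
  have cb := h.out hX hb
  obtain ⟨u, hu, hub⟩ : ∃ u ∈ nb H X a, u ∉ nb H X b := by
    by_contra hn; push Not at hn
    exact hne (eq_of_subset_of_card_le hn (by omega))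
  have hc : X.card + 2 ≤ S.card := by
    have := card_sdiff_add_card_eq_card hX; have := h.2.1; omega
  have hz : (5:ℤ) ≤ q := by exact_mod_cast hq
  obtain ⟨f, hf⟩ := c.addS 2 u cb.le hX (by omega) fun Y hY h2 => by
    have := tx_low c hX h hp (hY.trans hX) h2 (by have := card_le_card hY; omega)
    push_cast
    have := mul_nonneg (by linarith : (0:ℤ) ≤ q) (by linarith : (0:ℤ) ≤ q - 5)
    linarith
  have := tx_h c.cr.nc hX h (hf.mono subset_rfl fun _ _ _ _ e => Or.inl e) ha hb
  have k : (nb H X a).image f ∩ (nb H X b).image f ⊆ ((nb H X a).image f).erase (f u) := by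
    intro k hk
    rw [mem_inter] at hk
    refine mem_erase.2 ⟨?_, hk.1⟩
    rintro rfl
    obtain ⟨w, hw, e⟩ := mem_image.1 hk.2
    exact hf u (nb_sub hu) w (nb_sub hw) (Or.inr (star_adj_f.2 ⟨fun e => hub (e ▸ hw), hw⟩)) e.symm
  have k2 := card_le_card k
  rw [card_erase_of_mem (mem_image_of_mem _ hu)] at k2
  have := card_image_le (s := nb H X a) (f := f)
  omega

theorem tx_ed (c : Ctx q H S) (hX : X ⊆ S) (h : Ty q H S X) (ha : a ∈ S \ X) (hb : b ∈ S \ X)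
    (hne : nb H X a ≠ nb H X b) (z : V) (hza : z ∈ nb H X a) : z ∉ nb H X b := by
  intro hzb
  have hq := c.hq
  have ca := h.out hX ha
  have cb := h.out hX hb
  obtain ⟨p, hp, hpb⟩ : ∃ u ∈ nb H X a, u ∉ nb H X b := by
    by_contra hn; push Not at hn
    exact hne (eq_of_subset_of_card_le hn (by omega))
  obtain ⟨r, hr, hra⟩ : ∃ u ∈ nb H X b, u ∉ nb H X a := by
    by_contra hn; push Not at hn
    exact hne (eq_of_subset_of_card_le hn (by omega)).symm
  have hc : X.card < S.card := by
    have := card_sdiff_add_card_eq_card hX; have := h.2.1; omega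
  obtain ⟨f, hf⟩ := c.one p (N := {r}) (by simp) hX hc
  have k := tx_h c.cr.nc hX h (hf.mono subset_rfl fun _ _ _ _ e => Or.inl e) ha hb
  have hpr : f p ≠ f r := hf p (nb_sub hp) r (nb_sub hr)
    (Or.inr (star_adj_f.2 ⟨fun e => hra (e ▸ hp), by simp⟩))
  have ea : nb H X a = {p, z} := (eq_of_subset_of_card_le (by
    intro w hw; simp only [mem_insert, mem_singleton] at hw; rcases hw with rfl | rfl <;> assumption)
    (by rw [ca, card_pair (fun e : p = z => hpb (e ▸ hzb))])).symm
  have eb : nb H X b = {r, z} := (eq_of_subset_of_card_le (by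
    intro w hw; simp only [mem_insert, mem_singleton] at hw; rcases hw with rfl | rfl <;> assumption)
    (by rw [cb, card_pair (fun e : r = z => hra (e ▸ hza))])).symm
  rw [ea, eb] at k
  have : (({p, z} : Finset V).image f ∩ ({r, z} : Finset V).image f) ⊆ {f z} := by grind
  have := card_le_card this
  rw [card_singleton] at this
  omega

theorem bow2 (c : Ctx 4 H S) {t1 t2 t3 p r : V} {A3 B' V0 : Finset V} (h13 : t1 ≠ t3) (hpr : r ≠ p)
    (h21 : t2 ≠ t1) (h23 : t2 ≠ t3) (h2V : t2 ∈ (((S.erase p).erase r).erase t1).erase t3)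
    (hV0 : ((((S.erase p).erase r).erase t1).erase t3).erase t2 = V0) (hV : V0.card + 5 = S.card)
    (hA : A ⊆ V0) (hAc : A.card = 2) (hA3 : A3.card = 2) (hB : B ⊆ V0) (hBc : B.card = 2) (hB' : B'.card = 2)
    (h1 : ∀ z ∈ S, H.Adj t1 z → z = t2 ∨ z = t3 ∨ z ∈ A) (h3 : ∀ z ∈ S, H.Adj t3 z → z = t2 ∨ z = t1 ∨ z ∈ A3)
    (h2 : ∀ z ∈ S, H.Adj t2 z → z = t1 ∨ z = t3 ∨ z = p ∨ z = r)
    (hp : ∀ z ∈ S, H.Adj p z → z = t2 ∨ z = r ∨ z ∈ B) (hr : ∀ z ∈ S, H.Adj r z → z = t2 ∨ z = p ∨ z ∈ B') :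
    (A ∪ B).card = 4 ∧ Clq H (A ∪ B) := by
  have hS1 : V0 ⊆ S := by grind
  have hBt : ∀ z ∈ B, z ≠ t1 ∧ z ≠ t3 := fun z hz => by grind
  have hn2 : ∀ z ∈ V0, z ≠ t2 := by grind
  set V1 := (((S.erase p).erase r).erase t1).erase t3 with hV1
  have hV1S : V1 ⊆ S := by grind
  have hV1c : V1.card + 4 = S.card := by grind
  have nc : ¬ Col 4 (rwr H t2 (A ∪ B)) V1 := by
    rintro ⟨f, hf⟩
    have k : Ok H V0 f := by
      refine hf.mono (hV0 ▸ erase_subset _ _) fun u hu v hv e => (rwr_adj (hn2 u hu) (hn2 v hv)).2 e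
    have k4 := bow (by norm_num) c.cr.nc (A := A) (B := B) (A3 := A3) (B' := B') h13 hpr h21 h23
      (card_pos.1 (by omega)) hAc.le hA3.le (card_pos.1 (by omega)) hBc.le hB'.le h1 h3 h2 hp hr hBt (ψ := f)
      (by rw [← hV0] at k; exact k)
    have : A.image f ∪ B.image f ⊆ univ.erase (f t2) := by
      intro k hk
      rw [← image_union] at hk
      obtain ⟨z, hz, rfl⟩ := mem_image.1 hk
      have hz0 : z ∈ V0 := (union_subset hA hB) hz
      refine mem_erase.2 ⟨?_, mem_univ _⟩
      exact (hf t2 h2V z (by rw [← hV0] at hz0; exact mem_of_mem_erase hz0) (rwr_adj_v.2 ⟨hn2 z hz0, hz⟩)).symm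
    have := card_le_card this
    rw [card_erase_of_mem (mem_univ _), card_univ, Fintype.card_fin] at this
    omega
  obtain ⟨Y, hY, hNY, hN, hpY⟩ := c.gad hV1S (by omega) h2V ((card_union_le A B).trans (by omega)) nc
  rw [hV0] at hY
  have c1 := card_le_card hY
  have c2 := card_le_card hNY
  rcases c.LS Y (hY.trans hS1) (by omega) (by omega) hpY with ⟨k1, k2⟩ | k
  · exact ⟨hN, k2.mono hNY⟩
  · have := card_sdiff_add_card_eq_card (hY.trans hS1); have := k.2.1; omega

set_option maxHeartbeats 1000000 in
theorem tx4a (c : Ctx 4 H S) (hX : X ⊆ S) (h : Ty 4 H S X) (hp : pot 4 H X = 24) {t1 t2 t3 : V}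
    (hT : S \ X = {t1, t2, t3}) (h12 : t1 ≠ t2) (h13 : t1 ≠ t3) (h23 : t2 ≠ t3)
    (d12 : ∀ z ∈ nb H X t1, z ∉ nb H X t2) (d32 : ∀ z ∈ nb H X t3, z ∉ nb H X t2) : False := by
  have m1 : t1 ∈ S \ X := by rw [hT]; simp
  have m2 : t2 ∈ S \ X := by rw [hT]; simp
  have m3 : t3 ∈ S \ X := by rw [hT]; simp
  have c1 := h.out hX m1
  have c2 := h.out hX m2
  have c3 := h.out hX m3
  have a12 : H.Adj t1 t2 := h.1 _ m1 _ m2 h12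
  have a13 : H.Adj t1 t3 := h.1 _ m1 _ m3 h13
  have a23 : H.Adj t2 t3 := h.1 _ m2 _ m3 h23
  have hpS : pot 4 H S = 6 := by have := h.pot hX; push_cast at this; linarith
  have s1 := (mem_sdiff.1 m1).1
  have s2 := (mem_sdiff.1 m2).1
  have s3 := (mem_sdiff.1 m3).1
  have x1 := (mem_sdiff.1 m1).2
  have x2 := (mem_sdiff.1 m2).2
  have x3 := (mem_sdiff.1 m3).2
  have dS : ∀ z ∈ S, z ∈ X ∨ z = t1 ∨ z = t2 ∨ z = t3 := by
    intro z hz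
    by_cases k : z ∈ X
    · exact Or.inl k
    · have : z ∈ S \ X := mem_sdiff.2 ⟨hz, k⟩
      rw [hT] at this; simp only [mem_insert, mem_singleton] at this; exact Or.inr this
  have n1 : ∀ z ∈ S, H.Adj t1 z → z = t2 ∨ z = t3 ∨ z ∈ nb H X t1 := by
    intro z hz e
    rcases dS z hz with k | rfl | k | k
    · grind [mem_nb, nb_sub, Clq, Ok]
    · exact absurd rfl e.ne
    · exact Or.inl k
    · grind
  have n3 : ∀ z ∈ S, H.Adj t3 z → z = t2 ∨ z = t1 ∨ z ∈ nb H X t3 := by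
    intro z hz e
    rcases dS z hz with k | k | k | rfl
    · grind [mem_nb, nb_sub, Clq, Ok]
    · grind
    · exact Or.inl k
    · exact absurd rfl e.ne
  obtain ⟨p, r, hpr, e2⟩ := card_eq_two.1 c2
  have n2 : ∀ z ∈ S, H.Adj t2 z → z = t1 ∨ z = t3 ∨ z = p ∨ z = r := by
    intro z hz e
    rcases dS z hz with k | k | rfl | k
    · grind [mem_nb, nb_sub, Clq, Ok]
    · exact Or.inl k
    · exact absurd rfl e.ne
    · grind
  have pm : p ∈ nb H X t2 := by rw [e2]; simp
  have rm : r ∈ nb H X t2 := by rw [e2]; simp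
  have p1 : ¬ H.Adj p t1 := fun e => d12 p (mem_nb.2 ⟨nb_sub pm, e.symm⟩) pm
  have r1 : ¬ H.Adj r t1 := fun e => d12 r (mem_nb.2 ⟨nb_sub rm, e.symm⟩) rm
  have p3 : ¬ H.Adj p t3 := fun e => d32 p (mem_nb.2 ⟨nb_sub pm, e.symm⟩) pm
  have r3 : ¬ H.Adj r t3 := fun e => d32 r (mem_nb.2 ⟨nb_sub rm, e.symm⟩) rm
  have px := nb_sub pm
  have rx := nb_sub rm
  have hn : t2 ∉ cl H S t1 := by
    intro k
    have := cl_adj k (hX px) (fun e => x2 (e ▸ px)) (fun e => x1 (e ▸ px))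
    exact p1 (this.1 (mem_nb.1 pm).2).symm
  have hcl : (cl H S t2).card ≤ (cl H S t1).card := by
    have k : cl H S t2 ⊆ {t2} := by
      intro z hz
      rw [mem_singleton]
      by_contra hz2
      rcases n2 z (cl_sub hz) (cl_adjx hz hz2) with rfl | rfl | rfl | rfl
      · exact p1 ((cl_adj hz (hX px) (fun e => x1 (e ▸ px)) (fun e => x2 (e ▸ px))).2 (mem_nb.1 pm).2).symm
      · exact p3 ((cl_adj hz (hX px) (fun e => x3 (e ▸ px)) (fun e => x2 (e ▸ px))).2 (mem_nb.1 pm).2).symm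
      · exact p1 ((cl_adj hz s1 (fun e => x1 (e ▸ px)) h12).2 a12.symm)
      · exact r1 ((cl_adj hz s1 (fun e => x1 (e ▸ rx)) h12).2 a12.symm)
    have := card_le_card k
    have : 0 < (cl H S t1).card := card_pos.2 ⟨t1, cl_self s1⟩
    rw [card_singleton] at *; omega
  have dg := h.2.2
  have fin : nb H X t1 = nb H X t3 → Clq H (nb H X t1) → False := by
    intro e hc
    have mm : ∀ z ∈ S, z ∈ insert t1 (nb H S t1) ↔ z = t1 ∨ z = t2 ∨ z = t3 ∨ z ∈ nb H X t1 := by grind [mem_nb, nb_sub, Clq, Ok]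
    have h3c : t3 ∈ cl H S t1 := by
      refine mem_filter.2 ⟨s3, ?_⟩
      refine eq_of_subset_of_card_le ?_ (by rw [card_insert_of_notMem notMem_nb, card_insert_of_notMem notMem_nb, dg _ m1, dg _ m3])
      intro z hz
      rcases mem_insert.1 hz with rfl | hz
      · grind
      · grind [mem_nb, nb_sub, Clq, Ok]
    refine c.OE s1 (dg _ m1) s2 (dg _ m2) a12 hn ?_ ?_
    · exact (card_pair h13).ge.trans (card_le_card (by
        intro z hz; simp only [mem_insert, mem_singleton] at hz
        rcases hz with rfl | rfl
        · exact cl_self s1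
        · exact h3c))
    · have mm' : ∀ z ∈ (insert t1 (nb H S t1)).erase t2, z = t1 ∨ z = t3 ∨ z ∈ nb H X t1 := by grind [mem_nb, nb_sub, Clq, Ok]
      intro u hu v hv huv
      rcases mm' u hu with k | k | k <;> rcases mm' v hv with l | l | l
      · grind
      · grind
      · rw [k]; exact (mem_nb.1 l).2
      · rw [k, l]; exact a13.symm
      · grind
      · grind [mem_nb, nb_sub, Clq, Ok]
      · rw [l]; exact (mem_nb.1 k).2.symm
      · rw [l]; rw [e] at k; exact (mem_nb.1 k).2.symm
      · exact hc u k v l huv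
  have sub1 : ∀ z ∈ nb H X t1, z ∈ (insert t1 (nb H S t1)).erase t2 := fun z hz =>
    mem_erase.2 ⟨fun e => x2 (e ▸ nb_sub hz), mem_insert_of_mem (mem_nb.2 ⟨hX (nb_sub hz), (mem_nb.1 hz).2⟩)⟩
  rcases c.twn s1 (dg _ m1) s2 a12 (c.cr.ntw s1 s2 a12 hn (by
      have : nb H S t2 \ cl H S t1 ⊆ (nb H S t2).erase t1 := by
        intro z hz
        rw [mem_sdiff] at hz
        exact mem_erase.2 ⟨by rintro rfl; exact hz.2 (cl_self s1), hz.1⟩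
      have := card_le_card this
      rw [card_erase_of_mem (mem_nb.2 ⟨s1, a12.symm⟩), dg _ m2] at this
      omega)) with k | ⟨Y, hY, hvY, hNY, hYt, hYp⟩ | ⟨F, hF, hFc⟩
  · refine fin ?_ (k.mono sub1)
    refine eq_of_subset_of_card_le (fun z hz => mem_nb.2 ⟨nb_sub hz, ?_⟩) (by omega)
    exact k t3 (mem_erase.2 ⟨h23.symm, mem_insert_of_mem (mem_nb.2 ⟨s3, a13⟩)⟩) z (sub1 z hz)
      fun e => x3 (e ▸ nb_sub hz)
  · have hYe : S \ Y = {t2, p, r} := by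
      refine eq_of_subset_of_card_le ?_ ?_
      · intro z hz
        rw [mem_sdiff] at hz
        have t2m : t2 ∈ S \ Y := mem_sdiff.2 ⟨s2, hvY⟩
        by_cases e : z = t2
        · simp [e]
        rcases n2 z hz.1 (hYt.1 t2 t2m z (mem_sdiff.2 hz) (Ne.symm e)) with rfl | rfl | rfl | rfl
        · grind
        · grind [mem_nb, nb_sub, Clq, Ok]
        · simp
        · simp
      · have := hYt.2.1; have := card_le_three (a := t2) (b := p) (c := r); omega
    have mp : p ∈ S \ Y := by rw [hYe]; simp
    have mr : r ∈ S \ Y := by rw [hYe]; simp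
    have apr : H.Adj p r := hYt.1 _ mp _ mr hpr
    have a2p := (mem_nb.1 pm).2
    have a2r := (mem_nb.1 rm).2
    have dp := hYt.2.2 p mp
    have dr := hYt.2.2 r mr
    have pS := hX px
    have rS := hX rx
    have p1' : p ≠ t1 := by grind
    have p2' : p ≠ t2 := by grind
    have p3' : p ≠ t3 := by grind
    have r1' : r ≠ t1 := by grind
    have r2' : r ≠ t2 := by grind
    have r3' : r ≠ t3 := by grind
    obtain ⟨V0, hV0⟩ : ∃ V0, ((((S.erase p).erase r).erase t1).erase t3).erase t2 = V0 := ⟨_, rfl⟩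
    have mV : ∀ z, z ∈ V0 ↔ z ∈ S ∧ z ≠ p ∧ z ≠ r ∧ z ≠ t1 ∧ z ≠ t3 ∧ z ≠ t2 := by grind
    have h2V : t2 ∈ (((S.erase p).erase r).erase t1).erase t3 := by grind
    have hVc : V0.card + 5 = S.card := by grind
    have np : ∀ z ∈ S, H.Adj p z → z = t2 ∨ z = r ∨ z ∈ nb H V0 p := by
      intro z hz e
      by_cases k1 : z = t2
      · exact Or.inl k1
      by_cases k2 : z = r
      · grind
      refine Or.inr (Or.inr (mem_nb.2 ⟨(mV z).2 ⟨hz, e.ne.symm, k2, ?_, ?_, k1⟩, e⟩))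
      · rintro rfl; exact p1 e
      · rintro rfl; exact p3 e
    have nr : ∀ z ∈ S, H.Adj r z → z = t2 ∨ z = p ∨ z ∈ nb H V0 r := by
      intro z hz e
      by_cases k1 : z = t2
      · exact Or.inl k1
      by_cases k2 : z = p
      · grind
      refine Or.inr (Or.inr (mem_nb.2 ⟨(mV z).2 ⟨hz, k2, e.ne.symm, ?_, ?_, k1⟩, e⟩))
      · rintro rfl; exact r1 e
      · rintro rfl; exact r3 e
    have cB : ∀ p r : V, r ≠ p → r ≠ t2 → r ∈ S → (nb H S p).card = 4 → H.Adj p r → H.Adj p t2 → (∀ z ∈ V0, z ≠ r) →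
        (∀ z ∈ S, H.Adj p z → z = t2 ∨ z = r ∨ z ∈ nb H V0 p) → (nb H V0 p).card = 2 := by
      intro p r hpr r2' rS dp apr a2p hVr np
      have e : nb H S p = insert t2 (insert r (nb H V0 p)) := by
        ext z
        simp only [mem_insert]
        constructor
        · intro hz; exact np z (nb_sub hz) (mem_nb.1 hz).2
        · grind [mem_nb, nb_sub, Clq, Ok]
      rw [e, card_insert_of_notMem, card_insert_of_notMem] at dp
      · omega
      · intro k; exact hVr r (nb_sub k) rfl
      · grind [mem_nb, nb_sub, Clq, Ok]
    have cBp := cB p r hpr.symm r2' rS dp apr a2p.symm (fun z hz => ((mV z).1 hz).2.2.1) np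
    have cBr := cB r p hpr p2' pS dr apr.symm a2r.symm (fun z hz => ((mV z).1 hz).2.1) nr
    have AV : ∀ t, (∀ z ∈ nb H X t, z ∉ nb H X t2) → nb H X t ⊆ V0 := by
      intro t d z hz
      have zx := nb_sub hz
      exact (mV z).2 ⟨hX zx, fun e => d z hz (e ▸ pm), fun e => d z hz (e ▸ rm), fun e => x1 (e ▸ zx),
        fun e => x3 (e ▸ zx), fun e => x2 (e ▸ zx)⟩
    have A1 := AV t1 d12
    have A3 := AV t3 d32
    obtain ⟨b1, b1'⟩ := bow2 c h13 hpr.symm h12.symm h23 h2V hV0 hVc A1 c1 c3 nb_sub cBp cBr n1 n3 n2 np nr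
    obtain ⟨b3, b3'⟩ := bow2 c h13.symm hpr.symm h23 h12.symm (by rw [erase_right_comm]; exact h2V)
      (by rw [erase_right_comm (a := t3) (b := t1)]; exact hV0) hVc A3 c3 c1 nb_sub cBp cBr n3 n1
      (fun z hz e => by have := n2 z hz e; tauto) np nr
    by_cases e13 : nb H X t1 = nb H X t3
    · exact fin e13 (b1'.mono subset_union_left)
    have d13 := tx_ed c hX h m1 m3 e13
    have pi := pot_submod 4 H (nb H X t1 ∪ nb H V0 p) (nb H X t3 ∪ nb H V0 p)
    have ei : (nb H X t1 ∪ nb H V0 p) ∩ (nb H X t3 ∪ nb H V0 p) = nb H V0 p := by grind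
    rw [ei, b1'.pot 4, b3'.pot 4, b1, b3] at pi
    have pB := pot_clq_le 4 H (nb H V0 p)
    rw [cBp] at pB
    have VS : V0 ⊆ S := by grind
    have us := union_subset (union_subset A1 (nb_sub (H := H) (v := p))) (union_subset A3 (nb_sub (H := H) (v := p)))
    have := c.LSa (us.trans VS) (by
      have := card_le_card (subset_union_left (s₁ := nb H X t1 ∪ nb H V0 p) (s₂ := nb H X t3 ∪ nb H V0 p)); omega)
      (by have := card_le_card us; omega)
    push_cast at *
    linarith
  · have := (c.spn s1 (dg _ m1) s2 (dg _ m2) a12 hn hcl hF hFc).2.1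
    push_cast at this
    linarith

theorem Ctx.TX (c : Ctx q H S) (hX : X ⊆ S) (h : Ty q H S X) (hp : pot q H X = 2 * (q:ℤ)^2 - 2 * q) : False := by
  have hq := c.hq
  by_cases h5 : 5 ≤ q
  · exact tx5 h5 c hX h hp
  by_cases h3 : q = 3
  · subst h3
    have := h.pot hX; have := c.p1; push_cast at *; omega
  obtain rfl : q = 4 := by omega
  obtain ⟨a, ha, b, hb, hne⟩ := tx_ne c hX h
  have hab : a ≠ b := by grind
  obtain ⟨d, hd⟩ : (((S \ X).erase a).erase b).Nonempty := by
    rw [← card_pos, card_erase_of_mem (mem_erase.2 ⟨hab.symm, hb⟩), card_erase_of_mem ha]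
    have := h.2.1; omega
  simp only [mem_erase] at hd
  have key : ∀ x y z : V, x ∈ S \ X → y ∈ S \ X → z ∈ S \ X → x ≠ y → x ≠ z → y ≠ z → S \ X = {x, y, z} := by
    intro x y z hx hy hz h1 h2 h3
    refine (eq_of_subset_of_card_le ?_ ?_).symm
    · grind
    · rw [card_eq_three.2 ⟨x, y, z, h1, h2, h3, rfl⟩]; have := h.2.1; omega
  have hp' : KY.pot 4 H X = 24 := by rw [hp]; norm_num
  by_cases e : nb H X d = nb H X a
  · exact tx4a c hX h hp' (key a b d ha hb hd.2.2 hab (Ne.symm hd.2.1) (Ne.symm hd.1)) hab (Ne.symm hd.2.1) (Ne.symm hd.1)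
      (tx_ed c hX h ha hb hne) (by rw [e]; exact tx_ed c hX h ha hb hne)
  · exact tx4a c hX h hp' (key b a d hb ha hd.2.2 hab.symm (Ne.symm hd.1) (Ne.symm hd.2.1)) hab.symm (Ne.symm hd.1)
      (Ne.symm hd.2.1) (tx_ed c hX h hb ha hne.symm) (tx_ed c hX h hd.2.2 ha e)

theorem Ctx.emer (c : Ctx q H S) (hv : v ∈ S) (hE : T ⊆ S) (hvE : v ∉ T) (hc : T.card = q) (hcl : Clq H T)
    (h1 : ∀ e ∈ T, (nb H S e).card ≤ q + 1) (h2 : ∀ e ∈ T, ¬ H.Adj v e → (nb H S e).card ≤ q) : False := by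
  have hq := c.hq
  have k : (T.filter fun e => H.Adj v e).card + 2 ≤ q := by
    by_contra hlt
    exact c.dia2 hE hcl hc hv hvE (A := T.filter fun e => H.Adj v e) (filter_subset _ _) (by omega)
      fun e he => (mem_filter.1 he).2
  have k2 := card_filter_add_card_filter_not (s := T) (fun e => H.Adj v e)
  obtain ⟨a, b, ha, hb, hab⟩ := one_lt_card_iff.1 (by omega : 1 < (T.filter fun e => ¬ H.Adj v e).card)
  rw [mem_filter] at ha hb
  exact c.AE2 hE hcl hc subset_rfl (by omega) h1 ha.1 hb.1 hab ((h2 a ha.1 ha.2).antisymm (c.cr.deg (hE ha.1)))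
    ((h2 b hb.1 hb.2).antisymm (c.cr.deg (hE hb.1)))

theorem Ctx.SW (c : Ctx q H S) (hx : x ∈ S) (dx : (nb H S x).card = q) (hv : v ∈ S) (dv : (nb H S v).card = q)
    (hxv : H.Adj x v) (hn : v ∉ cl H S x) (hc : (cl H S v).card ≤ (cl H S x).card) :
    Clq H ((insert x (nb H S x)).erase v) := by
  have hq := c.hq
  rcases c.twn hx dx hv hxv (c.cr.ntw hx hv hxv hn (by
      have : nb H S v \ cl H S x ⊆ (nb H S v).erase x := by
        intro z hz
        rw [mem_sdiff] at hz
        exact mem_erase.2 ⟨by rintro rfl; exact hz.2 (cl_self hx), hz.1⟩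
      have := card_le_card this
      rw [card_erase_of_mem (mem_nb.2 ⟨hx, hxv.symm⟩), dv] at this
      omega)) with k | ⟨Y, hY, hvY, hNY, hYt, hYp⟩ | ⟨F, hF, hFc⟩
  · exact k
  · exact (c.TX hY hYt hYp).elim
  · exfalso
    obtain ⟨ho, -, hag⟩ := c.spn hx dx hv dv hxv hn hc hF hFc
    have hag' : ∀ a ∈ S, ∀ b ∈ S, a ≠ v → b ≠ v → (F.Adj a b ↔ H.Adj a b) := fun a ha b hb h1 h2 =>
      (hag a ha b hb).trans (rwr_adj h1 h2)
    rcases O1 hq ho v hv with ⟨X, hX, hvX, h2, hp⟩ | ⟨E, hE, hvE, hEc, hEq, hd⟩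
    · have e : pot q F X = pot q H X := pot_congr q fun a ha b hb =>
        hag' a (hX ha) b (hX hb) (fun e => hvX (e ▸ ha)) (fun e => hvX (e ▸ hb))
      have := c.S2 X hX h2 (card_lt_card ((Finset.ssubset_iff_subset_ne).2 ⟨hX, fun e => hvX (e ▸ hv)⟩))
      omega
    · have hEv : ∀ e ∈ E, e ≠ v := fun e he k => hvE (k ▸ he)
      refine c.emer hv hE hvE hEc (fun a ha b hb hab => (hag' a (hE ha) b (hE hb) (hEv a ha) (hEv b hb)).1
        (hEq a ha b hb hab)) ?_ ?_
      · intro e he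
        have : nb H S e ⊆ insert v (nb F S e) := by grind [mem_nb, nb_sub, Clq, Ok]
        have := card_le_card this
        have := card_insert_le v (nb F S e)
        have := hd e he
        omega
      · intro e he hve
        rw [← hd e he]
        refine card_le_card fun z hz => ?_
        have k : z ≠ v := by rintro rfl; exact hve (mem_nb.1 hz).2.symm
        exact mem_nb.2 ⟨nb_sub hz, (hag' e (hE he) z (nb_sub hz) (hEv e he) k).2 (mem_nb.1 hz).2⟩

theorem cl_symm (hx : x ∈ S) (h : y ∈ cl H S x) : x ∈ cl H S y := mem_filter.2 ⟨hx, (cl_eq h).symm⟩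

theorem Ctx.LP (c : Ctx q H S) (hx : x ∈ S) (dx : (nb H S x).card = q) (hv : v ∈ S) (dv : (nb H S v).card = q)
    (hxv : H.Adj x v) (hn : v ∉ cl H S x) : (cl H S x).card = 1 ∧ (cl H S v).card = 1 ∧
    Clq H ((insert x (nb H S x)).erase v) ∧ Clq H ((insert v (nb H S v)).erase x) := by
  have key : ∀ x v : V, x ∈ S → (nb H S x).card = q → v ∈ S → (nb H S v).card = q → H.Adj x v → v ∉ cl H S x →
      (cl H S v).card ≤ (cl H S x).card → (cl H S x).card = 1 ∧ (cl H S v).card = 1 ∧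
    Clq H ((insert x (nb H S x)).erase v) ∧ Clq H ((insert v (nb H S v)).erase x) := by
    intro x v hx dx hv dv hxv hn hc
    have k := c.SW hx dx hv dv hxv hn hc
    have k1 : (cl H S x).card < 2 := by
      by_contra hlt
      exact c.OE hx dx hv dv hxv hn (by omega) k
    have k2 : 0 < (cl H S x).card := card_pos.2 ⟨x, cl_self hx⟩
    have k3 : 0 < (cl H S v).card := card_pos.2 ⟨v, cl_self hv⟩
    exact ⟨by omega, by omega, k, c.SW hv dv hx dx hxv.symm (fun e => hn (cl_symm hv e)) (by omega)⟩
  rcases le_total (cl H S v).card (cl H S x).card with h | h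
  · grind
  · obtain ⟨a, b, d, e⟩ := key v x hv dv hx dx hxv.symm (fun e => hn (cl_symm hv e)) h
    exact ⟨b, a, e, d⟩

def Pr (q : ℕ) (H : SimpleGraph V) (S : Finset V) (x y : V) : Prop :=
  x ∈ S ∧ y ∈ S ∧ (nb H S x).card = q ∧ (nb H S y).card = q ∧ H.Adj x y ∧ y ∉ cl H S x

noncomputable def XX (H : SimpleGraph V) (S : Finset V) (x y : V) : Finset V := (insert x (nb H S x)).erase y

theorem Pr.symm (h : Pr q H S x y) : Pr q H S y x :=
  ⟨h.2.1, h.1, h.2.2.2.1, h.2.2.1, h.2.2.2.2.1.symm, fun e => h.2.2.2.2.2 (cl_symm h.2.1 e)⟩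

theorem Pr.clq (h : Pr q H S x y) (c : Ctx q H S) : Clq H (XX H S x y) :=
  (c.LP h.1 h.2.2.1 h.2.1 h.2.2.2.1 h.2.2.2.2.1 h.2.2.2.2.2).2.2.1

theorem Pr.card (h : Pr q H S x y) : (XX H S x y).card = q := by
  have : y ∈ insert x (nb H S x) := mem_insert_of_mem (mem_nb.2 ⟨h.2.1, h.2.2.2.2.1⟩)
  rw [XX, card_erase_of_mem this, card_insert_of_notMem notMem_nb, h.2.2.1]; omega

theorem Pr.sub (h : Pr q H S x y) : XX H S x y ⊆ S := by
  intro z hz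
  rcases mem_insert.1 (mem_of_mem_erase hz) with rfl | k
  · exact h.1
  · exact nb_sub k

theorem Pr.mx (h : Pr q H S x y) : x ∈ XX H S x y := mem_erase.2 ⟨h.2.2.2.2.1.ne, mem_insert_self _ _⟩
theorem Pr.ny : y ∉ XX H S x y := notMem_erase _ _

theorem Pr.mem (hz : z ∈ S) (h : H.Adj x z) (hn : z ≠ y) : z ∈ XX H S x y :=
  mem_erase.2 ⟨hn, mem_insert_of_mem (mem_nb.2 ⟨hz, h⟩)⟩

theorem Pr.hi (h : Pr q H S x y) (c : Ctx q H S) (hz : z ∈ XX H S x y) (hne : z ≠ x) : q + 1 ≤ (nb H S z).card := by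
  by_contra hlt
  have hzS := h.sub hz
  have dz : (nb H S z).card = q := by have := c.cr.deg hzS; omega
  have axz : H.Adj x z := h.clq c x h.mx z hz hne.symm
  by_cases k : z ∈ cl H S x
  · have := (c.LP h.1 h.2.2.1 h.2.1 h.2.2.2.1 h.2.2.2.2.1 h.2.2.2.2.2).1
    obtain ⟨w, hw⟩ := card_eq_one.1 this
    have h1 := cl_self (H := H) h.1
    rw [hw, mem_singleton] at k h1
    exact hne (k.trans h1.symm)
  · have hP : Pr q H S x z := ⟨h.1, hzS, h.2.2.1, dz, axz, k⟩
    refine c.dia2 h.sub (h.clq c) h.card h.2.1 Pr.ny (A := (XX H S x y).erase z) (erase_subset _ _)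
      (by rw [card_erase_of_mem hz, h.card]; omega) fun e he => ?_
    obtain ⟨e1, e2⟩ := mem_erase.1 he
    have hyz : y ≠ z := fun k => Pr.ny (k ▸ hz)
    refine hP.clq c y (Pr.mem h.2.1 h.2.2.2.2.1 hyz) e ?_ (fun k => Pr.ny (k ▸ e2))
    exact mem_erase.2 ⟨e1, mem_of_mem_erase e2⟩

theorem Pr.uniq (h : Pr q H S x y) (c : Ctx q H S) (hz : z ∈ S) (a : H.Adj x z) (dz : (nb H S z).card = q) : z = y := by
  by_contra hne
  have := h.hi c (Pr.mem hz a hne) a.ne.symm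
  omega

theorem pot_low (c : Crit q H S) : pot q H S ≤ q * ((S.filter fun v => (nb H S v).card = q).card : ℤ) - 2 * S.card := by
  unfold pot
  rw [E_sum]
  have : ∑ v ∈ S, ((q:ℤ) + 1 - if (nb H S v).card = q then 1 else 0) ≤ ∑ v ∈ S, ((nb H S v).card : ℤ) := by
    refine sum_le_sum fun v hv => ?_
    have := c.deg hv
    split_ifs with k <;> omega
  rw [sum_sub_distrib, sum_const, nsmul_eq_mul, sum_boole] at this
  have := mul_le_mul_of_nonneg_left this (by positivity : (0:ℤ) ≤ q)
  linarith

theorem il_ar {q m : ℤ} (h1 : 2 ≤ m) (h2 : m + 2 ≤ q) : 2 * q^2 - 2 * q + 4 ≤ m * (q^2 + 2*q - 2 - q*m) := by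
  have := mul_nonneg (mul_nonneg (by linarith : (0:ℤ) ≤ q) (by linarith : (0:ℤ) ≤ m - 2)) (by linarith : 0 ≤ q - 2 - m)
  have := mul_nonneg (by linarith : (0:ℤ) ≤ q - 4) (by linarith : (0:ℤ) ≤ m - 2)
  nlinarith

theorem Ctx.IL (c : Ctx q H S) {x1 x2 y1 y2 : V} (h1 : Pr q H S x1 y1) (h2 : Pr q H S x2 y2) (hne : x1 ≠ x2) :
    (XX H S x1 y1 ∩ XX H S x2 y2).card ≤ 1 := by
  by_contra hlt
  have hq := c.hq
  have n12 : x1 ∉ XX H S x2 y2 := fun k => by have := h2.hi c k hne; have := h1.2.2.1; omega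
  have n21 : x2 ∉ XX H S x1 y1 := fun k => by have := h1.hi c k hne.symm; have := h2.2.2.1; omega
  have c1 := h1.card
  have c2 := h2.card
  have cu := card_union_add_card_inter (XX H S x1 y1) (XX H S x2 y2)
  have lt1 : (XX H S x1 y1 ∩ XX H S x2 y2).card + 1 ≤ q := by
    have : XX H S x1 y1 ∩ XX H S x2 y2 ⊆ (XX H S x1 y1).erase x1 := by grind
    have := card_le_card this
    rw [card_erase_of_mem h1.mx] at this
    omega
  by_cases e : (XX H S x1 y1 ∩ XX H S x2 y2).card + 1 = q
  · exact c.dia2 h1.sub (h1.clq c) c1 h2.1 n21 inter_subset_left e.ge fun z hz => by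
      rw [mem_inter] at hz
      exact h2.clq c x2 h2.mx z hz.2 fun k => n21 (k ▸ hz.1)
  have us := union_subset h1.sub h2.sub
  have pu := pot_submod q H (XX H S x1 y1) (XX H S x2 y2)
  have pi := pot_clq_le q H (XX H S x1 y1 ∩ XX H S x2 y2)
  rw [(h1.clq c).pot, (h2.clq c).pot, c1, c2] at pu
  have ar := il_ar (q := q) (m := (XX H S x1 y1 ∩ XX H S x2 y2).card) (by omega) (by omega)
  have big : S.card ≤ (XX H S x1 y1 ∪ XX H S x2 y2).card + 1 := by
    by_contra hb
    have := c.LSa us (by omega) (by omega)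
    linarith
  have lw : (S.filter fun v => (nb H S v).card = q).card ≤ 3 := by
    have : (S.filter fun v => (nb H S v).card = q) ⊆ {x1, x2} ∪ (S \ (XX H S x1 y1 ∪ XX H S x2 y2)) := by
      intro z hz
      rw [mem_filter] at hz
      by_cases k1 : z ∈ XX H S x1 y1
      · have : z = x1 := by by_contra k; have := h1.hi c k1 k; omega
        simp [this]
      by_cases k2 : z ∈ XX H S x2 y2
      · have : z = x2 := by by_contra k; have := h2.hi c k2 k; omega
        simp [this]
      simp [k1, k2, hz.1]
    have := (card_le_card this).trans (card_union_le _ _)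
    have := card_sdiff_add_card_eq_card us
    have := card_le_two (a := x1) (b := x2)
    omega
  have := pot_low c.cr
  have := c.p1
  have : (q:ℤ) * ((S.filter fun v => (nb H S v).card = q).card : ℤ) ≤ q * 3 :=
    mul_le_mul_of_nonneg_left (by exact_mod_cast lw) (by positivity)
  have := card_le_card us
  omega

theorem Ctx.NN (c : Ctx q H S) (hq5 : 5 ≤ q) (h : Pr q H S x y) (hv : v ∈ XX H S x y) (hvx : v ≠ x) (hvy : ¬ H.Adj v y) :
    q + 2 ≤ (nb H S v).card := by
  by_contra hlt
  have hq := c.hq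
  have hz : (5:ℤ) ≤ q := by exact_mod_cast hq5
  have dv : (nb H S v).card = q + 1 := by have := h.hi c hv hvx; omega
  have hcl := h.clq c
  have hxx := h.mx
  have hcd := h.card
  have hsub := h.sub
  have out := nb_out hcl hsub hv
  set X := XX H S x y with hX
  have oc : (nb H (S \ X) v).card = 2 := by omega
  set N := nb H (S \ X) v with hN
  have axv : H.Adj x v := hcl x hxx v hv hvx.symm
  have axy := h.2.2.2.2.1
  have nbx : ∀ z ∈ S, H.Adj x z → z = y ∨ (z ∈ X ∧ z ≠ x) := by
    intro z hz a
    by_cases k : z = y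
    · exact Or.inl k
    · exact Or.inr ⟨Pr.mem hz a k, a.ne.symm⟩
  have hyX : y ∉ X := Pr.ny
  have nc : ¬ Col q (H ⊔ star y N) (S.erase x) := by
    rintro ⟨ψ, hψ'⟩
    have hψ : Ok H (S.erase x) ψ := hψ'.mono subset_rfl fun _ _ _ _ e => Or.inl e
    have hyN : ∀ w ∈ N, ψ y ≠ ψ w := by
      intro w hw
      have hw' := mem_nb.1 hw
      refine hψ' y (mem_erase.2 ⟨axy.ne.symm, h.2.1⟩) w (mem_erase.2 ⟨?_, (mem_sdiff.1 hw'.1).1⟩)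
        (Or.inr (star_adj_f.2 ⟨?_, hw⟩))
      · grind
      · grind
    by_cases k : ∃ w ∈ X, w ≠ x ∧ ψ w = ψ y
    · obtain ⟨w, hw, hwx, e⟩ := k
      obtain ⟨d, hd⟩ := exists_col (X.erase x) ψ (by rw [card_erase_of_mem hxx, hcd]; omega)
      refine c.cr.nc ⟨_, hψ.upd (c := d) fun z hz => ?_⟩
      rcases nbx z (nb_sub hz) (mem_nb.1 hz).2 with k | ⟨k, k'⟩
      · grind
      · grind
    · push Not at k
      have hyv : y ≠ v := by grind
      have k1 : Ok H (S.erase x) (Function.update ψ v (ψ y)) := by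
        refine Ok.upd (hψ.mono (erase_subset _ _) fun _ _ _ _ e => e) fun z hz => ?_
        obtain ⟨z1, z2⟩ := mem_nb.1 hz
        obtain ⟨z3, z4⟩ := mem_erase.1 z1
        by_cases zX : z ∈ X
        · exact k z zX z3
        · grind [mem_nb, nb_sub, Clq, Ok]
      refine c.cr.nc ⟨_, k1.upd (c := ψ v) fun z hz => ?_⟩
      rcases nbx z (nb_sub hz) (mem_nb.1 hz).2 with l | ⟨l, l'⟩
      · grind
      · grind [mem_nb, nb_sub, Clq, Ok]
  obtain ⟨S', hS', F, hF, hFc⟩ := extract nc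
  have hS'S := hS'.trans (erase_subset x S)
  have hxS' : x ∉ S' := by grind
  have ec := card_erase_add_one h.1
  have sc := card_le_card hS'
  have lo := c.le hFc (by omega)
  have ps : ∀ J ≤ H ⊔ star y N, pot q H S' ≤ pot q J S' + 2 * q * 2 := by
    intro J hJ
    have := pot_of_star (q := q) (H := H) (S := S') (u := y) (A := N) hJ
    have k : (N ∩ S').card ≤ 2 := oc ▸ card_le_card inter_subset_left
    have : (2:ℤ) * q * ((N ∩ S').card : ℤ) ≤ 2 * q * 2 := mul_le_mul_of_nonneg_left (by exact_mod_cast k) (by positivity)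
    linarith
  have pF := ps F hF
  have qq := mul_nonneg (by linarith : (0:ℤ) ≤ q) (by linarith : (0:ℤ) ≤ q - 5)
  have fc := hFc.card (by omega)
  by_cases e : S'.card + 2 ≤ S.card
  · rcases c.LS S' hS'S (by omega) e (by linarith) with ⟨k, -⟩ | k
    · omega
    · obtain ⟨z, hz⟩ : (((S \ S').erase x).erase y).Nonempty := by
        rw [← card_pos]
        have := k.2.1
        have := pred_card_le_card_erase (s := S \ S') (a := x)
        have := pred_card_le_card_erase (s := (S \ S').erase x) (a := y)
        omega
      obtain ⟨z1, z2, z3⟩ : z ≠ y ∧ z ≠ x ∧ z ∈ S \ S' := by simpa only [mem_erase] using hz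
      exact z1 (h.uniq c (mem_sdiff.1 z3).1 (k.1 x (mem_sdiff.2 ⟨h.1, hxS'⟩) z z3 z2.symm) (k.2.2 z z3))
  · obtain rfl : S' = S.erase x := eq_of_subset_of_card_le hS' (by omega)
    have pe := pot_erase q H h.1
    rw [h.2.2.1] at pe
    have p1 := c.p1
    rcases c.sm hFc (Or.inl (by omega)) with ⟨ho, hpo⟩ | ⟨-, k⟩
    · rcases pot_gap q (S := S.erase x) (F := F) (J := H ⊔ star y N) (fun a _ b _ e => hF e) with hag | hg
      · have hag' : ∀ a ∈ S.erase x, ∀ b ∈ S.erase x, a ≠ y → b ≠ y → (F.Adj a b ↔ H.Adj a b) := by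
          intro a ha b hb ay b_y
          rw [hag a ha b hb]
          exact ⟨fun e => e.resolve_right (star_adj_ne ay b_y), Or.inl⟩
        rcases O1 hq ho y (mem_erase.2 ⟨axy.ne.symm, h.2.1⟩) with ⟨Y, hY, hyY, h2, hp⟩ | ⟨E, hE, hyE, hEc, hEq, hd⟩
        · have e : pot q F Y = pot q H Y := pot_congr q fun a ha b hb =>
            hag' a (hY ha) b (hY hb) (fun e => hyY (e ▸ ha)) (fun e => hyY (e ▸ hb))
          have := c.S2 Y (hY.trans (erase_subset _ _)) h2 (by have := card_le_card hY; omega)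
          omega
        · have hEy : ∀ e ∈ E, e ≠ y := fun e he k => hyE (k ▸ he)
          have hEx : x ∉ E := by grind
          have inF : ∀ e ∈ E, ∀ z ∈ nb H S e, z ≠ x → z ∈ nb F (S.erase x) e := by grind [mem_nb, nb_sub, Clq, Ok]
          refine c.emer h.1 (hE.trans (erase_subset _ _)) hEx hEc (fun a ha b hb hab =>
            (hag' a (hE ha) b (hE hb) (hEy a ha) (hEy b hb)).1 (hEq a ha b hb hab)) ?_ ?_
          · intro e he
            have : nb H S e ⊆ insert x (nb F (S.erase x) e) := by grind
            have := card_le_card this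
            have := card_insert_le x (nb F (S.erase x) e)
            have := hd e he
            omega
          · intro e he hve
            rw [← hd e he]
            refine card_le_card fun z hz => inF e he z hz ?_
            rintro rfl; exact hve (mem_nb.1 hz).2.symm
      · have := ps _ le_rfl
        linarith
    · linarith

theorem kp (O : V → V → Prop) (d : Fin q) : ∀ (n : ℕ) (U : Finset V) (L : V → Finset (Fin q)), U.card ≤ n →
    (∀ v ∈ U, (U.filter (O v)).card < (L v).card) →
    (∀ W ⊆ U, ∃ K ⊆ W, (∀ u ∈ K, ∀ v ∈ K, ¬ H.Adj u v) ∧ ∀ v ∈ W, v ∉ K → ∃ u ∈ K, O v u) →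
    ∃ f : V → Fin q, (∀ v ∈ U, f v ∈ L v) ∧ Ok H U f := by
  intro n
  induction n with
  | zero =>
    intro U L hU h _
    obtain rfl := card_eq_zero.1 (Nat.le_zero.1 hU)
    exact ⟨fun _ => d, by simp, fun u hu => by simp at hu⟩
  | succ n ih =>
    intro U L hU h hK
    rcases U.eq_empty_or_nonempty with rfl | ⟨v0, hv0⟩
    · exact ⟨fun _ => d, by simp, fun u hu => by simp at hu⟩
    obtain ⟨c, hc⟩ : (L v0).Nonempty := card_pos.1 (by have := h v0 hv0; omega)
    obtain ⟨K, hKW, hKi, hKa⟩ := hK (U.filter fun v => c ∈ L v) (filter_subset _ _)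
    have hKU : K ⊆ U := hKW.trans (filter_subset _ _)
    have hKn : K.Nonempty := by grind
    have cu := card_sdiff_add_card_eq_card hKU
    have ck := hKn.card_pos
    obtain ⟨f, f1, f2⟩ := ih (U \ K) (fun v => (L v).erase c) (by omega) (by
      intro v hv
      rw [mem_sdiff] at hv
      have k0 : (U \ K).filter (O v) ⊆ U.filter (O v) := filter_subset_filter _ sdiff_subset
      have k1 := h v hv.1
      by_cases k : c ∈ L v
      · obtain ⟨u, hu, hO⟩ := hKa v (mem_filter.2 ⟨hv.1, k⟩) hv.2
        have : (U \ K).filter (O v) ⊂ U.filter (O v) := by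
          refine (Finset.ssubset_iff_of_subset k0).2 ⟨u, mem_filter.2 ⟨hKU hu, hO⟩, ?_⟩
          simp [hu]
        have := card_lt_card this
        rw [card_erase_of_mem k]; omega
      · rw [erase_eq_of_notMem k]
        exact (card_le_card k0).trans_lt k1) (fun W hW => hK W (hW.trans sdiff_subset))
    refine ⟨fun v => if v ∈ K then c else f v, ?_, ?_⟩
    · grind
    · grind [mem_nb, nb_sub, Clq, Ok]

theorem kern (O : V → V → Prop) {I B : Finset V} (hI : ∀ u ∈ I, ∀ v ∈ I, ¬ H.Adj u v)
    (hB : ∀ u ∈ B, ∀ v ∈ B, H.Adj u v → O u v) (hO : ∀ u v, O u v → H.Adj u v)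
    (hIB : ∀ u ∈ I, ∀ v ∈ B, H.Adj u v → O u v ∨ O v u) : ∀ (n : ℕ), ∀ W ⊆ I ∪ B, W.card ≤ n →
    ∃ K ⊆ W, (∀ u ∈ K, ∀ v ∈ K, ¬ H.Adj u v) ∧ ∀ v ∈ W, v ∉ K → ∃ u ∈ K, O v u := by
  intro n
  induction n with
  | zero =>
    intro W _ hc
    obtain rfl := card_eq_zero.1 (Nat.le_zero.1 hc)
    exact ⟨∅, by simp⟩
  | succ n ih =>
    intro W hW hc
    by_cases k : ∀ v ∈ W, v ∉ I → ∃ u ∈ W ∩ I, O v u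
    · exact ⟨W ∩ I, inter_subset_left, fun u hu v hv => hI u (mem_inter.1 hu).2 v (mem_inter.1 hv).2,
        fun v hv hn => k v hv fun hvI => hn (mem_inter.2 ⟨hv, hvI⟩)⟩
    · push Not at k
      obtain ⟨v, hv, hvI, hk⟩ := k
      have hvB : v ∈ B := by grind
      have hss : (W.filter fun w => w ≠ v ∧ ¬ H.Adj v w) ⊂ W :=
        (Finset.ssubset_iff_of_subset (filter_subset _ _)).2 ⟨v, hv, by simp⟩
      obtain ⟨K, k1, k2, k3⟩ := ih (W.filter fun w => w ≠ v ∧ ¬ H.Adj v w) ((filter_subset _ _).trans hW)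
        (by have := card_lt_card hss; omega)
      refine ⟨insert v K, insert_subset hv (k1.trans (filter_subset _ _)), ?_, ?_⟩
      · intro a ha b hb
        rcases mem_insert.1 ha with rfl | ha' <;> rcases mem_insert.1 hb with rfl | hb'
        · exact fun e => e.ne rfl
        · grind
        · exact fun e => (mem_filter.1 (k1 ha')).2.2 e.symm
        · exact k2 a ha' b hb'
      · intro w hw hwn
        rw [mem_insert, not_or] at hwn
        by_cases e : H.Adj v w
        · refine ⟨v, mem_insert_self _ _, ?_⟩
          rcases mem_union.1 (hW hw) with l | l
          · exact (hIB w l v hvB e.symm).resolve_right (hk w (mem_inter.2 ⟨hw, l⟩))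
          · exact hB w l v hvB e.symm
        · grind

noncomputable def MM (H : SimpleGraph V) (I B : Finset V) : Finset (V × V) := (I ×ˢ B).filter fun p => H.Adj p.1 p.2

theorem mem_MM {I : Finset V} {p : V × V} : p ∈ MM H I B ↔ (p.1 ∈ I ∧ p.2 ∈ B) ∧ H.Adj p.1 p.2 := by
  simp [MM, mem_filter]

theorem MM_card (I : Finset V) : (MM H I B).card = ∑ v ∈ I, (nb H B v).card := by
  rw [MM, card_filter, sum_product]
  refine sum_congr rfl fun v _ => ?_
  rw [nb, card_filter]

set_option maxHeartbeats 1000000 in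
theorem TTn (c : Crit q H S) (hq : 0 < q) : ∀ (n : ℕ) (I B : Finset V), I.card + B.card ≤ n → I ⊆ S → B ⊆ S →
    (∀ v ∈ I, (nb H S v).card = q) → (∀ v ∈ B, (nb H S v).card = q + 1) → (∀ u ∈ I, ∀ v ∈ I, ¬ H.Adj u v) →
    (MM H I B).card ≤ I.card + 2 * B.card := by
  intro n
  induction n with
  | zero =>
    intro I B h _ _ _ _ _
    obtain rfl := card_eq_zero.1 (by omega : I.card = 0)
    simp [MM]
  | succ n ih =>
    intro I B hn hI hB dI dB ind
    by_contra hlt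
    have dis : ∀ v ∈ I, v ∉ B := by grind
    let D : Finset (V × Bool) := I ×ˢ {false} ∪ B ×ˢ univ
    let tt : {d // d ∈ D} → Finset (V × V) := fun d => (MM H I B).filter fun p => p.1 = d.1.1 ∨ p.2 = d.1.1
    have hall : ∃ g : {d // d ∈ D} → V × V, Function.Injective g ∧ ∀ d, g d ∈ tt d := by
      refine (Finset.all_card_le_biUnion_card_iff_exists_injective tt).1 fun Jf => ?_
      rcases Jf.eq_empty_or_nonempty with rfl | hJ
      · simp
      let I' := I.filter fun v => ∃ d ∈ Jf, d.1.1 = v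
      let B' := B.filter fun v => ∃ d ∈ Jf, d.1.1 = v
      have hI' : I' ⊆ I := filter_subset _ _
      have hB' : B' ⊆ B := filter_subset _ _
      have cI := card_sdiff_add_card_eq_card hI'
      have cB := card_sdiff_add_card_eq_card hB'
      have k1 : Jf.card ≤ I'.card + 2 * B'.card := by
        have : Jf.map ⟨Subtype.val, Subtype.val_injective⟩ ⊆ I' ×ˢ {false} ∪ B' ×ˢ univ := by
          intro p hp
          obtain ⟨d, hd, rfl⟩ := mem_map.1 hp
          have hdD := d.2
          simp only [D, mem_union, mem_product] at hdD
          simp only [mem_union, mem_product, Function.Embedding.coeFn_mk, I', B', mem_filter]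
          rcases hdD with k | k
          · exact Or.inl ⟨⟨k.1, d, hd, rfl⟩, k.2⟩
          · exact Or.inr ⟨⟨k.1, d, hd, rfl⟩, k.2⟩
        have := (card_le_card this).trans (card_union_le _ _)
        rw [card_map, card_product, card_product, card_singleton, card_univ, Fintype.card_bool] at this
        omega
      have k2 : MM H I B ⊆ Jf.biUnion tt ∪ MM H (I \ I') (B \ B') := by
        intro p hp
        have hp' := mem_MM.1 hp
        by_cases e1 : p.1 ∈ I'
        · obtain ⟨d, hd, e⟩ := (mem_filter.1 e1).2
          exact mem_union_left _ (mem_biUnion.2 ⟨d, hd, mem_filter.2 ⟨hp, Or.inl e.symm⟩⟩)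
        by_cases e2 : p.2 ∈ B'
        · obtain ⟨d, hd, e⟩ := (mem_filter.1 e2).2
          exact mem_union_left _ (mem_biUnion.2 ⟨d, hd, mem_filter.2 ⟨hp, Or.inr e.symm⟩⟩)
        exact mem_union_right _ (mem_MM.2 ⟨⟨mem_sdiff.2 ⟨hp'.1.1, e1⟩, mem_sdiff.2 ⟨hp'.1.2, e2⟩⟩, hp'.2⟩)
      have k3 := (card_le_card k2).trans (card_union_le _ _)
      have k4 := hJ.card_pos
      have k5 := ih (I \ I') (B \ B') (by omega) (sdiff_subset.trans hI) (sdiff_subset.trans hB)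
        (fun v hv => dI v (mem_sdiff.1 hv).1) (fun v hv => dB v (mem_sdiff.1 hv).1)
        (fun u hu v hv => ind u (mem_sdiff.1 hu).1 v (mem_sdiff.1 hv).1)
      omega
    obtain ⟨g, gi, gt⟩ := hall
    let asg : V → V → Prop := fun u v => ∃ d : {d // d ∈ D}, d.1.1 = u ∧ (g d = (u, v) ∨ g d = (v, u))
    let O : V → V → Prop := fun u v => H.Adj u v ∧ ¬ asg u v
    have gM : ∀ d, g d ∈ MM H I B := by grind
    have as1 : ∀ u v, asg u v → (u ∈ I ∧ v ∈ B) ∨ (v ∈ I ∧ u ∈ B) := by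
      rintro u v ⟨d, -, e | e⟩
      · have := mem_MM.1 (gM d); rw [e] at this; exact Or.inl this.1
      · have := mem_MM.1 (gM d); rw [e] at this; exact Or.inr this.1
    have as2 : ∀ u v, u ≠ v → asg u v → asg v u → False := by
      rintro u v hne ⟨d, hd, e⟩ ⟨d', hd', e'⟩
      have k1 := mem_MM.1 (gM d)
      have k2 := mem_MM.1 (gM d')
      have : g d = g d' := by grind
      have := gi this
      subst this
      exact hne (hd.symm.trans hd')
    let U := I ∪ B
    have hUS : U ⊆ S := union_subset hI hB
    have hUn : U.Nonempty := by
      obtain ⟨p, hp⟩ : (MM H I B).Nonempty := card_pos.1 (by omega)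
      exact ⟨p.1, mem_union_left _ (mem_MM.1 hp).1.1⟩
    obtain ⟨ψ, hψ⟩ := c.sub (T := S \ U) sdiff_subset (by
      intro e
      obtain ⟨u, hu⟩ := hUn
      have := hUS hu
      rw [← e, mem_sdiff] at this
      exact this.2 hu)
    have od : ∀ v, (U.filter (O v)).card + (U.filter fun w => H.Adj v w ∧ asg v w).card ≤ (nb H U v).card := by
      intro v
      rw [← card_union_of_disjoint]
      · refine card_le_card fun w hw => ?_
        rcases mem_union.1 hw with k | k
        · grind [mem_nb, nb_sub, Clq, Ok]
        · grind [mem_nb, nb_sub, Clq, Ok]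
      · rw [Finset.disjoint_left]
        intro w h1 h2
        exact (mem_filter.1 h1).2.2 (mem_filter.1 h2).2.2
    let L : V → Finset (Fin q) := fun v => univ \ (nb H (S \ U) v).image ψ
    have Lc : ∀ v, q ≤ (L v).card + (nb H (S \ U) v).card := by
      intro v
      have := card_sdiff_add_card_eq_card (subset_univ ((nb H (S \ U) v).image ψ))
      rw [card_univ, Fintype.card_fin] at this
      have := card_image_le (s := nb H (S \ U) v) (f := ψ)
      show q ≤ (univ \ (nb H (S \ U) v).image ψ).card + _
      omega
    obtain ⟨f, f1, f2⟩ := kp (H := H) O ⟨0, hq⟩ U.card U L le_rfl (by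
      intro v hv
      have ns := nb_split H hUS v
      have := Lc v
      have od' := od v
      rcases mem_union.1 hv with k | k
      · have : 0 < (U.filter fun w => H.Adj v w ∧ asg v w).card := by
          let d : {d // d ∈ D} := ⟨(v, false), by simp [D, k]⟩
          have gd := mem_filter.1 (gt d)
          have gm := mem_MM.1 gd.1
          have e1 : (g d).1 = v := by grind
          refine card_pos.2 ⟨(g d).2, mem_filter.2 ⟨mem_union_right _ gm.1.2, e1 ▸ gm.2, d, rfl, Or.inl ?_⟩⟩
          exact Prod.ext e1 rfl
        have := dI v k
        refine lt_of_le_of_lt (le_of_eq (by congr)) (show (U.filter (O v)).card < _ by omega)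
      · have : 1 < (U.filter fun w => H.Adj v w ∧ asg v w).card := by
          let d : Bool → {d // d ∈ D} := fun b => ⟨(v, b), by simp [D, k]⟩
          have e1 : ∀ b, (g (d b)).2 = v := by
            intro b
            have gd := mem_filter.1 (gt (d b))
            have gm := mem_MM.1 gd.1
            rcases gd.2 with e | e
            · grind
            · exact e
          have mm : ∀ b, (g (d b)).1 ∈ U.filter fun w => H.Adj v w ∧ asg v w := by
            intro b
            have gm := mem_MM.1 (gM (d b))
            refine mem_filter.2 ⟨mem_union_left _ gm.1.1, ?_, d b, rfl, Or.inr (Prod.ext rfl (e1 b))⟩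
            have := gm.2.symm
            rwa [e1 b] at this
          refine one_lt_card.2 ⟨_, mm false, _, mm true, fun e => ?_⟩
          have := gi (Prod.ext e ((e1 false).trans (e1 true).symm) : g (d false) = g (d true))
          simp [d] at this
        have := dB v k
        refine lt_of_le_of_lt (le_of_eq (by congr)) (show (U.filter (O v)).card < _ by omega)) (fun W hW => kern O ind (fun u hu v hv e => ⟨e, fun k => by
            rcases as1 u v k with l | l
            · exact dis u l.1 hu
            · exact dis v l.1 hv⟩) (fun u v e => e.1) (fun u hu v hv e => by
            by_cases k : asg u v
            · exact Or.inr ⟨e.symm, fun l => as2 u v e.ne k l⟩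
            · exact Or.inl ⟨e, k⟩) W.card W hW le_rfl)
    have cross : ∀ u ∈ U, ∀ v ∈ S, v ∉ U → H.Adj u v → f u ≠ ψ v := by grind [mem_nb, nb_sub, Clq, Ok]
    refine c.nc ⟨fun v => if v ∈ U then f v else ψ v, fun u hu v hv e => ?_⟩
    by_cases k : u ∈ U <;> by_cases l : v ∈ U <;> simp only [k, l, if_true, if_false]
    · exact f2 u k v l e
    · grind
    · exact (cross v l u hu k e.symm).symm
    · grind [mem_nb, nb_sub, Clq, Ok]

theorem Crit.TT (c : Crit q H S) (hq : 0 < q) {I : Finset V} (hI : I ⊆ S) (hB : B ⊆ S)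
    (dI : ∀ v ∈ I, (nb H S v).card = q) (dB : ∀ v ∈ B, (nb H S v).card = q + 1)
    (ind : ∀ u ∈ I, ∀ v ∈ I, ¬ H.Adj u v) : ∑ v ∈ I, (nb H B v).card ≤ I.card + 2 * B.card := by
  rw [← MM_card]; exact TTn c hq _ I B le_rfl hI hB dI dB ind

theorem spread {r : V → ℚ} (hX : X ⊆ S) (hr : ∀ v ∈ B, 0 ≤ r v) :
    ∑ x ∈ X, ∑ v ∈ nb H B x, r v ≤ ∑ v ∈ B, ((nb H S v).card : ℚ) * r v := by
  have : ∑ x ∈ X, ∑ v ∈ nb H B x, r v = ∑ v ∈ B, ((nb H X v).card : ℚ) * r v := by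
    simp only [nb, sum_filter]
    rw [sum_comm]
    refine sum_congr rfl fun v _ => ?_
    rw [card_filter, Nat.cast_sum, sum_mul]
    refine sum_congr rfl fun x _ => ?_
    simp only [H.adj_comm x v]
    split_ifs <;> simp
  rw [this]
  refine sum_le_sum fun v hv => mul_le_mul_of_nonneg_right ?_ (hr v hv)
  exact_mod_cast card_le_card fun u hu => mem_nb.2 ⟨hX (mem_nb.1 hu).1, (mem_nb.1 hu).2⟩

noncomputable def rr (q : ℕ) (H : SimpleGraph V) (S : Finset V) (v : V) : ℚ :=
  q - ((q:ℚ)^2 + q - 2) / ((nb H S v).card : ℚ)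

theorem rr_ge (hq : 3 ≤ q) {d : ℕ} (hd : 0 < d) (h : d ≤ (nb H S v).card) :
    (q:ℚ) - ((q:ℚ)^2 + q - 2) / d ≤ rr q H S v := by
  unfold rr
  have h3 : (3:ℚ) ≤ q := by exact_mod_cast hq
  have h1 : (0:ℚ) < d := by exact_mod_cast hd
  have h2 : (d:ℚ) ≤ (nb H S v).card := by exact_mod_cast h
  have : ((q:ℚ)^2 + q - 2) / ((nb H S v).card : ℚ) ≤ ((q:ℚ)^2 + q - 2) / d :=
    div_le_div_of_nonneg_left (by nlinarith) h1 h2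
  linarith

theorem rr_mul (h : 0 < (nb H S v).card) :
    ((nb H S v).card : ℚ) * rr q H S v = q * ((nb H S v).card : ℚ) - ((q:ℚ)^2 + q - 2) := by
  unfold rr
  have h1 : ((nb H S v).card : ℚ) ≠ 0 := by exact_mod_cast h.ne'
  field_simp

theorem rr_nn (hq : 3 ≤ q) (h : q + 1 ≤ (nb H S v).card) : 0 ≤ rr q H S v := by
  have := rr_ge (H := H) (S := S) (v := v) hq (d := q + 1) (by omega) h
  have h1 : (0:ℚ) < q + 1 := by positivity
  have : ((q:ℚ)^2 + q - 2) / ((q + 1 : ℕ) : ℚ) ≤ q := by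
    push_cast
    rw [div_le_iff₀ h1]; nlinarith
  linarith

noncomputable def lw (q : ℕ) (H : SimpleGraph V) (S : Finset V) : Finset V := S.filter fun v => (nb H S v).card = q

theorem mem_lw : v ∈ lw q H S ↔ v ∈ S ∧ (nb H S v).card = q := mem_filter

theorem Ctx.disch (c : Ctx q H S) (hB : B ⊆ S) (dB : ∀ v ∈ B, (nb H S v).card = q + 1) (hC : C ⊆ S)
    (dC : ∀ v ∈ C, q + 1 ≤ (nb H S v).card) (dis : Disjoint B C)
    (hun : ∀ v ∈ S, (nb H S v).card ≠ q → v ∈ B ∨ v ∈ C) :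
    2 * (B.card : ℚ) + ∑ x ∈ lw q H S, (∑ v ∈ nb H C x, rr q H S v - (q - 2)) < 0 := by
  have hq := c.hq
  have k1 := spread (H := H) (B := C) (r := rr q H S) (filter_subset _ _ : lw q H S ⊆ S) fun v hv => rr_nn hq (dC v hv)
  have d1 : Disjoint (lw q H S) B := Finset.disjoint_left.2 fun v h1 h2 => by
    have := (mem_lw.1 h1).2; have := dB v h2; omega
  have d2 : Disjoint (lw q H S ∪ B) C := by
    rw [disjoint_union_left]
    refine ⟨Finset.disjoint_left.2 fun v h1 h2 => ?_, dis⟩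
    have := (mem_lw.1 h1).2; have := dC v h2; omega
  have e : S = (lw q H S ∪ B) ∪ C := by
    ext v
    simp only [mem_union, mem_lw]
    constructor
    · grind
    · grind
  have hp : (pot q H S : ℚ) = ∑ v ∈ S, (((q:ℚ)^2 + q - 2) - q * ((nb H S v).card : ℚ)) := by
    unfold pot
    rw [E_sum, sum_sub_distrib, ← mul_sum, sum_const, nsmul_eq_mul]
    push_cast; ring
  have s1 : ∑ v ∈ C, ((nb H S v).card : ℚ) * rr q H S v = - ∑ v ∈ C, (((q:ℚ)^2 + q - 2) - q * ((nb H S v).card : ℚ)) := by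
    rw [← sum_neg_distrib]
    refine sum_congr rfl fun v hv => ?_
    rw [rr_mul (by have := dC v hv; omega)]; ring
  have s2 : ∑ v ∈ B, (((q:ℚ)^2 + q - 2) - q * ((nb H S v).card : ℚ)) = -2 * (B.card:ℚ) := by
    have : ∀ v ∈ B, (((q:ℚ)^2 + q - 2) - q * ((nb H S v).card : ℚ)) = -2 := fun v hv => by
      rw [dB v hv]; push_cast; ring
    rw [sum_congr rfl this, sum_const, nsmul_eq_mul]; ring
  have s3 : ∑ v ∈ lw q H S, (((q:ℚ)^2 + q - 2) - q * ((nb H S v).card : ℚ)) = ((q:ℚ) - 2) * ((lw q H S).card:ℚ) := by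
    have : ∀ v ∈ lw q H S, (((q:ℚ)^2 + q - 2) - q * ((nb H S v).card : ℚ)) = q - 2 := fun v hv => by
      rw [(mem_lw.1 hv).2]; ring
    rw [sum_congr rfl this, sum_const, nsmul_eq_mul]; ring
  have s4 : ∑ v ∈ S, (((q:ℚ)^2 + q - 2) - q * ((nb H S v).card : ℚ)) =
      ((q:ℚ) - 2) * ((lw q H S).card:ℚ) + -2 * (B.card:ℚ) + ∑ v ∈ C, (((q:ℚ)^2 + q - 2) - q * ((nb H S v).card : ℚ)) := by
    rw [← s2, ← s3, ← sum_union d1, ← sum_union d2, ← e]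
  have p1 : (0:ℤ) < pot q H S := by have := c.p1; have := c.hz; linarith
  have p1' : (0:ℚ) < pot q H S := by exact_mod_cast p1
  rw [sum_sub_distrib, sum_const, nsmul_eq_mul]
  change ∑ x ∈ lw q H S, _ ≤ _ at k1
  linarith

theorem Ctx.tm (c : Ctx q H S) (hx : x ∈ S) (dx : (nb H S x).card = q) : (cl H S x).card + 2 ≤ q := by
  by_contra hlt
  have hsub : cl H S x ⊆ insert x (nb H S x) := fun y hy => by rw [← cl_eq hy]; exact mem_insert_self _ _
  have hT : insert x (nb H S x) ⊆ S := insert_subset hx nb_sub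
  have hc : (insert x (nb H S x)).card = q + 1 := by rw [card_insert_of_notMem notMem_nb, dx]
  have h2 : (insert x (nb H S x) \ cl H S x).card ≤ 2 := by rw [card_sdiff_of_subset hsub]; omega
  obtain ⟨u, v, huv⟩ : ∃ u v, ∀ e ∈ insert x (nb H S x) \ cl H S x, e = u ∨ e = v := by
    by_contra hn
    push Not at hn
    obtain ⟨a, ha, -⟩ := hn x x
    obtain ⟨b, hb, hba, -⟩ := hn a a
    obtain ⟨d, hd, hda, hdb⟩ := hn a b
    have := two_lt_card.2 ⟨a, ha, b, hb, d, hd, hba.symm, hda.symm, hdb.symm⟩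
    omega
  have key : ∀ a ∈ cl H S x, ∀ b ∈ insert x (nb H S x), a ≠ b → H.Adj a b := by
    intro a ha b hb hne
    rw [← cl_eq ha, mem_insert, mem_nb] at hb
    exact (hb.resolve_left hne.symm).2
  refine c.dia (u := u) (v := v) hT hc fun a ha b hb hne => ?_
  by_cases k : a ∈ cl H S x
  · grind
  by_cases l : b ∈ cl H S x
  · exact Or.inl (key b l a ha hne.symm).symm
  right
  rcases huv a (mem_sdiff.2 ⟨ha, k⟩) with e1 | e1 <;> rcases huv b (mem_sdiff.2 ⟨hb, l⟩) with e2 | e2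
  · grind
  · grind
  · grind
  · grind

theorem Ctx.LR (c : Ctx q H S) (hx : x ∈ S) (dx : (nb H S x).card = q) (ht : 2 ≤ (cl H S x).card)
    (dC : ∀ v ∈ C, q + 1 ≤ (nb H S v).card) (hC : ∀ v ∈ S, q + 2 ≤ (nb H S v).card → v ∈ C) :
    0 ≤ ∑ v ∈ nb H C x, rr q H S v - ((q:ℚ) - 2) := by
  have hq := c.hq
  have tm := c.tm hx dx
  set t := (cl H S x).card with hte
  have hT : insert x (nb H S x) ⊆ S := insert_subset hx nb_sub
  have hc : (insert x (nb H S x)).card = q + 1 := by rw [card_insert_of_notMem notMem_nb, dx]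
  have ex : ((nb H S x).filter fun v => q < (nb H S v).card ∧ (nb H S v).card < q + t).card ≤ 1 := by
    by_contra hlt
    obtain ⟨v, hv, w, hw, hne⟩ := one_lt_card.1 (not_le.1 hlt)
    rw [mem_filter, mem_nb] at hv hw
    have m1 := c.M hx dx hv.1.1 hv.1.2 hv.2.1 hv.2.2
    have m2 := c.M hx dx hw.1.1 hw.1.2 hw.2.1 hw.2.2
    refine c.dia (u := v) (v := w) hT hc fun a ha b hb hab => ?_
    by_cases k1 : a = v
    · grind [mem_nb, nb_sub, Clq, Ok]
    · grind [mem_nb, nb_sub, Clq, Ok]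
  have cov : nb H S x ⊆ (cl H S x).erase x ∪ ((nb H S x).filter fun v => q < (nb H S v).card ∧ (nb H S v).card < q + t)
      ∪ (nb H S x).filter fun v => q + t ≤ (nb H S v).card := by
    intro v hv
    have hv' := mem_nb.1 hv
    simp only [mem_union, mem_erase, mem_filter]
    by_cases k : v ∈ cl H S x
    · grind
    by_cases l : q + t ≤ (nb H S v).card
    · grind
    refine Or.inl (Or.inr ⟨hv, ?_, by omega⟩)
    refine lt_of_le_of_ne (c.cr.deg hv'.1) fun e => ?_
    have := (c.LP hx dx hv'.1 e.symm hv'.2 k).1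
    omega
  have k1 := (card_le_card cov).trans ((card_union_le _ _).trans (Nat.add_le_add_right (card_union_le _ _) _))
  rw [card_erase_of_mem (cl_self hx), dx] at k1
  have hi : q ≤ t + ((nb H S x).filter fun v => q + t ≤ (nb H S v).card).card := by omega
  have hsub : ((nb H S x).filter fun v => q + t ≤ (nb H S v).card) ⊆ nb H C x := by grind [mem_nb, nb_sub, Clq, Ok]
  have l1 := sum_le_sum_of_subset_of_nonneg hsub (f := rr q H S) fun v hv _ => rr_nn hq (dC v (mem_nb.1 hv).1)
  have l2 := card_nsmul_le_sum ((nb H S x).filter fun v => q + t ≤ (nb H S v).card) (rr q H S)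
    ((q:ℚ) - ((q:ℚ)^2 + q - 2) / (q + t : ℕ)) fun v hv => rr_ge hq (by omega) (mem_filter.1 hv).2
  rw [nsmul_eq_mul] at l2
  have qz : (3:ℚ) ≤ q := by exact_mod_cast hq
  have tz : (2:ℚ) ≤ t := by exact_mod_cast ht
  have tq : (t:ℚ) + 2 ≤ q := by exact_mod_cast tm
  have hz : (q:ℚ) ≤ t + ((nb H S x).filter fun v => q + t ≤ (nb H S v).card).card := by exact_mod_cast hi
  have e : (q:ℚ) - ((q:ℚ)^2 + q - 2) / (q + t : ℕ) = (q * (t - 1) + 2) / (q + t) := by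
    push_cast; field_simp; ring
  have pos : (0:ℚ) ≤ (q * (t - 1) + 2) / (q + t) := by
    apply div_nonneg _ (by linarith)
    have := mul_nonneg (by linarith : (0:ℚ) ≤ q) (by linarith : (0:ℚ) ≤ t - 1)
    linarith
  have m1 := mul_le_mul_of_nonneg_right (by linarith :
    (q:ℚ) - t ≤ ((nb H S x).filter fun v => q + t ≤ (nb H S v).card).card) pos
  have m2 : (q:ℚ) - 2 ≤ (q - t) * ((q * (t - 1) + 2) / (q + t)) := by
    rw [← mul_div_assoc, le_div_iff₀ (by linarith)]
    have := mul_nonneg (mul_nonneg (by linarith : (0:ℚ) ≤ q) (by linarith : (0:ℚ) ≤ t - 2)) (by linarith : (0:ℚ) ≤ q - 2 - t)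
    linarith
  rw [e] at l2
  linarith

theorem cl_one (hx : x ∈ S) (h : ¬ 2 ≤ (cl H S x).card) (hn : y ≠ x) : y ∉ cl H S x := fun k =>
  h (one_lt_card.2 ⟨y, k, x, cl_self hx, hn⟩)

theorem Ctx.q3 (c : Ctx q H S) (h3 : q = 3) : False := by
  have hq := c.hq
  have := c.disch (B := ∅) (C := S.filter fun v => (nb H S v).card ≠ q) (by simp) (by simp) (filter_subset _ _)
    (fun v hv => by rw [mem_filter] at hv; have := c.cr.deg hv.1; omega) (disjoint_empty_left _)
    (fun v hv k => Or.inr (mem_filter.2 ⟨hv, k⟩))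
  refine absurd this (not_lt.2 (add_nonneg (by positivity) (sum_nonneg fun x hx => ?_)))
  rw [mem_lw] at hx
  have dC : ∀ v ∈ S.filter fun v => (nb H S v).card ≠ q, q + 1 ≤ (nb H S v).card :=
    fun v hv => by rw [mem_filter] at hv; have := c.cr.deg hv.1; omega
  by_cases ht : 2 ≤ (cl H S x).card
  · exact c.LR hx.1 hx.2 ht dC (fun v hv k => mem_filter.2 ⟨hv, by omega⟩)
  have ns := nb_split H (filter_subset (fun v => (nb H S v).card ≠ q) S) x
  have : (nb H (S \ S.filter fun v => (nb H S v).card ≠ q) x).card ≤ 1 := by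
    have aux : ∀ y ∈ nb H (S \ S.filter fun v => (nb H S v).card ≠ q) x, Pr q H S x y := by
      intro y hy
      rw [mem_nb, mem_sdiff, mem_filter] at hy
      have dy : (nb H S y).card = q := by grind
      exact ⟨hx.1, hy.1.1, hx.2, dy, hy.2, cl_one hx.1 ht hy.2.ne.symm⟩
    rw [card_le_one]
    intro y hy z hz
    have p := aux z hz
    have p' := aux y hy
    exact p.uniq c p'.2.1 p'.2.2.2.2.1 p'.2.2.2.1
  have l2 := card_nsmul_le_sum (nb H (S.filter fun v => (nb H S v).card ≠ q) x) (rr q H S)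
    ((q:ℚ) - ((q:ℚ)^2 + q - 2) / (q + 1 : ℕ)) fun v hv => rr_ge hq (by omega) (dC v (mem_nb.1 hv).1)
  rw [nsmul_eq_mul] at l2
  have hz0 : 2 ≤ (nb H (S.filter fun v => (nb H S v).card ≠ q) x).card := by omega
  have hz : ((2:ℕ):ℚ) ≤ (nb H (S.filter fun v => (nb H S v).card ≠ q) x).card := Nat.cast_le.2 hz0
  subst h3
  have e3 : ((3:ℕ):ℚ) = 3 := by norm_num
  have e2 : ((2:ℕ):ℚ) = 2 := by norm_num
  have e4 : ((3:ℕ):ℚ) - (((3:ℕ):ℚ)^2 + (3:ℕ) - 2) / (3 + 1 : ℕ) = 1 / 2 := by norm_num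
  rw [e4] at l2
  rw [e3]
  rw [e2] at hz
  linarith

def Ind (H : SimpleGraph V) (X : Finset V) : Prop := ∀ u ∈ X, ∀ v ∈ X, ¬ H.Adj u v

theorem indep2 (P : Finset V) (hP : ∀ x ∈ P, ∀ y ∈ P, ∀ z ∈ P, H.Adj x y → H.Adj x z → y = z) :
    ∃ X ⊆ P, (∀ u ∈ X, ∀ v ∈ X, ¬ H.Adj u v) ∧ ∀ u ∈ P \ X, ∀ v ∈ P \ X, ¬ H.Adj u v := by
  obtain ⟨X, hX, hm⟩ := exists_max_image (P.powerset.filter (Ind H)) card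
    ⟨∅, by simp [Ind]⟩
  rw [mem_filter, mem_powerset] at hX
  refine ⟨X, hX.1, hX.2, fun u hu v hv huv => ?_⟩
  rw [mem_sdiff] at hu hv
  have key : ∀ w ∈ X, ¬ H.Adj u w := fun w hw e => hv.2 (by
    rw [hP u hu.1 v hv.1 w (hX.1 hw) huv e]; exact hw)
  have := hm (insert u X) (by
    rw [mem_filter, mem_powerset]
    refine ⟨insert_subset hu.1 hX.1, fun a ha b hb => ?_⟩
    rcases mem_insert.1 ha with e1 | ha' <;> rcases mem_insert.1 hb with e2 | hb'
    · rw [e1, e2]; exact fun e => e.ne rfl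
    · grind
    · rw [e2]; exact fun e => key a ha' e.symm
    · exact hX.2 a ha' b hb')
  rw [card_insert_of_notMem hu.2] at this
  omega

theorem Ctx.sumA (c : Ctx q H S) (hq : 4 ≤ q) : ∃ A P B : Finset V, A ⊆ S ∧ B ⊆ S ∧ Disjoint A P ∧
    (∀ v ∈ B, (nb H S v).card = q + 1) ∧ (∀ v ∈ S, (nb H S v).card = q + 1 → v ∈ B) ∧
    (∀ x ∈ A, (nb H S x).card = q ∧ ∀ y, ¬ Pr q H S x y) ∧ (∀ x ∈ P, ∃ y, Pr q H S x y) ∧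
    (∀ u ∈ A ∪ P, ∀ v ∈ A ∪ P, H.Adj u v → Pr q H S u v) ∧
    2 * B.card + 2 * A.card + P.card < ∑ x ∈ A, (nb H B x).card + ∑ x ∈ P, (nb H B x).card := by
  let B := S.filter fun v => (nb H S v).card = q + 1
  let C := S.filter fun v => q + 2 ≤ (nb H S v).card
  let L1 := (lw q H S).filter fun x => ¬ 2 ≤ (cl H S x).card
  let A := L1.filter fun x => ¬ ∃ y, Pr q H S x y
  let P := L1.filter fun x => ∃ y, Pr q H S x y
  have hd := c.disch (B := B) (C := C) (filter_subset _ _) (fun v hv => (mem_filter.1 hv).2) (filter_subset _ _)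
    (fun v hv => by have := (mem_filter.1 hv).2; omega)
    (Finset.disjoint_left.2 fun v h1 h2 => by have := (mem_filter.1 h1).2; have := (mem_filter.1 h2).2; omega)
    (fun v hv k => by
      have := c.cr.deg hv
      by_cases l : (nb H S v).card = q + 1
      · grind
      · exact Or.inr (mem_filter.2 ⟨hv, by omega⟩))
  have mA : ∀ x ∈ L1, x ∈ S ∧ (nb H S x).card = q ∧ ¬ 2 ≤ (cl H S x).card := fun x hx => by
    have := mem_filter.1 hx
    exact ⟨(mem_lw.1 this.1).1, (mem_lw.1 this.1).2, this.2⟩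
  have prA : ∀ u ∈ L1, ∀ v ∈ S, (nb H S v).card = q → H.Adj u v → Pr q H S u v := fun u hu v hv dv e =>
    ⟨(mA u hu).1, hv, (mA u hu).2.1, dv, e, cl_one (mA u hu).1 (mA u hu).2.2 e.ne.symm⟩
  have hone : ∀ x, ((nb H C x).card : ℚ) ≤ ∑ v ∈ nb H C x, rr q H S v := by
    intro x
    have l2 := card_nsmul_le_sum (nb H C x) (rr q H S) 1 fun v hv => by
      refine le_trans ?_ (rr_ge c.hq (d := q + 2) (by omega) (mem_filter.1 (mem_nb.1 hv).1).2)
      have : (0:ℚ) < q + 2 := by positivity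
      rw [show (((q + 2 : ℕ)):ℚ) = q + 2 by push_cast; ring, show ((q:ℚ)^2 + q - 2) = (q - 1) * (q + 2) by ring,
        mul_div_assoc, div_self this.ne']
      linarith
    simpa using l2
  have cov : ∀ x ∈ S, (nb H S x).card ≤ (nb H (lw q H S) x).card + (nb H B x).card + (nb H C x).card := by
    intro x hx
    refine (card_le_card (t := nb H (lw q H S) x ∪ nb H B x ∪ nb H C x) fun v hv => ?_).trans
      ((card_union_le _ _).trans (Nat.add_le_add_right (card_union_le _ _) _))
    rw [mem_nb] at hv
    have := c.cr.deg hv.1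
    simp only [mem_union, mem_nb, mem_lw, B, C, mem_filter, hv.1, hv.2, and_true, true_and]
    omega
  have gA : ∀ x ∈ A, 2 - ((nb H B x).card:ℚ) ≤ ∑ v ∈ nb H C x, rr q H S v - (q - 2) := by
    intro x hx
    have hx' := mem_filter.1 hx
    have h1 := cov x (mA x hx'.1).1
    have h0 : (nb H (lw q H S) x).card = 0 := by
      rw [card_eq_zero, eq_empty_iff_forall_notMem]
      intro y hy
      rw [mem_nb, mem_lw] at hy
      exact hx'.2 ⟨y, prA x hx'.1 y hy.1.1 hy.1.2 hy.2⟩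
    rw [(mA x hx'.1).2.1, h0] at h1
    have h2 : (q:ℚ) ≤ ((0 + (nb H B x).card + (nb H C x).card : ℕ):ℚ) := Nat.cast_le.2 h1
    have := hone x
    push_cast at h2
    linarith
  have gP : ∀ x ∈ P, 1 - ((nb H B x).card:ℚ) ≤ ∑ v ∈ nb H C x, rr q H S v - (q - 2) := by
    intro x hx
    have hx' := mem_filter.1 hx
    have h1 := cov x (mA x hx'.1).1
    have h0 : (nb H (lw q H S) x).card ≤ 1 := by
      obtain ⟨y, hy⟩ := hx'.2
      rw [card_le_one]
      intro a ha b hb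
      rw [mem_nb, mem_lw] at ha hb
      rw [hy.uniq c ha.1.1 ha.2 ha.1.2, hy.uniq c hb.1.1 hb.2 hb.1.2]
    rw [(mA x hx'.1).2.1] at h1
    have h2 : (q:ℚ) ≤ ((1 + (nb H B x).card + (nb H C x).card : ℕ):ℚ) := Nat.cast_le.2 (by omega)
    have := hone x
    push_cast at h2
    linarith
  have tot := sum_filter_add_sum_filter_not (lw q H S) (fun x => ¬ 2 ≤ (cl H S x).card)
    (fun x => ∑ v ∈ nb H C x, rr q H S v - ((q:ℚ) - 2))
  have tot2 := sum_filter_add_sum_filter_not L1 (fun x => ∃ y, Pr q H S x y)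
    (fun x => ∑ v ∈ nb H C x, rr q H S v - ((q:ℚ) - 2))
  have n2 : 0 ≤ ∑ x ∈ (lw q H S).filter fun x => ¬ ¬ 2 ≤ (cl H S x).card,
      (∑ v ∈ nb H C x, rr q H S v - ((q:ℚ) - 2)) := sum_nonneg fun x hx => by
    have hx' := mem_filter.1 hx
    have hx2 := mem_lw.1 hx'.1
    exact c.LR hx2.1 hx2.2 (not_not.1 hx'.2) (fun v hv => by have := (mem_filter.1 hv).2; omega)
      (fun v hv k => mem_filter.2 ⟨hv, k⟩)
  have sA := sum_le_sum gA
  have sP := sum_le_sum gP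
  rw [sum_sub_distrib, sum_const, nsmul_eq_mul] at sA sP
  refine ⟨A, P, B, fun x hx => (mA x (mem_filter.1 hx).1).1, filter_subset _ _, ?_, fun v hv => (mem_filter.1 hv).2,
    fun v hv k => mem_filter.2 ⟨hv, k⟩, ?_, fun x hx => (mem_filter.1 hx).2, ?_, ?_⟩
  · exact Finset.disjoint_left.2 fun x h1 h2 => (mem_filter.1 h1).2 (mem_filter.1 h2).2
  · grind
  · grind
  · change ∑ x ∈ L1, _ + _ = _ at tot
    change ∑ x ∈ P, _ + ∑ x ∈ A, _ = _ at tot2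
    have : (2:ℚ) * B.card + 2 * A.card + P.card < ∑ x ∈ A, ((nb H B x).card:ℚ) + ∑ x ∈ P, ((nb H B x).card:ℚ) := by
      linarith
    exact_mod_cast this

theorem Ctx.q4 (c : Ctx q H S) (hq : 4 ≤ q) : False := by
  obtain ⟨A, P, B, hA, hB, dis, dB, Bm, mA, mP, pr, lt⟩ := c.sumA hq
  have hP : P ⊆ S := fun x hx => (mP x hx).choose_spec.1
  have dP : ∀ x ∈ P, (nb H S x).card = q := fun x hx => (mP x hx).choose_spec.2.2.1
  have iA : ∀ u ∈ A, ∀ v ∈ A ∪ P, ¬ H.Adj u v := by grind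
  by_cases h5 : 5 ≤ q
  · have h1 := c.cr.TT (by omega) hA hB (fun v hv => (mA v hv).1) dB fun u hu v hv => iA u hu v (mem_union_left _ hv)
    have h2 : ∑ x ∈ P, (nb H B x).card ≤ P.card * 1 := by
      refine sum_le_card_nsmul _ _ _ fun x hx => ?_
      obtain ⟨y, hy⟩ := mP x hx
      refine (card_le_card fun v hv => ?_).trans (c.IL hy hy.symm hy.2.2.2.2.1.ne)
      rw [mem_nb] at hv
      have dv := dB v hv.1
      have hvy : v ≠ y := fun e => by rw [e, hy.2.2.2.1] at dv; omega
      have m1 := Pr.mem (hB hv.1) hv.2 hvy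
      refine mem_inter.2 ⟨m1, Pr.mem (hB hv.1) ?_ hv.2.ne.symm⟩
      by_contra k
      have := c.NN h5 hy m1 hv.2.ne.symm fun e => k e.symm
      omega
    omega
  have q4 : q = 4 := by omega
  obtain ⟨X, hX, iX, iY⟩ := indep2 (H := H) P fun x hx y hy z hz e1 e2 => by
    have p := pr x (mem_union_right _ hx) z (mem_union_right _ hz) e2
    exact p.uniq c (hP hy) e1 (dP y hy)
  have half : ∀ X ⊆ P, (∀ u ∈ X, ∀ v ∈ X, ¬ H.Adj u v) →
      ∑ x ∈ A, (nb H B x).card + ∑ x ∈ X, (nb H B x).card ≤ A.card + X.card + 2 * B.card := by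
    intro X hX iX
    have dX := disjoint_of_subset_right hX dis
    have := c.cr.TT (I := A ∪ X) (by omega) (union_subset hA (hX.trans hP)) hB (fun v hv => by
      rcases mem_union.1 hv with k | k
      · grind
      · exact dP v (hX k)) dB (fun u hu v hv => by
      rcases mem_union.1 hu with k | k
      · grind
      · rcases mem_union.1 hv with l | l
        · exact fun e => iA v l u (mem_union_right _ (hX k)) e.symm
        · exact iX u k v l)
    rwa [sum_union dX, card_union_of_disjoint dX] at this
  have h1 := half X hX iX
  have h2 := half (P \ X) sdiff_subset iY
  have h3 := sum_sdiff (f := fun x => (nb H B x).card) hX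
  have h4 := card_sdiff_add_card_eq_card hX
  have h5 : ∑ x ∈ A, (nb H B x).card ≤ A.card * 4 := by
    refine sum_le_card_nsmul _ _ _ fun x hx => ?_
    rw [← q4, ← (mA x hx).1]
    exact card_le_card fun v hv => mem_nb.2 ⟨hB (mem_nb.1 hv).1, (mem_nb.1 hv).2⟩
  have h6 : ∑ x ∈ P, (nb H B x).card ≤ B.card := by
    rw [← card_biUnion]
    · exact card_le_card (biUnion_subset.2 fun x _ => nb_sub)
    · intro x hx x' hx' hne
      refine Finset.disjoint_left.2 fun v hv hv' => ?_
      rw [mem_nb] at hv hv'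
      obtain ⟨y, hy⟩ := mP x hx
      obtain ⟨y', hy'⟩ := mP x' hx'
      have dv := dB v hv.1
      have m1 := Pr.mem (hB hv.1) hv.2 (y := y) fun e => by rw [e, hy.2.2.2.1] at dv; omega
      have m2 := Pr.mem (hB hv.1) hv'.2 (y := y') fun e => by rw [e, hy'.2.2.2.1] at dv; omega
      have il := c.IL hy hy' hne
      have sub : (XX H S x y ∪ XX H S x' y').erase v ⊆ nb H S v := by
        intro w hw
        obtain ⟨hw1, hw2⟩ := mem_erase.1 hw
        rcases mem_union.1 hw2 with k | k
        · exact mem_nb.2 ⟨hy.sub k, hy.clq c v m1 w k hw1.symm⟩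
        · exact mem_nb.2 ⟨hy'.sub k, hy'.clq c v m2 w k hw1.symm⟩
      have k1 := card_le_card sub
      rw [card_erase_of_mem (mem_union_left _ m1)] at k1
      have k2 := card_union_add_card_inter (XX H S x y) (XX H S x' y')
      rw [hy.card, hy'.card] at k2
      omega
  omega

theorem Ctx.false (c : Ctx q H S) : False := by
  have := c.hq
  rcases Nat.lt_or_ge q 4 with k | k
  · exact c.q3 (by omega)
  · exact c.q4 k

theorem yo (hq : 3 ≤ q) : yy q ≤ (q:ℤ)^2 - q - 2 := by
  have : (3:ℤ) ≤ q := by exact_mod_cast hq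
  unfold yy
  refine max_le ?_ ?_ <;> nlinarith

theorem E_le_sq (H : SimpleGraph V) (S : Finset V) : tw H S ≤ S.card ^ 2 := by
  unfold tw
  refine (card_filter_le _ _).trans ?_
  rw [card_product, sq]

theorem main (hq : 3 ≤ q) : ∀ (H : SimpleGraph V) (S : Finset V), Crit q H S → yy q < pot q H S → Ore q H S := by
  have wf : WellFounded fun p p' : SimpleGraph V × Finset V => Sm p.1 p.2 p'.1 p'.2 := by
    let m : SimpleGraph V × Finset V → ℕ ×ₗ (ℕ ×ₗ ℕ) := fun p =>
      toLex (p.2.card, toLex ((E p.1 p.2 p.2).toNat, p.2.card ^ 2 - tw p.1 p.2))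
    refine Subrelation.wf (r := InvImage (· < ·) m) ?_ (InvImage.wf m wellFounded_lt)
    intro p p' h
    show m p < m p'
    rw [Prod.Lex.lt_iff]
    rcases h with h | ⟨h1, h2⟩
    · exact Or.inl h
    · refine Or.inr ⟨h1, ?_⟩
      rw [Prod.Lex.lt_iff]
      have n1 := E_nn p.1 p.2 p.2
      have n2 := E_nn p'.1 p'.2 p'.2
      rcases h2 with h2 | ⟨h2, h3⟩
      · exact Or.inl (show (E p.1 p.2 p.2).toNat < (E p'.1 p'.2 p'.2).toNat by omega)
      · refine Or.inr ⟨show (E p.1 p.2 p.2).toNat = (E p'.1 p'.2 p'.2).toNat by rw [h2], ?_⟩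
        show p.2.card ^ 2 - tw p.1 p.2 < p'.2.card ^ 2 - tw p'.1 p'.2
        have := E_le_sq p.1 p.2
        rw [h1] at this ⊢
        omega
  intro H S
  refine wf.induction (C := fun p => Crit q p.1 p.2 → yy q < pot q p.1 p.2 → Ore q p.1 p.2) (H, S) ?_
  rintro ⟨H, S⟩ ih hc hp
  simp only at hc hp ⊢
  have card := hc.card (by omega)
  by_cases hs : S.card = q + 1
  · exact Ore.base hc hs
  by_cases ht : TC H S
  · exact (Ctx.false ⟨hq, hc, ht, hp, by omega, fun H' S' h => ih (H', S') h⟩).elim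
  obtain ⟨a, b, A, B, hcmp, c1, c2⟩ := dirac hq hc ht
  have k1 := c1.card (by omega)
  have k2 := c2.card (by omega)
  have ci := card_union_add_card_inter A B
  rw [hcmp.un, hcmp.int, card_pair hcmp.ne] at ci
  have cB := card_erase_add_one (hcmp.bB)
  have i1 := ih (H ⊔ star a {b}, A) (Or.inl (by simp only; omega)) c1
  have i2 := ih (mrg H a b, B.erase b) (Or.inl (by simp only; omega)) c2
  simp only at i1 i2
  have o1 : pot q (H ⊔ star a {b}) A ≤ (q:ℤ)^2 - q - 2 := by
    by_cases k : yy q < pot q (H ⊔ star a {b}) A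
    · rw [(i1 k).pot]
    · exact (not_lt.1 k).trans (yo hq)
  have o2 : pot q (mrg H a b) (B.erase b) ≤ (q:ℤ)^2 - q - 2 := by
    by_cases k : yy q < pot q (mrg H a b) (B.erase b)
    · rw [(i2 k).pot]
    · exact (not_lt.1 k).trans (yo hq)
  have hpS := (hcmp.pots (q := q)).2.2
  exact Ore.comp hc hcmp (i1 (by linarith)) (i2 (by linarith))

theorem final (hq : 3 ≤ q) (hc : Crit q H S) (ht : TC H S) (hs : S.card ≠ q + 1) : pot q H S ≤ yy q := by
  by_contra k
  have := hc.card (by omega)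
  exact Ctx.false ⟨hq, hc, ht, not_le.1 k, by omega, fun H' S' _ => main hq H' S'⟩
end KY

namespace KY
open Finset Classical

theorem br_crit {V : Type*} [Fintype V] {k : ℕ} (hk : 4 ≤ k) {G : SimpleGraph V} (hG : IsKCritical k G)
    (h3 : IsThreeConnected G) : Crit (k - 1) G univ := by
  have del : ∀ u v, G.Adj u v → ∃ f : V → Fin (k - 1), ∀ x y, G.Adj x y → f x = f y →
      (x = u ∧ y = v) ∨ (x = v ∧ y = u) := by
    intro u v e
    have hlt : G.deleteEdges {s(u, v)} < G := by
      refine lt_of_le_of_ne (SimpleGraph.deleteEdges_le _) fun k => ?_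
      have : (G.deleteEdges {s(u, v)}).Adj u v := by rw [k]; exact e
      simp [SimpleGraph.deleteEdges_adj] at this
    obtain ⟨f⟩ := hG.2 _ hlt
    refine ⟨f, fun x y hxy hf => ?_⟩
    by_contra hn
    refine f.valid (v := x) (w := y) ?_ hf
    rw [SimpleGraph.deleteEdges_adj]
    refine ⟨hxy, fun h => hn ?_⟩
    simpa using h
  refine ⟨?_, ?_, ?_⟩
  · rintro ⟨f, hf⟩
    have h1 : G.Colorable (k - 1) :=
      ⟨SimpleGraph.Coloring.mk f fun {u v} h => hf u (mem_univ _) v (mem_univ _) h⟩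
    have h2 := h1.chromaticNumber_le
    rw [hG.1] at h2
    have : k ≤ k - 1 := by exact_mod_cast h2
    omega
  · intro v _
    obtain ⟨w, hw⟩ : ∃ w, G.Adj v w := by
      have hcn := h3.2 ∅ (by simp)
      obtain ⟨u, hu⟩ := Fintype.exists_ne_of_one_lt_card (by have := h3.1; omega : 1 < Fintype.card V) v
      obtain ⟨p⟩ := hcn.preconnected ⟨v, by simp⟩ ⟨u, by simp⟩
      obtain ⟨d, -, h1, -⟩ := p.exists_boundary_dart {⟨v, by simp⟩} rfl (by
        intro h
        exact hu (congrArg Subtype.val h))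
      have h1' : d.fst.1 = v := congrArg Subtype.val h1
      have := d.adj
      refine ⟨d.snd.1, ?_⟩
      rw [← h1']
      exact this
    obtain ⟨f, hf⟩ := del v w hw
    refine ⟨f, fun x hx y hy e h => ?_⟩
    rcases hf x y e h with k | k
    · grind
    · grind
  · intro u _ v _ e
    obtain ⟨f, hf⟩ := del u v e
    exact ⟨f, fun x _ y _ => hf x y⟩

theorem br_tc {V : Type*} [Fintype V] {G : SimpleGraph V} (h3 : IsThreeConnected G) : TC G univ := by
  rintro A - B - dis ⟨a, ha⟩ ⟨b, hb⟩ hc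
  have hcn := h3.2 (↑(univ \ (A ∪ B)) : Set V) (by rw [Set.ncard_coe_finset]; exact hc)
  have key : ∀ x, x ∈ A ∪ B → x ∈ ((↑(univ \ (A ∪ B)) : Set V))ᶜ := fun x hx => by grind
  obtain ⟨p⟩ := hcn.preconnected ⟨a, key a (mem_union_left _ ha)⟩ ⟨b, key b (mem_union_right _ hb)⟩
  obtain ⟨d, -, h1, h2⟩ := p.exists_boundary_dart {x | x.1 ∈ A} ha (fun h => Finset.disjoint_left.1 dis h hb)
  refine ⟨d.fst.1, h1, d.snd.1, ?_, d.adj⟩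
  have h3 := d.snd.2
  rw [Set.mem_compl_iff, mem_coe, mem_sdiff] at h3
  have h4 : d.snd.1 ∈ A ∪ B := by grind
  exact (mem_union.1 h4).resolve_left h2

theorem br_pot {V : Type*} [Fintype V] [DecidableEq V] {k : ℕ} (hk : 4 ≤ k) (G : SimpleGraph V) [DecidableRel G.Adj] :
    potential k G Finset.univ = pot (k - 1) G univ := by
  have e1 : 2 * ((G.induce ((Finset.univ : Finset V) : Set V)).edgeFinset.card : ℤ) = E G univ univ := by
    rw [E_sum]
    have h1 := G.sum_degrees_eq_twice_card_edges
    have h2 : (G.induce ((Finset.univ : Finset V) : Set V)).edgeFinset.card = G.edgeFinset.card := by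
      have : ((Finset.univ : Finset V) : Set V) = Set.univ := coe_univ
      refine SimpleGraph.Iso.card_edgeFinset_eq ⟨⟨fun x => x.1, fun x => ⟨x, by simp⟩, fun x => rfl, fun x => rfl⟩, Iff.rfl⟩
    rw [h2]
    have h3 : ∑ v, ((nb G univ v).card : ℤ) = ((∑ v, G.degree v : ℕ) : ℤ) := by
      rw [Nat.cast_sum]
      refine sum_congr rfl fun v _ => ?_
      rw [← G.card_neighborFinset_eq_degree]
      congr 2
      ext w; simp [mem_nb]
    rw [h3, h1]; push_cast; ring
  have hz : ((k - 1 : ℕ) : ℤ) = k - 1 := by omega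
  unfold potential pot
  rw [← e1, hz]
  ring

end KY

/-- **Theorem.** Let `k ≥ 4` and let `G` be a `k`-critical graph that is 3-connected and not
isomorphic to `K_k`. Then `ρ_{k,G}(V(G)) ≤ y_k` where `y_k = max {2k-6, k²-5k+2}`. -/
theorem threeConnected_kCritical_potential_le {V : Type*} [Fintype V] [DecidableEq V] (k : ℕ)
    (hk : 4 ≤ k) (G : SimpleGraph V) [DecidableRel G.Adj] (hG : IsKCritical k G)
    (h3 : IsThreeConnected G) (hK : IsEmpty (G ≃g (⊤ : SimpleGraph (Fin k)))) :
    potential k G Finset.univ ≤ yk k := by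
  have hc := KY.br_crit hk hG h3
  have hz : ((k - 1 : ℕ) : ℤ) = k - 1 := by omega
  have hy : yk k = KY.yy (k - 1) := by
    unfold yk KY.yy
    rw [hz]; congr 1 <;> ring
  rw [KY.br_pot hk, hy]
  refine KY.final (by omega) hc (KY.br_tc h3) fun hs => ?_
  have hcl := hc.clq hs
  have hcard : Fintype.card V = k := by rw [← Finset.card_univ]; omega
  refine hK.false ⟨Fintype.equivFinOfCardEq hcard, ?_⟩
  intro a b
  simp only [SimpleGraph.top_adj, ne_eq, EmbeddingLike.apply_eq_iff_eq]
  exact ⟨fun h => hcl a (Finset.mem_univ _) b (Finset.mem_univ _) h, fun h => h.ne⟩
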